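/- arXiv:2210.09410 — 5 statements merged into one kernel-verified Lean document; each statement's English description precedes it below -/
import Mathlib

section
/- Let k : ℕ → ℕ satisfy k(n) ≤ n for all sufficiently large n, k(n) → ∞ as n → ∞, and k(n) · n² / 2^(k(n)² − k(n)) → 0 as n → ∞. Then the probability that a uniformly random picture of size n is reconstructible from its k(n)-deck tends to 1 as n → ∞. -/
open Filter

/-- The `k × k` subgrid of a picture `P` of size `n` with top-left offset `(i, j)`.
When `k ≤ n` and `i, j ≤ n - k`, the guard condition always holds and this is the
genuine subgrid `(a, b) ↦ P (i + a, j + b)`. -/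
def subgrid (n k : ℕ) (P : Fin n × Fin n → Bool) (i j : ℕ) : Fin k × Fin k → Bool :=
  fun p =>
    if h : i + (p.1 : ℕ) < n ∧ j + (p.2 : ℕ) < n then
      P (⟨i + (p.1 : ℕ), h.1⟩, ⟨j + (p.2 : ℕ), h.2⟩)
    else false

/-- The `k`-deck of a picture `P` of size `n`: the multiset, indexed over the
`(n - k + 1)²` pairs `(i, j)` with `0 ≤ i, j ≤ n - k`, of its `k × k` subgrids. -/
def deck (n k : ℕ) (P : Fin n × Fin n → Bool) : Multiset (Fin k × Fin k → Bool) :=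
  (Finset.univ : Finset (Fin (n - k + 1) × Fin (n - k + 1))).val.map
    (fun q => subgrid n k P (q.1 : ℕ) (q.2 : ℕ))

/-- A picture `P` of size `n` is reconstructible from its `k`-deck if every picture
of size `n` with the same `k`-deck equals `P`. -/
def Reconstructible (n k : ℕ) (P : Fin n × Fin n → Bool) : Prop :=
  ∀ P' : Fin n × Fin n → Bool, deck n k P' = deck n k P → P' = P

open scoped Classical in
/-- The probability, under the uniform distribution on the `2 ^ (n²)` pictures of
size `n`, that a random picture is reconstructible from its `k`-deck. -/
noncomputable def reconProb (n k : ℕ) : ℝ :=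
  (Finset.univ.filter fun P : Fin n × Fin n → Bool =>
      Reconstructible n k P).card / 2 ^ (n ^ 2)

namespace RP

/-- Extension of a picture to the plane. -/
def px (n : ℕ) (P : Fin n × Fin n → Bool) (c : ℤ × ℤ) : Bool :=
  if h : (0 ≤ c.1 ∧ c.1 < n) ∧ (0 ≤ c.2 ∧ c.2 < n) then
    P (⟨c.1.toNat, by omega⟩, ⟨c.2.toNat, by omega⟩) else false

/-- Embedding of the cells into the plane. -/
def em (n : ℕ) (v : Fin n × Fin n) : ℤ × ℤ := ((v.1 : ℕ), (v.2 : ℕ))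

lemma px_em (n : ℕ) (P : Fin n × Fin n → Bool) (v : Fin n × Fin n) : px n P (em n v) = P v := by
  unfold px em
  have h1 := v.1.2
  have h2 := v.2.2
  rw [dif_pos ⟨⟨by simp, by simp⟩, ⟨by simp, by simp⟩⟩]
  simp

/-- The box of the cells. -/
noncomputable def box (n : ℤ) : Finset (ℤ × ℤ) := Finset.Ico 0 n ×ˢ Finset.Ico 0 n

lemma mem_box {n : ℤ} {c : ℤ × ℤ} : c ∈ box n ↔ (0 ≤ c.1 ∧ c.1 < n) ∧ (0 ≤ c.2 ∧ c.2 < n) := by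
  simp [box]

lemma card_box (n : ℕ) : (box n).card = n ^ 2 := by
  simp [box, sq]

lemma exists_em {n : ℕ} {c : ℤ × ℤ} (h : c ∈ box n) : ∃ v, em n v = c := by
  rw [mem_box] at h
  refine ⟨(⟨c.1.toNat, by omega⟩, ⟨c.2.toNat, by omega⟩), ?_⟩
  unfold em
  ext <;> simp <;> omega

lemma em_inj (n : ℕ) : Function.Injective (em n) := by
  intro a b h
  unfold em at h
  simp only [Prod.mk.injEq, Nat.cast_inj] at h
  ext
  · exact h.1
  · exact h.2

lemma em_mem (n : ℕ) (v) : em n v ∈ box n := by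
  rw [mem_box]
  unfold em
  have h1 := v.1.2
  have h2 := v.2.2
  simp

open scoped Classical in
/-- Probability. -/
noncomputable def pr (n : ℕ) (E : (Fin n × Fin n → Bool) → Prop) : ℝ :=
  (Finset.univ.filter fun P => E P).card / 2 ^ (n ^ 2)

lemma pr_eq (n : ℕ) (E : (Fin n × Fin n → Bool) → Prop) [DecidablePred E] :
    pr n E = (Finset.univ.filter fun P => E P).card / 2 ^ (n ^ 2) := by
  unfold pr
  congr!

lemma pr_nonneg (n : ℕ) (E) : 0 ≤ pr n E := by unfold pr; positivity

lemma pr_mono {n : ℕ} {E F : (Fin n × Fin n → Bool) → Prop} (h : ∀ P, E P → F P) :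
    pr n E ≤ pr n F := by
  unfold pr
  gcongr with P hP
  exact h P

lemma pr_or {n : ℕ} (E F : (Fin n × Fin n → Bool) → Prop) :
    pr n (fun P => E P ∨ F P) ≤ pr n E + pr n F := by
  classical
  simp only [pr_eq]
  rw [← add_div]
  gcongr
  rw [Finset.filter_or]
  exact_mod_cast Finset.card_union_le _ _

lemma pr_exists {n : ℕ} {ι : Type*} (s : Finset ι) (E : ι → (Fin n × Fin n → Bool) → Prop) :
    pr n (fun P => ∃ i ∈ s, E i P) ≤ ∑ i ∈ s, pr n (E i) := by
  classical
  simp only [pr_eq]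
  rw [← Finset.sum_div]
  gcongr
  have : (Finset.univ.filter fun P => ∃ i ∈ s, E i P) =
      s.biUnion fun i => Finset.univ.filter fun P => E i P := by
    ext P; simp
  rw [this]
  exact_mod_cast Finset.card_biUnion_le

lemma pr_exists_le {n : ℕ} {ι : Type*} (s : Finset ι) (E : ι → (Fin n × Fin n → Bool) → Prop)
    (p : ℝ) (h : ∀ i ∈ s, pr n (E i) ≤ p) :
    pr n (fun P => ∃ i ∈ s, E i P) ≤ s.card * p := by
  refine (pr_exists s E).trans ((Finset.sum_le_sum h).trans ?_)
  simp

lemma pr_le_one (n : ℕ) (E) : pr n E ≤ 1 := by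
  classical
  unfold pr
  rw [div_le_one (by positivity)]
  have := Finset.card_le_univ (Finset.univ.filter fun P => E P)
  have h2 : Fintype.card (Fin n × Fin n → Bool) = 2 ^ (n ^ 2) := by
    simp [sq]
  rw [h2] at this
  exact_mod_cast this

lemma pr_not (n : ℕ) (E) : pr n E = 1 - pr n (fun P => ¬ E P) := by
  classical
  unfold pr
  have h := Finset.card_filter_add_card_filter_not (s := (Finset.univ : Finset (Fin n × Fin n → Bool)))
    (fun P => E P)
  have h2 : Fintype.card (Fin n × Fin n → Bool) = 2 ^ (n ^ 2) := by
    simp [sq]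
  rw [Finset.card_univ, h2] at h
  have h3 : ((Finset.univ.filter fun P => E P).card : ℝ) +
    (Finset.univ.filter fun P => ¬ E P).card = 2 ^ (n ^ 2) := by exact_mod_cast h
  rw [← h3]
  have h4 : ((Finset.univ.filter fun P => E P).card : ℝ) +
    (Finset.univ.filter fun P => ¬ E P).card ≠ 0 := by rw [h3]; positivity
  field_simp
  ring

lemma pr_zero {n : ℕ} {E : (Fin n × Fin n → Bool) → Prop} (h : ∀ P, ¬ E P) : pr n E = 0 := by
  unfold pr
  simp [h]

lemma pr_comp {n : ℕ} (E : (Fin n × Fin n → Bool) → Prop) (σ : Equiv.Perm (Fin n × Fin n)) :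
    pr n (fun P => E (fun v => P (σ v))) = pr n E := by
  classical
  unfold pr
  congr 2
  refine Finset.card_bij (fun P _ => fun v => P (σ v)) ?_ ?_ ?_
  · intro P hP; simpa using hP
  · intro P _ Q _ h
    funext v
    have := congrFun h (σ.symm v)
    simpa using this
  · intro P hP
    refine ⟨fun v => P (σ.symm v), ?_, ?_⟩
    · simpa using hP
    · funext v; simp

lemma glb0 {V : Type*} [Fintype V] [DecidableEq V] (S : Finset V) (g : V → V) (b : V → Bool)
    (r : V → ℤ) (hr : ∀ c ∈ S, r (g c) < r c) (F : Finset (V → Bool))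
    (hF : ∀ P ∈ F, ∀ c ∈ S, P c = xor (P (g c)) (b c)) :
    F.card * 2 ^ S.card ≤ 2 ^ (Fintype.card V) := by
  have h1 : F.card ≤ Fintype.card ({c : V // c ∉ S} → Bool) := by
    rw [← Finset.card_univ]
    refine Finset.card_le_card_of_injOn (fun P c => P c.1) (by simp) ?_
    intro P hP Q hQ h
    by_contra hne
    have hex : (Finset.univ.filter fun c => P c ≠ Q c).Nonempty := by
      obtain ⟨c, hc⟩ := Function.ne_iff.mp hne
      exact ⟨c, by simpa using hc⟩
    obtain ⟨c, hc, hmin⟩ := Finset.exists_min_image _ r hex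
    have hcne : P c ≠ Q c := by simpa using hc
    have hcS : c ∈ S := by
      by_contra hcS
      exact hcne (congrFun h ⟨c, hcS⟩)
    have : P (g c) = Q (g c) := by
      by_contra hg
      have := hmin (g c) (by simpa using hg)
      exact absurd (hr c hcS) (by omega)
    exact hcne (by rw [hF P hP c hcS, hF Q hQ c hcS, this])
  have h2 : Fintype.card ({c : V // c ∉ S} → Bool) * 2 ^ S.card = 2 ^ (Fintype.card V) := by
    rw [Fintype.card_fun, Fintype.card_bool, ← pow_add, Fintype.card_subtype_compl]
    congr 1
    have := Finset.card_le_univ S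
    simp
    omega
  calc _ ≤ _ := Nat.mul_le_mul_right _ h1
    _ = _ := h2

lemma glb {n : ℕ} (S : Finset (ℤ × ℤ)) (g : ℤ × ℤ → ℤ × ℤ) (b : ℤ × ℤ → Bool) (r : ℤ × ℤ → ℤ)
    (hS : ∀ c ∈ S, c ∈ box n) (hg : ∀ c ∈ S, g c ∈ box n) (hr : ∀ c ∈ S, r (g c) < r c) :
    pr n (fun P => ∀ c ∈ S, px n P c = xor (px n P (g c)) (b c)) ≤ (1 / 2) ^ S.card := by
  classical
  set S' : Finset (Fin n × Fin n) := Finset.univ.filter fun v => em n v ∈ S with hS'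
  have hcard : S'.card = S.card := by
    refine Finset.card_bij (fun v _ => em n v) ?_ ?_ ?_
    · intro v hv; simpa [hS'] using hv
    · intro v _ w _ h; exact em_inj n h
    · intro c hc
      obtain ⟨v, hv⟩ := exists_em (hS c hc)
      exact ⟨v, by simp [hS', hv, hc], hv⟩
  have hch : ∀ v : Fin n × Fin n, ∃ w : Fin n × Fin n, em n v ∈ S → em n w = g (em n v) := by
    intro v
    by_cases hv : em n v ∈ S
    · obtain ⟨w, hw⟩ := exists_em (hg _ hv)
      exact ⟨w, fun _ => hw⟩
    · exact ⟨v, fun h => absurd h hv⟩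
  choose g' hg' using hch
  have := glb0 S' g' (fun v => b (em n v)) (fun v => r (em n v))
    (by
      intro c hc
      have hc : em n c ∈ S := by simpa [hS'] using hc
      rw [hg' c hc]; exact hr _ hc)
    (Finset.univ.filter fun P => ∀ c ∈ S, px n P c = xor (px n P (g c)) (b c))
    (by
      intro P hP c hc
      have hc : em n c ∈ S := by simpa [hS'] using hc
      have hP := (Finset.mem_filter.mp hP).2 _ hc
      rw [← hg' c hc, px_em, px_em] at hP
      exact hP)
  rw [pr_eq]
  rw [hcard] at this
  have hV : Fintype.card (Fin n × Fin n) = n ^ 2 := by simp [sq]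
  rw [hV] at this
  rw [div_le_iff₀ (by positivity), one_div, inv_pow, inv_mul_eq_div, le_div_iff₀ (by positivity)]
  exact_mod_cast this

/-- Linear functional. -/
def ell (n : ℤ) (c : ℤ × ℤ) : ℤ := c.1 * (2 * n) + c.2

lemma ell_add (n : ℤ) (a b : ℤ × ℤ) : ell n (a + b) = ell n a + ell n b := by
  simp [ell]; ring

lemma ell_sub (n : ℤ) (a b : ℤ × ℤ) : ell n (a - b) = ell n a - ell n b := by
  simp [ell]; ring

lemma ell_ne_zero {n : ℤ} {d : ℤ × ℤ} (h1 : d.2 < 2 * n) (h2 : - (2 * n) < d.2) (h : d ≠ 0) :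
    ell n d ≠ 0 := by
  intro he
  unfold ell at he
  apply h
  have h1 : d.1 = 0 := by
    by_contra hne
    rcases lt_or_gt_of_ne hne with h | h
    · have : d.1 * (2 * n) ≤ (-1) * (2 * n) := by
        apply mul_le_mul_of_nonneg_right <;> omega
      nlinarith
    · have : d.1 * (2 * n) ≥ 1 * (2 * n) := by
        apply mul_le_mul_of_nonneg_right <;> omega
      nlinarith
  rw [h1] at he
  ext
  · exact h1
  · simp at he ⊢; exact he

lemma ell_ne {n : ℤ} {a b : ℤ × ℤ} (ha : a ∈ box n) (hb : b ∈ box n) (h : a ≠ b) :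
    ell n a ≠ ell n b := by
  rw [mem_box] at ha hb
  have := ell_ne_zero (n := n) (d := a - b) (by simp; omega) (by simp; omega) (sub_ne_zero.mpr h)
  rw [ell_sub] at this
  omega

end RP

namespace RP

/-- Equality of two rectangles. -/
def Eqr (w h : ℤ) (p q : ℤ × ℤ → Bool) (x y : ℤ × ℤ) : Prop :=
  ∀ a b : ℤ, 0 ≤ a → a < w → 0 ≤ b → b < h → p (x.1 + a, x.2 + b) = q (y.1 + a, y.2 + b)

/-- A rectangle valid inside the picture. -/
def Vd (n w h : ℤ) (z : ℤ × ℤ) : Prop := 0 ≤ z.1 ∧ z.1 + w ≤ n ∧ 0 ≤ z.2 ∧ z.2 + h ≤ n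

/-- Uniqueness of a rectangle. -/
def Uq (n w h : ℤ) (p : ℤ × ℤ → Bool) (z : ℤ × ℤ) : Prop :=
  ∀ z', Vd n w h z' → Eqr w h p p z z' → z' = z

/-- The window relation. -/
def WR (n k : ℤ) (p' p : ℤ × ℤ → Bool) : Prop :=
  ∀ x, Vd n k k x → ∃ y, Vd n k k y ∧ Eqr k k p' p x y

lemma deck_WR {n k : ℕ} (hkn : k ≤ n) {P P' : Fin n × Fin n → Bool} (h : deck n k P' = deck n k P) :
    WR n k (px n P') (px n P) := by
  intro x hx
  unfold Vd at hx
  have hmem : subgrid n k P' x.1.toNat x.2.toNat ∈ deck n k P' := by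
    unfold deck
    rw [Multiset.mem_map]
    exact ⟨(⟨x.1.toNat, by omega⟩, ⟨x.2.toNat, by omega⟩), by simp, by simp⟩
  rw [h] at hmem
  unfold deck at hmem
  rw [Multiset.mem_map] at hmem
  obtain ⟨q, -, hq⟩ := hmem
  have hq1 := q.1.2
  have hq2 := q.2.2
  refine ⟨((q.1 : ℕ), (q.2 : ℕ)), ?_, ?_⟩
  · unfold Vd; simp only; omega
  intro a b ha ha' hb hb'
  have := congrFun hq (⟨a.toNat, by omega⟩, ⟨b.toNat, by omega⟩)
  unfold subgrid at this
  simp only at this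
  rw [dif_pos (by omega), dif_pos (by omega)] at this
  unfold px
  rw [dif_pos (by simp only; omega), dif_pos (by simp only; omega)]
  convert this.symm using 3 <;> simp <;> omega

lemma px_ext {n : ℕ} {P P' : Fin n × Fin n → Bool} (h : ∀ c ∈ box n, px n P' c = px n P c) :
    P' = P := by
  funext v
  have := h (em n v) (em_mem n v)
  rwa [px_em, px_em] at this

section steps
variable {n k : ℤ} {p p' : ℤ × ℤ → Bool} (H : WR n k p' p) {x y : ℤ × ℤ}
  (hxy : Eqr k k p' p x y)
include H hxy

lemma stepR (hx : Vd n k k (x.1 + 1, x.2)) (hu : Uq n (k - 1) k p (y.1 + 1, y.2)) :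
    Vd n k k (y.1 + 1, y.2) ∧ Eqr k k p' p (x.1 + 1, x.2) (y.1 + 1, y.2) := by
  obtain ⟨w, hw, hxw⟩ := H _ hx
  have : w = (y.1 + 1, y.2) := by
    apply hu w
    · unfold Vd at hw ⊢; omega
    intro a b ha ha' hb hb'
    have h1 := hxw a b (by omega) (by omega) (by omega) (by omega)
    have h2 := hxy (a + 1) b (by omega) (by omega) (by omega) (by omega)
    simp only at h1 h2 ⊢
    rw [← h1, show y.1 + 1 + a = y.1 + (a + 1) by ring, ← h2]
    congr 2; ring
  rw [← this]
  exact ⟨hw, hxw⟩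

lemma stepL (hx : Vd n k k (x.1 - 1, x.2)) (hu : Uq n (k - 1) k p y) :
    Vd n k k (y.1 - 1, y.2) ∧ Eqr k k p' p (x.1 - 1, x.2) (y.1 - 1, y.2) := by
  obtain ⟨w, hw, hxw⟩ := H _ hx
  have : (w.1 + 1, w.2) = y := by
    apply hu
    · unfold Vd at hw ⊢; simp only; omega
    intro a b ha ha' hb hb'
    have h1 := hxw (a + 1) b (by omega) (by omega) (by omega) (by omega)
    have h2 := hxy a b (by omega) (by omega) (by omega) (by omega)
    simp only at h1 h2 ⊢
    rw [← h2, show w.1 + 1 + a = w.1 + (a + 1) by ring, ← h1]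
    congr 2; ring
  have h3 : w = (y.1 - 1, y.2) := by rw [← this]; simp
  rw [← h3]
  exact ⟨hw, hxw⟩

lemma stepU (hx : Vd n k k (x.1, x.2 + 1)) (hu : Uq n k (k - 1) p (y.1, y.2 + 1)) :
    Vd n k k (y.1, y.2 + 1) ∧ Eqr k k p' p (x.1, x.2 + 1) (y.1, y.2 + 1) := by
  obtain ⟨w, hw, hxw⟩ := H _ hx
  have : w = (y.1, y.2 + 1) := by
    apply hu w
    · unfold Vd at hw ⊢; omega
    intro a b ha ha' hb hb'
    have h1 := hxw a b (by omega) (by omega) (by omega) (by omega)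
    have h2 := hxy a (b + 1) (by omega) (by omega) (by omega) (by omega)
    simp only at h1 h2 ⊢
    rw [← h1, show y.2 + 1 + b = y.2 + (b + 1) by ring, ← h2]
    congr 2; ring
  rw [← this]
  exact ⟨hw, hxw⟩

lemma stepD (hx : Vd n k k (x.1, x.2 - 1)) (hu : Uq n k (k - 1) p y) :
    Vd n k k (y.1, y.2 - 1) ∧ Eqr k k p' p (x.1, x.2 - 1) (y.1, y.2 - 1) := by
  obtain ⟨w, hw, hxw⟩ := H _ hx
  have : (w.1, w.2 + 1) = y := by
    apply hu
    · unfold Vd at hw ⊢; simp only; omega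
    intro a b ha ha' hb hb'
    have h1 := hxw a (b + 1) (by omega) (by omega) (by omega) (by omega)
    have h2 := hxy a b (by omega) (by omega) (by omega) (by omega)
    simp only at h1 h2 ⊢
    rw [← h2, show w.2 + 1 + b = w.2 + (b + 1) by ring, ← h1]
    congr 2; ring
  have h3 : w = (y.1, y.2 - 1) := by rw [← this]; simp
  rw [← h3]
  exact ⟨hw, hxw⟩

end steps
end RP

namespace RP

section walks
variable {n k : ℤ} {p p' : ℤ × ℤ → Bool} (H : WR n k p' p) {x y : ℤ × ℤ}
  (hx0 : Vd n k k x) (hy0 : Vd n k k y)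
  (hxy : Eqr k k p' p x y)
include H hx0 hy0 hxy

lemma walkR (t : ℕ) (hx : Vd n k k (x.1 + t, x.2))
    (hu : ∀ i : ℤ, 1 ≤ i → i ≤ t → Uq n (k - 1) k p (y.1 + i, y.2)) :
    Vd n k k (y.1 + t, y.2) ∧ Eqr k k p' p (x.1 + t, x.2) (y.1 + t, y.2) := by
  induction t with
  | zero => simpa using ⟨hy0, hxy⟩
  | succ t ih =>
    have hx' : Vd n k k (x.1 + t, x.2) := by
      unfold Vd at *; push_cast at *; omega
    obtain ⟨h1, h2⟩ := ih hx' (fun i hi hi' => hu i hi (by push_cast; omega))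
    have := stepR H h2 (by push_cast at hx; simpa [add_assoc] using hx)
      (by have := hu (t + 1) (by omega) (by push_cast; omega); simpa [add_assoc] using this)
    push_cast
    simpa [add_assoc] using this

lemma walkL (t : ℕ) (hx : Vd n k k (x.1 - t, x.2))
    (hu : ∀ i : ℤ, 0 ≤ i → i < t → Uq n (k - 1) k p (y.1 - i, y.2)) :
    Vd n k k (y.1 - t, y.2) ∧ Eqr k k p' p (x.1 - t, x.2) (y.1 - t, y.2) := by
  induction t with
  | zero => simpa using ⟨hy0, hxy⟩
  | succ t ih =>
    have hx' : Vd n k k (x.1 - t, x.2) := by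
      unfold Vd at *; push_cast at *; omega
    obtain ⟨h1, h2⟩ := ih hx' (fun i hi hi' => hu i hi (by push_cast; omega))
    have := stepL H h2 (by push_cast at hx; simpa [sub_sub] using hx)
      (hu t (by omega) (by push_cast; omega))
    push_cast
    simpa [sub_sub] using this

lemma walkU (t : ℕ) (hx : Vd n k k (x.1, x.2 + t))
    (hu : ∀ i : ℤ, 1 ≤ i → i ≤ t → Uq n k (k - 1) p (y.1, y.2 + i)) :
    Vd n k k (y.1, y.2 + t) ∧ Eqr k k p' p (x.1, x.2 + t) (y.1, y.2 + t) := by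
  induction t with
  | zero => simpa using ⟨hy0, hxy⟩
  | succ t ih =>
    have hx' : Vd n k k (x.1, x.2 + t) := by
      unfold Vd at *; push_cast at *; omega
    obtain ⟨h1, h2⟩ := ih hx' (fun i hi hi' => hu i hi (by push_cast; omega))
    have := stepU H h2 (by push_cast at hx; simpa [add_assoc] using hx)
      (by have := hu (t + 1) (by omega) (by push_cast; omega); simpa [add_assoc] using this)
    push_cast
    simpa [add_assoc] using this

lemma walkD (t : ℕ) (hx : Vd n k k (x.1, x.2 - t))
    (hu : ∀ i : ℤ, 0 ≤ i → i < t → Uq n k (k - 1) p (y.1, y.2 - i)) :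
    Vd n k k (y.1, y.2 - t) ∧ Eqr k k p' p (x.1, x.2 - t) (y.1, y.2 - t) := by
  induction t with
  | zero => simpa using ⟨hy0, hxy⟩
  | succ t ih =>
    have hx' : Vd n k k (x.1, x.2 - t) := by
      unfold Vd at *; push_cast at *; omega
    obtain ⟨h1, h2⟩ := ih hx' (fun i hi hi' => hu i hi (by push_cast; omega))
    have := stepD H h2 (by push_cast at hx; simpa [sub_sub] using hx)
      (hu t (by omega) (by push_cast; omega))
    push_cast
    simpa [sub_sub] using this

end walks

/-- Rectangle of cells. -/
noncomputable def rc (w h : ℤ) (z : ℤ × ℤ) : Finset (ℤ × ℤ) :=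
  Finset.Ico z.1 (z.1 + w) ×ˢ Finset.Ico z.2 (z.2 + h)

lemma mem_rc {w h : ℤ} {z c : ℤ × ℤ} :
    c ∈ rc w h z ↔ (z.1 ≤ c.1 ∧ c.1 < z.1 + w) ∧ (z.2 ≤ c.2 ∧ c.2 < z.2 + h) := by
  simp [rc]

lemma card_rc (w h : ℤ) (z : ℤ × ℤ) : (rc w h z).card = w.toNat * h.toNat := by
  simp [rc]

lemma rc_box {n w h : ℤ} {z c : ℤ × ℤ} (hz : Vd n w h z) (hc : c ∈ rc w h z) : c ∈ box n := by
  rw [mem_rc] at hc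
  rw [mem_box]
  unfold Vd at hz
  omega

lemma Eqr_symm {w h : ℤ} {p : ℤ × ℤ → Bool} {x y : ℤ × ℤ} (H : Eqr w h p p x y) :
    Eqr w h p p y x := fun a b h1 h2 h3 h4 => (H a b h1 h2 h3 h4).symm

lemma Eqr_at {w h : ℤ} {p q : ℤ × ℤ → Bool} {x y c : ℤ × ℤ} (H : Eqr w h p q x y)
    (hc : c ∈ rc w h x) : p c = q (c + (y - x)) := by
  rw [mem_rc] at hc
  have := H (c.1 - x.1) (c.2 - x.2) (by omega) (by omega) (by omega) (by omega)
  convert this using 2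
  · ext <;> simp
  · ext <;> simp <;> ring

lemma eqr_pr {n : ℕ} {w h : ℤ} {z z' : ℤ × ℤ} (hz : Vd n w h z) (hz' : Vd n w h z')
    (hne : ell n z ≠ ell n z') :
    pr n (fun P => Eqr w h (px n P) (px n P) z z') ≤ (1 / 2) ^ (w.toNat * h.toNat) := by
  wlog hlt : ell n z < ell n z' generalizing z z'
  · have := this hz' hz hne.symm (by omega)
    refine le_trans (pr_mono ?_) this
    intro P; exact Eqr_symm
  have := glb (n := n) (rc w h z') (fun c => c + (z - z')) (fun _ => false) (ell n)
    (fun c hc => rc_box hz' hc)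
    (fun c hc => rc_box hz (by
      rw [mem_rc] at hc ⊢; simp; omega))
    (fun c hc => by rw [ell_add, ell_sub]; omega)
  rw [card_rc] at this
  refine le_trans (pr_mono ?_) this
  intro P hP c hc
  have := Eqr_at (Eqr_symm hP) hc
  simpa using this

lemma case1_det {n k : ℕ} (hk1 : 1 ≤ k) (hkn : k ≤ n) {P P' : Fin n × Fin n → Bool}
    (h : deck n k P' = deck n k P)
    (h1 : ∀ z, Vd n (k - 1) k z → Uq n (k - 1) k (px n P) z)
    (h2 : ∀ z, Vd n k (k - 1) z → Uq n k (k - 1) (px n P) z) : P' = P := by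
  have H := deck_WR hkn h
  have hv0 : Vd n k k (0, 0) := by unfold Vd; simp; omega
  obtain ⟨y, hy, hxy⟩ := H _ hv0
  have key : ∀ i j : ℕ, i + k ≤ n → j + k ≤ n → Vd n k k (y.1 + i, y.2 + j) ∧
      Eqr k k (px n P') (px n P) (i, j) (y.1 + i, y.2 + j) := by
    intro i
    induction i with
    | zero =>
      intro j
      induction j with
      | zero => intro _ _; simpa using ⟨hy, hxy⟩
      | succ j ih =>
        intro hi hj
        obtain ⟨h3, h4⟩ := ih hi (by omega)
        have := stepU H h4 (by unfold Vd; simp; omega) (h2 _ (by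
          unfold Vd at h3 ⊢; simp at h3 ⊢; omega))
        push_cast at this ⊢
        simpa [add_assoc] using this
    | succ i ih =>
      intro j hi hj
      obtain ⟨h3, h4⟩ := ih j (by omega) hj
      have := stepR H h4 (by unfold Vd; simp; omega) (h1 _ (by
          unfold Vd at h3 ⊢; simp at h3 ⊢; omega))
      push_cast at this ⊢
      simpa [add_assoc] using this
  have hyz : y = (0, 0) := by
    have := (key (n - k) (n - k) (by omega) (by omega)).1
    unfold Vd at this hy
    simp at this
    ext <;> simp <;> omega
  subst hyz
  apply px_ext
  intro c hc
  rw [mem_box] at hc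
  obtain ⟨-, h3⟩ := key (min c.1.toNat (n - k)) (min c.2.toNat (n - k)) (by omega) (by omega)
  have := Eqr_at (c := c) h3 (by rw [mem_rc]; simp only; omega)
  simpa using this

lemma case1_uq {n k : ℕ} {w h : ℤ} (N : ℕ) (hN : w.toNat * h.toNat = N) (hw : 1 ≤ w) (hh : 1 ≤ h) :
    pr n (fun P => ¬ ∀ z, Vd n w h z → Uq n w h (px n P) z) ≤ (n : ℝ) ^ 4 * (1 / 2) ^ N := by
  classical
  have hsub : ∀ z, Vd n w h z → z ∈ box n := by
    intro z hz; rw [mem_box]; unfold Vd at hz; omega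
  have h1 : pr n (fun P => ¬ ∀ z, Vd n w h z → Uq n w h (px n P) z) ≤
      pr n (fun P => ∃ q ∈ box n ×ˢ box n, (Vd n w h q.1 ∧ Vd n w h q.2 ∧ q.1 ≠ q.2) ∧
        Eqr w h (px n P) (px n P) q.1 q.2) := by
    apply pr_mono
    intro P hP
    unfold Uq at hP
    push Not at hP
    obtain ⟨z, hz, z', hz', he, hne⟩ := hP
    exact ⟨(z, z'), by simp [hsub z hz, hsub z' hz'], ⟨hz, hz', hne.symm⟩, he⟩
  refine h1.trans ((pr_exists_le _ _ ((1 / 2) ^ N) ?_).trans ?_)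
  · intro q _
    by_cases hq : (Vd n w h q.1 ∧ Vd n w h q.2 ∧ q.1 ≠ q.2)
    · refine le_trans (pr_mono ?_) (hN ▸ eqr_pr hq.1 hq.2.1
        (ell_ne (hsub _ hq.1) (hsub _ hq.2.1) hq.2.2))
      intro P hP; exact hP.2
    · rw [pr_zero (by tauto)]; positivity
  · rw [Finset.card_product, card_box]
    apply le_of_eq
    push_cast; ring

lemma case1 {n k : ℕ} (hk : 2 ≤ k) (hkn : k ≤ n) (hn : n ^ 5 ≤ 2 ^ (k ^ 2 - k)) :
    pr n (fun P => ¬ Reconstructible n k P) ≤ 2 / n := by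
  have hA := case1_uq (n := n) (k := k) (w := k - 1) (h := k) (k ^ 2 - k) (by
    rw [show ((k : ℤ) - 1).toNat = k - 1 by omega]; simp [Nat.sub_mul, sq]) (by omega) (by omega)
  have hB := case1_uq (n := n) (k := k) (w := k) (h := k - 1) (k ^ 2 - k) (by
    rw [show ((k : ℤ) - 1).toNat = k - 1 by omega]; simp [Nat.mul_sub, sq]) (by omega) (by omega)
  have hC : (n : ℝ) ^ 4 * (1 / 2) ^ (k ^ 2 - k) ≤ 1 / n := by
    have : (n : ℝ) ^ 5 ≤ 2 ^ (k ^ 2 - k) := by exact_mod_cast hn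
    have hn0 : (0 : ℝ) < n := by
      have : 0 < n := by omega
      exact_mod_cast this
    rw [one_div, inv_pow, le_div_iff₀ hn0, mul_right_comm, ← pow_succ, ← div_eq_mul_inv]
    rw [div_le_one (by positivity)]
    exact this
  refine le_trans (pr_mono ?_) ((pr_or _ _).trans ((add_le_add (hA.trans hC) (hB.trans hC)).trans ?_))
  · intro P hP
    by_contra hcon
    push Not at hcon
    exact hP (fun P' hd => case1_det (by omega) hkn hd hcon.1 hcon.2)
  · apply le_of_eq; ring

end RP

namespace RP

/-- Sup-distance at most `r`. -/
def nr (r : ℤ) (x y : ℤ × ℤ) : Prop :=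
  (x.1 - y.1 ≤ r ∧ y.1 - x.1 ≤ r) ∧ (x.2 - y.2 ≤ r ∧ y.2 - x.2 ≤ r)

/-- Scales. -/
def rr (i : ℕ) : ℤ := 20 * 32 ^ i

lemma rr_pos (i : ℕ) : 20 ≤ rr i := by
  unfold rr
  have : (1 : ℤ) ≤ 32 ^ i := one_le_pow₀ (by norm_num)
  omega

lemma rr_succ (i : ℕ) : rr (i + 1) = 32 * rr i := by
  unfold rr; ring

lemma rr_mono {i j : ℕ} (h : i ≤ j) : rr i ≤ rr j := by
  unfold rr
  have : (32 : ℤ) ^ i ≤ 32 ^ j := pow_le_pow_right₀ (by norm_num) h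
  omega

/-- Bad sites of level `i`. -/
def Bad (X : Set (ℤ × ℤ)) : ℕ → Set (ℤ × ℤ)
  | 0 => X
  | i + 1 => {x | x ∈ Bad X i ∧ ∃ y ∈ Bad X i, ¬ nr (rr i) x y ∧ nr (6 * rr i) x y}

/-- Bad sites of level exactly `i`. -/
def Lv (X : Set (ℤ × ℤ)) (i : ℕ) : Set (ℤ × ℤ) := {x | x ∈ Bad X i ∧ x ∉ Bad X (i + 1)}

/-- Core sites. -/
def Core (X : Set (ℤ × ℤ)) (I : ℕ) (a : ℤ × ℤ) : Prop :=
  ∀ i < I, ∀ q ∈ Lv X i, ¬ nr (rr i) a q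

/-- Adjacent sites. -/
def Adj (a b : ℤ × ℤ) : Prop :=
  (a.1 = b.1 ∧ (a.2 = b.2 + 1 ∨ b.2 = a.2 + 1)) ∨ (a.2 = b.2 ∧ (a.1 = b.1 + 1 ∨ b.1 = a.1 + 1))

/-- Coarse rectangle. -/
def InW (l u : ℤ × ℤ) (a : ℤ × ℤ) : Prop := (l.1 ≤ a.1 ∧ a.1 ≤ u.1) ∧ (l.2 ≤ a.2 ∧ a.2 ≤ u.2)

/-- A step avoiding `B`. -/
def Stp (l u : ℤ × ℤ) (B : Set (ℤ × ℤ)) (a b : ℤ × ℤ) : Prop :=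
  (InW l u a ∧ a ∉ B) ∧ (InW l u b ∧ b ∉ B) ∧ Adj a b

/-- Connection avoiding `B`. -/
def Con (l u : ℤ × ℤ) (B : Set (ℤ × ℤ)) : ℤ × ℤ → ℤ × ℤ → Prop := Relation.ReflTransGen (Stp l u B)

lemma Adj.symm {a b} (h : Adj a b) : Adj b a := by unfold Adj at *; omega

lemma Con.symm {l u B a b} (h : Con l u B a b) : Con l u B b a := by
  unfold Con at *
  induction h with
  | refl => exact Relation.ReflTransGen.refl
  | tail _ hst ih =>
    exact Relation.ReflTransGen.head ⟨hst.2.1, hst.1, hst.2.2.symm⟩ ih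

lemma con_col {l u B} (z s : ℤ) (t : ℕ) (h : ∀ v, s ≤ v → v ≤ s + t → InW l u (z, v) ∧ (z, v) ∉ B) :
    Con l u B (z, s) (z, s + t) := by
  induction t with
  | zero =>
    simp only [Nat.cast_zero, add_zero]
    exact Relation.ReflTransGen.refl
  | succ t ih =>
    refine Relation.ReflTransGen.tail (ih fun v h1 h2 => h v h1 (by push_cast; omega)) ?_
    refine ⟨h _ (by omega) (by push_cast; omega), h _ (by omega) (by omega), ?_⟩
    unfold Adj; left; simp; omega

lemma con_row {l u B} (z s : ℤ) (t : ℕ) (h : ∀ v, s ≤ v → v ≤ s + t → InW l u (v, z) ∧ (v, z) ∉ B) :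
    Con l u B (s, z) (s + t, z) := by
  induction t with
  | zero =>
    simp only [Nat.cast_zero, add_zero]
    exact Relation.ReflTransGen.refl
  | succ t ih =>
    refine Relation.ReflTransGen.tail (ih fun v h1 h2 => h v h1 (by push_cast; omega)) ?_
    refine ⟨h _ (by omega) (by push_cast; omega), h _ (by omega) (by omega), ?_⟩
    unfold Adj; right; simp; omega

lemma con_col2 {l u B} (z s t : ℤ)
    (h : ∀ v, min s t ≤ v → v ≤ max s t → InW l u (z, v) ∧ (z, v) ∉ B) :
    Con l u B (z, s) (z, t) := by
  rcases le_total s t with hst | hst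
  · have := con_col (l := l) (u := u) (B := B) z s (t - s).toNat
      (fun v h1 h2 => h v (by omega) (by omega))
    rwa [show s + ((t - s).toNat : ℤ) = t by omega] at this
  · have := con_col (l := l) (u := u) (B := B) z t (s - t).toNat
      (fun v h1 h2 => h v (by omega) (by omega))
    rw [show t + ((s - t).toNat : ℤ) = s by omega] at this
    exact this.symm

lemma con_row2 {l u B} (z s t : ℤ)
    (h : ∀ v, min s t ≤ v → v ≤ max s t → InW l u (v, z) ∧ (v, z) ∉ B) :
    Con l u B (s, z) (t, z) := by
  rcases le_total s t with hst | hst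
  · have := con_row (l := l) (u := u) (B := B) z s (t - s).toNat
      (fun v h1 h2 => h v (by omega) (by omega))
    rwa [show s + ((t - s).toNat : ℤ) = t by omega] at this
  · have := con_row (l := l) (u := u) (B := B) z t (s - t).toNat
      (fun v h1 h2 => h v (by omega) (by omega))
    rw [show t + ((s - t).toNat : ℤ) = s by omega] at this
    exact this.symm

/-- Annulus. -/
def Ann (l u : ℤ × ℤ) (r : ℤ) (q z : ℤ × ℤ) : Prop := InW l u z ∧ ¬ nr r z q ∧ nr (6 * r) z q

lemma ann_con {l u : ℤ × ℤ} {B : Set (ℤ × ℤ)} {r : ℤ} (hr : 1 ≤ r) {q w : ℤ × ℤ}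
    (h1 : 2 * r + 2 ≤ u.1 - l.1) (h2 : 2 * r + 2 ≤ u.2 - l.2)
    (hB : ∀ z, Ann l u r q z → z ∉ B) (hw : InW l u w) (hwq : nr r w q) {z z' : ℤ × ℤ}
    (hz : Ann l u r q z) (hz' : Ann l u r q z') : Con l u B z z' := by
  obtain ⟨c1, hc1⟩ : ∃ c1, (c1 = q.1 + r + 1 ∨ c1 = q.1 - r - 1) ∧ l.1 ≤ c1 ∧ c1 ≤ u.1 := by
    unfold InW nr at *
    by_cases h : q.1 + r + 1 ≤ u.1
    · exact ⟨q.1 + r + 1, by omega⟩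
    · exact ⟨q.1 - r - 1, by omega⟩
  obtain ⟨c2, hc2⟩ : ∃ c2, (c2 = q.2 + r + 1 ∨ c2 = q.2 - r - 1) ∧ l.2 ≤ c2 ∧ c2 ≤ u.2 := by
    unfold InW nr at *
    by_cases h : q.2 + r + 1 ≤ u.2
    · exact ⟨q.2 + r + 1, by omega⟩
    · exact ⟨q.2 - r - 1, by omega⟩
  have key : ∀ z, Ann l u r q z → Con l u B z (c1, c2) := by
    rintro ⟨z1, z2⟩ hz
    by_cases h : z1 - q.1 ≤ r ∧ q.1 - z1 ≤ r
    · have a1 : Con l u B (z1, z2) (c1, z2) := by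
        apply con_row2
        intro v hv1 hv2
        have : Ann l u r q (v, z2) := by
          unfold Ann InW nr at *; simp only at *; omega
        exact ⟨this.1, hB _ this⟩
      have a2 : Con l u B (c1, z2) (c1, c2) := by
        apply con_col2
        intro v hv1 hv2
        have : Ann l u r q (c1, v) := by
          unfold Ann InW nr at *; simp only at *; omega
        exact ⟨this.1, hB _ this⟩
      exact Relation.ReflTransGen.trans a1 a2
    · have a1 : Con l u B (z1, z2) (z1, c2) := by
        apply con_col2
        intro v hv1 hv2
        have : Ann l u r q (z1, v) := by
          unfold Ann InW nr at *; simp only at *; omega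
        exact ⟨this.1, hB _ this⟩
      have a2 : Con l u B (z1, c2) (c1, c2) := by
        apply con_row2
        intro v hv1 hv2
        have : Ann l u r q (v, c2) := by
          unfold Ann InW nr at *; simp only at *; omega
        exact ⟨this.1, hB _ this⟩
      exact Relation.ReflTransGen.trans a1 a2
  exact Relation.ReflTransGen.trans (key z hz) (key z' hz').symm

lemma ann_common {l u : ℤ × ℤ} {r : ℤ} (hr : 1 ≤ r) {p p' q q' : ℤ × ℤ}
    (h1 : 4 * r + 4 ≤ u.1 - l.1)
    (hp : InW l u p) (hpq : nr r p q) (hp' : InW l u p') (hpp' : nr 1 p p')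
    (hpq' : nr r p' q') (hqq : nr r q q') : ∃ z, Ann l u r q z ∧ Ann l u r q' z := by
  unfold Ann InW nr at *
  by_cases h : max q.1 q'.1 + r + 1 ≤ u.1
  · exact ⟨(max q.1 q'.1 + r + 1, p.2), by simp only; omega⟩
  · exact ⟨(min q.1 q'.1 - r - 1, p.2), by simp only; omega⟩

lemma nr_symm {r x y} (h : nr r x y) : nr r y x := by unfold nr at *; omega
lemma nr_self {r : ℤ} (hr : 0 ≤ r) (x) : nr r x x := by unfold nr; omega

lemma con_level {l u : ℤ × ℤ} {B B' : Set (ℤ × ℤ)} {r : ℤ} (hr : 2 ≤ r)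
    (h1 : 4 * r + 4 ≤ u.1 - l.1) (h2 : 4 * r + 4 ≤ u.2 - l.2)
    (hL : ∀ q ∈ B, q ∉ B' → ∀ y ∈ B, nr (6 * r) q y → nr r q y)
    {a b : ℤ × ℤ}
    (hac : ∀ q ∈ B, q ∉ B' → ¬ nr r a q) (hbc : ∀ q ∈ B, q ∉ B' → ¬ nr r b q)
    (hab : Con l u B' a b) : Con l u B a b := by
  have hAB : ∀ q ∈ B, q ∉ B' → ∀ z, Ann l u r q z → z ∉ B := by
    intro q hq hq' z hz hzB
    exact hz.2.1 (nr_symm (hL q hq hq' z hzB (nr_symm hz.2.2)))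
  have inv : ((∀ q ∈ B, q ∉ B' → ¬ nr r b q) → Con l u B a b) ∧
      (∀ q ∈ B, q ∉ B' → nr r b q → ∀ z, Ann l u r q z → Con l u B a z) := by
    clear hbc
    unfold Con at hab
    induction hab with
    | refl => exact ⟨fun _ => Relation.ReflTransGen.refl, fun q hq hq' h => absurd h (hac q hq hq')⟩
    | @tail p p' _ hst ih =>
      obtain ⟨⟨hpW, hpB⟩, ⟨hpW', hpB'⟩, hadj⟩ := hst
      have hnr : nr 1 p p' := by unfold Adj nr at *; omega
      refine ⟨?_, ?_⟩
      · intro hout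
        have hpB2 : p' ∉ B := fun h => hout p' h hpB' (nr_self (by omega) _)
        by_cases hp : ∀ q ∈ B, q ∉ B' → ¬ nr r p q
        · have hpB3 : p ∉ B := fun h => hp p h hpB (nr_self (by omega) _)
          exact Relation.ReflTransGen.tail (ih.1 hp) ⟨⟨hpW, hpB3⟩, ⟨hpW', hpB2⟩, hadj⟩
        · push Not at hp
          obtain ⟨q, hq, hq', hpq⟩ := hp
          refine ih.2 q hq hq' hpq p' ⟨hpW', hout q hq hq', ?_⟩
          unfold nr at *; omega
      · intro q' hq' hqB' hpq' z hz
        by_cases hpb : nr r p q'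
        · exact ih.2 q' hq' hqB' hpb z hz
        have hpA : Ann l u r q' p := by
          refine ⟨hpW, hpb, ?_⟩
          unfold nr at *; omega
        have hcon : ∀ w, Ann l u r q' w → Con l u B w z := fun w hw =>
          ann_con (by omega) (by omega) (by omega) (hAB q' hq' hqB') hpW' hpq' hw hz
        by_cases hp : ∀ q ∈ B, q ∉ B' → ¬ nr r p q
        · exact Relation.ReflTransGen.trans (ih.1 hp) (hcon p hpA)
        · push Not at hp
          obtain ⟨q, hq, hqB, hpq⟩ := hp
          have hqq : nr r q q' := hL q hq hqB q' hq' (by unfold nr at *; omega)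
          obtain ⟨w, hw, hw'⟩ := ann_common (by omega) h1 hpW hpq hpW' hnr hpq' hqq
          exact Relation.ReflTransGen.trans (ih.2 q hq hqB hpq w hw) (hcon w hw')
  exact inv.1 hbc

lemma con_core {l u : ℤ × ℤ} {X : Set (ℤ × ℤ)} {I : ℕ} (hI : Bad X I = ∅)
    (h1 : 4 * rr I + 4 ≤ u.1 - l.1) (h2 : 4 * rr I + 4 ≤ u.2 - l.2)
    {a b : ℤ × ℤ} (ha : InW l u a) (hb : InW l u b) (hac : Core X I a) (hbc : Core X I b) :
    Con l u X a b := by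
  have key : ∀ j, j ≤ I → Con l u (Bad X (I - j)) a b := by
    intro j
    induction j with
    | zero =>
      intro _
      simp only [Nat.sub_zero]
      rw [hI]
      obtain ⟨a1, a2⟩ := a
      obtain ⟨b1, b2⟩ := b
      refine Relation.ReflTransGen.trans (b := (a1, b2)) (con_col2 _ _ _ ?_) (con_row2 _ _ _ ?_)
      · intro v hv hv'
        refine ⟨?_, by simp⟩
        unfold InW at *; simp only at *; omega
      · intro v hv hv'
        refine ⟨?_, by simp⟩
        unfold InW at *; simp only at *; omega
    | succ j ih =>
      intro hj
      have h3 := ih (by omega)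
      obtain ⟨i, hi⟩ : ∃ i, i = I - (j + 1) := ⟨_, rfl⟩
      rw [← hi]
      rw [show I - j = i + 1 by omega] at h3
      have hrI := rr_mono (show i ≤ I by omega)
      have := rr_pos i
      refine con_level (r := rr i) (by omega) (by omega) (by omega) ?_ ?_ ?_ h3
      · intro q hq hq' y hy hqy
        by_contra hcon
        exact hq' ⟨hq, y, hy, hcon, hqy⟩
      · exact fun q hq hq' => hac i (by omega) q ⟨hq, hq'⟩
      · exact fun q hq hq' => hbc i (by omega) q ⟨hq, hq'⟩
  have := key I le_rfl
  simpa [Bad] using this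

lemma Bad_anti {X : Set (ℤ × ℤ)} {i : ℕ} : Bad X (i + 1) ⊆ Bad X i := fun _ h => h.1

lemma core_notin {X : Set (ℤ × ℤ)} {I : ℕ} (hI : Bad X I = ∅) {a} (ha : Core X I a) : a ∉ X := by
  intro hX
  have : ∀ i, i ≤ I → a ∈ Bad X i := by
    intro i
    induction i with
    | zero => intro _; exact hX
    | succ i ih =>
      intro hi
      by_contra hcon
      exact ha i (by omega) a ⟨ih (by omega), hcon⟩ (nr_self (by have := rr_pos i; omega) _)
  have := this I le_rfl
  rw [hI] at this
  exact this

lemma clean_all {X : Set (ℤ × ℤ)} {I : ℕ} {Er : Set (ℤ × ℤ)}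
    (hcore : ∀ a, Core X I a → a ∉ Er)
    (hiso : ∀ i < I, ∀ q a, a ∈ Er → nr (3 * rr i) a q →
      ∃ b ∈ Er, nr (3 * rr i + 10) b q ∧ ¬ nr (3 * rr i) b q) : Er = ∅ := by
  have key : ∀ i, i ≤ I → ∀ a ∈ Er, ∃ l, i ≤ l ∧ l < I ∧ ∃ q ∈ Lv X l, nr (rr l + rr i) a q := by
    intro i
    induction i with
    | zero =>
      intro _ a ha
      by_contra hcon
      push Not at hcon
      refine hcore a ?_ ha
      intro l hl q hq hn
      refine hcon l (by omega) hl q hq ?_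
      have := rr_pos 0
      unfold nr at *; omega
    | succ i ih =>
      intro hi a ha
      have ih := ih (by omega)
      obtain ⟨l, hl, hlI, q, hq, hn⟩ := ih a ha
      have hp := rr_pos i
      have hs := rr_succ i
      rcases Nat.lt_or_ge i l with hil | hil
      · exact ⟨l, by omega, hlI, q, hq, by unfold nr at *; omega⟩
      · obtain rfl : l = i := by omega
        obtain ⟨b, hb, hb1, hb2⟩ := hiso l (by omega) q a ha (by unfold nr at *; omega)
        obtain ⟨l', hl', hlI', q', hq', hn'⟩ := ih b hb
        rcases Nat.lt_or_ge l l' with hil' | hil'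
        · exact ⟨l', by omega, hlI', q', hq', by unfold nr at *; omega⟩
        · obtain rfl : l' = l := by omega
          exfalso
          have : nr (rr l') q q' := by
            by_contra hcon
            exact hq.2 ⟨hq.1, q', hq'.1, hcon, by unfold nr at *; omega⟩
          apply hb2
          unfold nr at *; omega
  ext a
  simp only [Set.mem_empty_iff_false, iff_false]
  intro ha
  obtain ⟨l, h1, h2, _⟩ := key I le_rfl a ha
  omega

end RP

namespace RP

/-- Finite ball. -/
noncomputable def ball (r : ℤ) (x : ℤ × ℤ) : Finset (ℤ × ℤ) :=
  Finset.Icc (x.1 - r) (x.1 + r) ×ˢ Finset.Icc (x.2 - r) (x.2 + r)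

lemma mem_ball {r : ℤ} {x y : ℤ × ℤ} : y ∈ ball r x ↔ nr r x y := by
  simp [ball, nr]; omega

lemma card_ball (r : ℤ) (x : ℤ × ℤ) : (ball r x).card = (2 * r + 1).toNat ^ 2 := by
  simp only [ball, Finset.card_product, Int.card_Icc]
  rw [sq]; congr 2 <;> ring

/-- Possible witness sets for badness. -/
noncomputable def Tr : ℕ → ℤ × ℤ → Finset (Finset (ℤ × ℤ))
  | 0, x => {{x}}
  | i + 1, x => (ball (6 * rr i) x).biUnion fun y => Finset.image₂ (· ∪ ·) (Tr i x) (Tr i y)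

/-- Separated sets. -/
def Sep (S : Finset (ℤ × ℤ)) : Prop := ∀ x ∈ S, ∀ y ∈ S, x ≠ y → ¬ nr 3 x y

lemma bad_wit {X : Set (ℤ × ℤ)} (i : ℕ) : ∀ x ∈ Bad X i, ∃ S ∈ Tr i x, (∀ z ∈ S, z ∈ X) ∧
    S.card = 2 ^ i ∧ Sep S ∧ ∀ z ∈ S, nr (4 * 32 ^ i) z x := by
  induction i with
  | zero =>
    intro x hx
    refine ⟨{x}, by simp [Tr], by simpa using (show x ∈ X from hx), by simp, ?_, ?_⟩
    · intro a ha b hb hab; simp at ha hb; subst ha hb; exact absurd rfl hab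
    · intro z hz; simp at hz; subst hz; unfold nr; simp
  | succ i ih =>
    rintro x ⟨hx, y, hy, hn, hn'⟩
    obtain ⟨S, hS, h1, h2, h3, h4⟩ := ih x hx
    obtain ⟨S', hS', h1', h2', h3', h4'⟩ := ih y hy
    have hp : (1 : ℤ) ≤ 32 ^ i := one_le_pow₀ (by norm_num)
    have hr : rr i = 20 * 32 ^ i := rfl
    have hsp : ∀ a ∈ S, ∀ b ∈ S', ¬ nr 3 a b := by
      intro a ha b hb hab
      have := h4 a ha
      have := h4' b hb
      apply hn
      unfold nr at *; omega
    refine ⟨S ∪ S', ?_, ?_, ?_, ?_, ?_⟩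
    · simp only [Tr, Finset.mem_biUnion]
      exact ⟨y, mem_ball.mpr hn', Finset.mem_image₂_of_mem hS hS'⟩
    · intro z hz
      rcases Finset.mem_union.mp hz with h | h
      · exact h1 z h
      · exact h1' z h
    · rw [Finset.card_union_of_disjoint, h2, h2']
      · ring
      · rw [Finset.disjoint_left]
        intro a ha hb
        exact hsp a ha a hb (nr_self (by norm_num) _)
    · intro a ha b hb hab
      rcases Finset.mem_union.mp ha with h | h <;> rcases Finset.mem_union.mp hb with h' | h'
      · exact h3 a h b h' hab
      · exact hsp a h b h'
      · exact fun hn => hsp b h' a h (nr_symm hn)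
      · exact h3' a h b h' hab
    · intro z hz
      rw [pow_succ]
      rcases Finset.mem_union.mp hz with h | h
      · have := h4 z h
        unfold nr at *; omega
      · have := h4' z h
        unfold nr at *; omega

lemma card_Tr (i : ℕ) : ∀ x, (Tr i x).card * (2 ^ 28 * 4096 ^ i) ≤ (2 ^ 28) ^ (2 ^ i) := by
  induction i with
  | zero => intro x; simp [Tr]
  | succ i ih =>
    intro x
    set R : ℕ := 241 * 32 ^ i with hR
    have hRb : ∀ x, (ball (6 * rr i) x).card ≤ R ^ 2 := by
      intro x
      rw [card_ball]
      apply Nat.pow_le_pow_left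
      have hp : (1 : ℤ) ≤ 32 ^ i := one_le_pow₀ (by norm_num)
      have hr : rr i = 20 * 32 ^ i := rfl
      rw [Int.toNat_le, hR]
      push_cast
      omega
    set D : ℕ := 2 ^ 28 * 4096 ^ i with hD
    set K : ℕ := (2 ^ 28) ^ (2 ^ i) with hK
    have hcard : (Tr (i + 1) x).card * D ^ 2 ≤ R ^ 2 * K ^ 2 := by
      calc (Tr (i + 1) x).card * D ^ 2
          ≤ (∑ y ∈ ball (6 * rr i) x, (Tr i x).card * (Tr i y).card) * D ^ 2 := by
            apply Nat.mul_le_mul_right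
            refine Finset.card_biUnion_le.trans (Finset.sum_le_sum fun y _ => ?_)
            exact Finset.card_image₂_le _ _ _
        _ = ∑ y ∈ ball (6 * rr i) x, ((Tr i x).card * D) * ((Tr i y).card * D) := by
            rw [Finset.sum_mul]
            exact Finset.sum_congr rfl fun y _ => by ring
        _ ≤ ∑ y ∈ ball (6 * rr i) x, K * K :=
            Finset.sum_le_sum fun y _ => Nat.mul_le_mul (ih x) (ih y)
        _ ≤ R ^ 2 * K ^ 2 := by
            rw [Finset.sum_const, smul_eq_mul, ← sq]
            exact Nat.mul_le_mul_right _ (hRb x)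
    have hDD : (2 ^ 28 * 4096 ^ (i + 1)) * R ^ 2 ≤ D ^ 2 := by
      rw [hD, hR]
      have e1 : (2 ^ 28 * 4096 ^ (i + 1)) * (241 * 32 ^ i) ^ 2 =
          (2 ^ 28 * 4096 ^ i) * ((4096 * 241 ^ 2) * 1024 ^ i) := by
        rw [show (1024 : ℕ) = 32 ^ 2 by norm_num, ← pow_mul, mul_comm 2 i, pow_mul]; ring
      rw [e1, sq (2 ^ 28 * 4096 ^ i)]
      apply Nat.mul_le_mul_left
      apply Nat.mul_le_mul (by norm_num)
      exact Nat.pow_le_pow_left (by norm_num) i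
    have hKK : (2 ^ 28) ^ (2 ^ (i + 1)) = K ^ 2 := by rw [hK, pow_succ 2 i, pow_mul]
    rw [hKK]
    have hR0 : 0 < R ^ 2 := by positivity
    apply Nat.le_of_mul_le_mul_left _ hR0
    calc R ^ 2 * ((Tr (i + 1) x).card * (2 ^ 28 * 4096 ^ (i + 1)))
        = (Tr (i + 1) x).card * ((2 ^ 28 * 4096 ^ (i + 1)) * R ^ 2) := by ring
      _ ≤ (Tr (i + 1) x).card * D ^ 2 := Nat.mul_le_mul_left _ hDD
      _ ≤ _ := hcard

section hier
variable {n : ℕ} (X : (Fin n × Fin n → Bool) → Set (ℤ × ℤ)) (η : ℝ) (hη : 0 ≤ η)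
  (hX : ∀ S : Finset (ℤ × ℤ), S.Nonempty → Sep S → pr n (fun P => ∀ z ∈ S, z ∈ X P) ≤ η ^ S.card)
include hη hX

lemma pr_bad (i : ℕ) (x : ℤ × ℤ) :
    pr n (fun P => x ∈ Bad (X P) i) ≤ (2 ^ 28 * η) ^ (2 ^ i) / (2 ^ 28 * 4096 ^ i) := by
  classical
  have h1 : pr n (fun P => x ∈ Bad (X P) i) ≤ (Tr i x).card * η ^ (2 ^ i) := by
    have : pr n (fun P => x ∈ Bad (X P) i) ≤
      pr n (fun P => ∃ S ∈ Tr i x, (S.card = 2 ^ i ∧ Sep S) ∧ (∀ z ∈ S, z ∈ X P)) := by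
      apply pr_mono
      intro P hP
      obtain ⟨S, hS, h1, h2, h3, -⟩ := bad_wit i x hP
      exact ⟨S, hS, ⟨h2, h3⟩, h1⟩
    refine this.trans (pr_exists_le _ _ _ ?_)
    intro S _
    by_cases hS : S.card = 2 ^ i ∧ Sep S
    · rw [← hS.1]
      refine le_trans (pr_mono ?_) (hX S ?_ hS.2)
      · intro P hP; exact hP.2
      · rw [← Finset.card_pos, hS.1]; positivity
    · rw [pr_zero (by tauto)]; positivity
  refine h1.trans ?_
  rw [le_div_iff₀ (by positivity), mul_pow]
  have h2 : ((Tr i x).card : ℝ) * (2 ^ 28 * 4096 ^ i) ≤ (2 ^ 28) ^ (2 ^ i) := by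
    exact_mod_cast card_Tr i x
  calc _ = ((Tr i x).card : ℝ) * (2 ^ 28 * 4096 ^ i) * η ^ (2 ^ i) := by ring
    _ ≤ _ := by gcongr

lemma pr_badI (G : Finset (ℤ × ℤ)) (hG : ∀ P, ∀ x ∈ X P, x ∈ G) (I : ℕ) (hκ : 2 ^ 28 * η ≤ 1 / 4) :
    pr n (fun P => Bad (X P) I ≠ ∅) ≤ G.card * (1 / 4) ^ (2 ^ I) := by
  have hsub : ∀ P, ∀ i, Bad (X P) i ⊆ X P := by
    intro P i
    induction i with
    | zero => exact subset_rfl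
    | succ i ih => exact Bad_anti.trans ih
  refine le_trans (pr_mono (F := fun P => ∃ x ∈ G, x ∈ Bad (X P) I) ?_) (pr_exists_le _ _ _ ?_)
  · intro P hP
    obtain ⟨x, hx⟩ := Set.nonempty_iff_ne_empty.mpr hP
    exact ⟨x, hG P x (hsub P I hx), hx⟩
  · intro x _
    refine (pr_bad X η hη hX I x).trans ?_
    have h1 : (2 ^ 28 * η) ^ (2 ^ I) ≤ (1 / 4 : ℝ) ^ (2 ^ I) := by gcongr
    refine le_trans (div_le_self (by positivity) ?_) h1
    have : (1 : ℝ) ≤ 4096 ^ I := one_le_pow₀ (by norm_num)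
    linarith

lemma pr_core (I : ℕ) (hκ : 2 ^ 28 * η ≤ 1 / 4) (a : ℤ × ℤ) :
    pr n (fun P => ¬ Core (X P) I a) ≤ 2 ^ 28 * η := by
  refine le_trans (pr_mono (F := fun P => ∃ i ∈ Finset.range I, ∃ q ∈ ball (rr i) a,
    q ∈ Bad (X P) i) ?_) ((pr_exists _ _).trans ?_)
  · intro P hP
    unfold Core at hP
    push Not at hP
    obtain ⟨i, hi, q, hq, hn⟩ := hP
    exact ⟨i, by simpa using hi, q, mem_ball.mpr hn, hq.1⟩
  · have hi : ∀ i ∈ Finset.range I, pr n (fun P => ∃ q ∈ ball (rr i) a, q ∈ Bad (X P) i) ≤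
        (2 ^ 28 * η) * (1 / 2) ^ (i + 1) := by
      intro i _
      refine (pr_exists_le _ _ _ fun q _ => pr_bad X η hη hX i q).trans ?_
      have hb : ((ball (rr i) a).card : ℝ) ≤ (41 * 32 ^ i) ^ 2 := by
        rw [card_ball]
        have : (2 * rr i + 1).toNat ≤ 41 * 32 ^ i := by
          have hp : (1 : ℤ) ≤ 32 ^ i := one_le_pow₀ (by norm_num)
          have hr : rr i = 20 * 32 ^ i := rfl
          rw [Int.toNat_le]
          push_cast
          omega
        exact_mod_cast Nat.pow_le_pow_left this 2
      have hk : (2 ^ 28 * η) ^ (2 ^ i) ≤ 2 ^ 28 * η :=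
        pow_le_of_le_one (by positivity) (by linarith) (by positivity)
      calc ((ball (rr i) a).card : ℝ) * ((2 ^ 28 * η) ^ (2 ^ i) / (2 ^ 28 * 4096 ^ i))
          ≤ (41 * 32 ^ i) ^ 2 * ((2 ^ 28 * η) / (2 ^ 28 * 4096 ^ i)) := by gcongr
        _ = (2 ^ 28 * η) * ((41 ^ 2 / 2 ^ 28) * ((32 ^ 2 / 4096 : ℝ)) ^ i) := by
          rw [div_pow, ← pow_mul, mul_comm 2 i, pow_mul]; field_simp
        _ ≤ (2 ^ 28 * η) * ((1 / 2) * (1 / 2) ^ i) := by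
          apply mul_le_mul_of_nonneg_left _ (by positivity)
          apply mul_le_mul (by norm_num) _ (by positivity) (by positivity)
          exact pow_le_pow_left₀ (by norm_num) (by norm_num) i
        _ = _ := by rw [pow_succ]; ring
    refine (Finset.sum_le_sum hi).trans ?_
    rw [← Finset.mul_sum]
    have : ∑ i ∈ Finset.range I, (1 / 2 : ℝ) ^ (i + 1) ≤ 1 := by
      have : ∀ I : ℕ, ∑ i ∈ Finset.range I, (1 / 2 : ℝ) ^ (i + 1) = 1 - (1 / 2) ^ I := by
        intro I
        induction I with
        | zero => simp
        | succ I ih => rw [Finset.sum_range_succ, ih]; ring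
      rw [this]
      have : (0 : ℝ) ≤ (1 / 2) ^ I := by positivity
      linarith
    calc _ ≤ 2 ^ 28 * η * 1 := by gcongr
      _ = _ := mul_one _

end hier
end RP

namespace RP

/-- Position of the coarse window, one coordinate. -/
def ph (n k a : ℤ) : ℤ := min (k * a) (n - k)

/-- Largest coarse coordinate. -/
def cA (n k : ℤ) : ℤ := (n - 1) / k

lemma cA_mul {n k a : ℤ} (hk : 1 ≤ k) (ha : a ≤ cA n k) : k * a ≤ n - 1 := by
  unfold cA at ha
  rw [mul_comm]
  exact (Int.le_ediv_iff_mul_le (by omega)).mp ha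

lemma ph_sep {n k a b : ℤ} (hk : 1 ≤ k) (hb : b ≤ cA n k) (hab : a + 4 ≤ b) :
    ph n k a + 3 * k ≤ ph n k b := by
  have h1 := cA_mul hk hb
  have h2 : k * a + 4 * k ≤ k * b := by nlinarith
  unfold ph; omega

/-- Width of the test rectangle. -/
def ws (k : ℤ) (t : Bool) : ℤ := if t then k - 1 else k
/-- Height of the test rectangle. -/
def hs (k : ℤ) (t : Bool) : ℤ := if t then k else k - 1
/-- Position of the test rectangle. -/
def zs (n k : ℤ) (t : Bool) (a : ℤ × ℤ) (i : ℤ) : ℤ × ℤ :=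
  if t then (ph n k a.1 + i, ph n k a.2) else (ph n k a.1, ph n k a.2 + i)

/-- Elementary event of non-uniqueness. -/
def Ev (n k : ℤ) (σ : Bool) (p : ℤ × ℤ → Bool) (a : ℤ × ℤ) (c : Bool × ℤ × (ℤ × ℤ)) : Prop :=
  (InW (0, 0) (cA n k, cA n k) a ∧ -k ≤ c.2.1 ∧ c.2.1 ≤ k ∧
  Vd n (ws k c.1) (hs k c.1) (zs n k c.1 a c.2.1) ∧ Vd n (ws k c.1) (hs k c.1) c.2.2 ∧
  (if σ then ell n (zs n k c.1 a c.2.1) < ell n c.2.2 else ell n c.2.2 < ell n (zs n k c.1 a c.2.1))) ∧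
  Eqr (ws k c.1) (hs k c.1) p p (zs n k c.1 a c.2.1) c.2.2

/-- Bad coarse sites. -/
def XX (n k : ℤ) (p : ℤ × ℤ → Bool) : Set (ℤ × ℤ) :=
  {a | InW (0, 0) (cA n k, cA n k) a ∧ ∃ t i, -k ≤ i ∧ i ≤ k ∧
    Vd n (ws k t) (hs k t) (zs n k t a i) ∧ ¬ Uq n (ws k t) (hs k t) p (zs n k t a i)}

/-- Possible choices. -/
noncomputable def CC (n k : ℕ) : Finset (Bool × ℤ × (ℤ × ℤ)) :=
  Finset.univ ×ˢ Finset.Icc (-(k : ℤ)) k ×ˢ box n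

lemma card_CC (n k : ℕ) : (CC n k).card = 2 * ((2 * k + 1) * n ^ 2) := by
  simp only [CC, Finset.card_product, card_box, Int.card_Icc, Finset.card_univ, Fintype.card_bool]
  congr 2
  omega

lemma Vd_box {n w h : ℤ} (hw : 1 ≤ w) (hh : 1 ≤ h) {z} (hz : Vd n w h z) : z ∈ box n := by
  rw [mem_box]; unfold Vd at hz; omega

lemma ws_pos {k : ℤ} (hk : 2 ≤ k) (t) : 1 ≤ ws k t := by unfold ws; split_ifs <;> omega
lemma hs_pos {k : ℤ} (hk : 2 ≤ k) (t) : 1 ≤ hs k t := by unfold hs; split_ifs <;> omega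

lemma XX_Ev {n k : ℕ} (hk : 2 ≤ k) {p} {a} (ha : a ∈ XX n k p) :
    ∃ σ, ∃ c ∈ CC n k, Ev n k σ p a c := by
  obtain ⟨hW, t, i, h1, h2, hv, hu⟩ := ha
  unfold Uq at hu
  push Not at hu
  obtain ⟨z', hz', he, hne⟩ := hu
  have hwp := ws_pos (k := k) (by omega) t
  have hhp := hs_pos (k := k) (by omega) t
  have hb1 := Vd_box hwp hhp hv
  have hb2 := Vd_box hwp hhp hz'
  have hell := ell_ne hb1 hb2 hne.symm
  have hc : (t, i, z') ∈ CC n k := by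
    simp only [CC, Finset.mem_product, Finset.mem_univ, Finset.mem_Icc, true_and]
    exact ⟨⟨h1, h2⟩, hb2⟩
  rcases lt_or_gt_of_ne hell with h | h
  · exact ⟨true, _, hc, ⟨hW, h1, h2, hv, hz', by simpa using h⟩, he⟩
  · exact ⟨false, _, hc, ⟨hW, h1, h2, hv, hz', by simpa using h⟩, he⟩

lemma pr_choice {n : ℕ} {γ : Type*} [Inhabited γ] (S : Finset (ℤ × ℤ)) (C : Finset γ)
    (E : ℤ × ℤ → γ → (Fin n × Fin n → Bool) → Prop) (q : ℝ)
    (h : ∀ f : ℤ × ℤ → γ, pr n (fun P => ∀ a ∈ S, E a (f a) P) ≤ q) :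
    pr n (fun P => ∀ a ∈ S, ∃ c ∈ C, E a c P) ≤ (C.card : ℝ) ^ S.card * q := by
  classical
  have h1 : pr n (fun P => ∀ a ∈ S, ∃ c ∈ C, E a c P) ≤
      pr n (fun P => ∃ f ∈ Fintype.piFinset (fun _ : S => C),
        ∀ a ∈ S, E a (if h : a ∈ S then f ⟨a, h⟩ else default) P) := by
    apply pr_mono
    intro P hP
    have : ∀ a : S, ∃ c ∈ C, E a c P := fun a => hP a a.2
    choose f hf hf' using this
    refine ⟨f, by simpa using hf, ?_⟩
    intro a ha
    rw [dif_pos ha]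
    exact hf' ⟨a, ha⟩
  refine h1.trans ((pr_exists_le _ _ q fun f _ => h _).trans ?_)
  simp

lemma pr_fixed {n k : ℕ} (hk : 2 ≤ k) (σ : Bool) (S : Finset (ℤ × ℤ)) (hS : Sep S)
    (f : ℤ × ℤ → Bool × ℤ × (ℤ × ℤ)) :
    pr n (fun P => ∀ a ∈ S, Ev n k σ (px n P) a (f a)) ≤ ((1 / 2) ^ (k ^ 2 - k)) ^ S.card := by
  classical
  by_cases hval : ∀ a ∈ S, InW (0, 0) (cA n k, cA n k) a ∧ -k ≤ (f a).2.1 ∧ (f a).2.1 ≤ k ∧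
    Vd n (ws k (f a).1) (hs k (f a).1) (zs n k (f a).1 a (f a).2.1) ∧
    Vd n (ws k (f a).1) (hs k (f a).1) (f a).2.2 ∧
    (if σ then ell n (zs n k (f a).1 a (f a).2.1) < ell n (f a).2.2
      else ell n (f a).2.2 < ell n (zs n k (f a).1 a (f a).2.1))
  swap
  · rw [pr_zero]
    · positivity
    · intro P hP
      exact hval fun a ha => (hP a ha).1
  set R : ℤ × ℤ → Finset (ℤ × ℤ) := fun a => rc (ws k (f a).1) (hs k (f a).1) (zs n k (f a).1 a (f a).2.1)
    with hR
  have hloc : ∀ a ∈ S, ∀ c ∈ R a, (ph n k a.1 - k ≤ c.1 ∧ c.1 ≤ ph n k a.1 + 2 * k - 2) ∧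
      (ph n k a.2 - k ≤ c.2 ∧ c.2 ≤ ph n k a.2 + 2 * k - 2) := by
    intro a ha c hc
    obtain ⟨-, h1, h2, -⟩ := hval a ha
    simp only [hR] at hc
    rw [mem_rc] at hc
    unfold zs ws hs at hc
    split_ifs at hc <;> simp only at hc <;> omega
  have huniq : ∀ a ∈ S, ∀ b ∈ S, ∀ c, c ∈ R a → c ∈ R b → a = b := by
    intro a ha b hb c hca hcb
    by_contra hne
    have h1 := hloc a ha c hca
    have h2 := hloc b hb c hcb
    have hWa := (hval a ha).1
    have hWb := (hval b hb).1
    have hn := hS a ha b hb hne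
    unfold InW at hWa hWb
    simp only at hWa hWb
    have hk1 : (1 : ℤ) ≤ k := by omega
    apply hn
    unfold nr
    refine ⟨⟨?_, ?_⟩, ?_, ?_⟩
    · by_contra h
      have := ph_sep (a := b.1) (b := a.1) hk1 hWa.1.2 (by omega)
      omega
    · by_contra h
      have := ph_sep (a := a.1) (b := b.1) hk1 hWb.1.2 (by omega)
      omega
    · by_contra h
      have := ph_sep (a := b.2) (b := a.2) hk1 hWa.2.2 (by omega)
      omega
    · by_contra h
      have := ph_sep (a := a.2) (b := b.2) hk1 hWb.2.2 (by omega)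
      omega
  have hch : ∀ c : ℤ × ℤ, ∃ a, c ∈ S.biUnion R → a ∈ S ∧ c ∈ R a := by
    intro c
    by_cases hc : c ∈ S.biUnion R
    · obtain ⟨a, ha, hca⟩ := Finset.mem_biUnion.mp hc
      exact ⟨a, fun _ => ⟨ha, hca⟩⟩
    · exact ⟨0, fun h => absurd h hc⟩
  choose o ho using hch
  have hcard : (S.biUnion R).card = S.card * (k ^ 2 - k) := by
    rw [Finset.card_biUnion]
    · rw [Finset.sum_const_nat]
      intro a ha
      simp only [hR, card_rc]
      unfold ws hs
      split_ifs
      · rw [show ((k : ℤ) - 1).toNat = k - 1 by omega]; simp [Nat.sub_mul, sq]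
      · rw [show ((k : ℤ) - 1).toNat = k - 1 by omega]; simp [Nat.mul_sub, sq]
    · intro a ha b hb hab
      rw [Function.onFun, Finset.disjoint_left]
      intro c hca hcb
      exact hab (huniq a ha b hb c hca hcb)
  have := glb (n := n) (S.biUnion R) (fun c => c + ((f (o c)).2.2 - zs n k (f (o c)).1 (o c) (f (o c)).2.1))
    (fun _ => false) (fun c => if σ then - ell n c else ell n c)
    (by
      intro c hc
      obtain ⟨h1, h2⟩ := ho c hc
      exact rc_box (hval _ h1).2.2.2.1 h2)
    (by
      intro c hc
      obtain ⟨h1, h2⟩ := ho c hc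
      refine rc_box (hval _ h1).2.2.2.2.1 ?_
      simp only [hR] at h2
      rw [mem_rc] at h2 ⊢
      simp only [Prod.fst_add, Prod.snd_add, Prod.fst_sub, Prod.snd_sub]
      omega)
    (by
      intro c hc
      obtain ⟨h1, h2⟩ := ho c hc
      have := (hval _ h1).2.2.2.2.2
      split_ifs at this ⊢ <;> simp only [ell_add, ell_sub] <;> omega)
  rw [hcard, mul_comm, pow_mul] at this
  refine le_trans (pr_mono ?_) this
  intro P hP c hc
  obtain ⟨h1, h2⟩ := ho c hc
  have := Eqr_at (hP _ h1).2 h2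
  simpa using this

lemma pr_XX {n k : ℕ} (hk : 2 ≤ k) (θ : ℝ)
    (hθ : θ = 2 * ((2 * k + 1) * n ^ 2) * (1 / 2) ^ (k ^ 2 - k)) (hθ1 : θ ≤ 1)
    (S : Finset (ℤ × ℤ)) (hne : S.Nonempty) (hS : Sep S) :
    pr n (fun P => ∀ z ∈ S, z ∈ XX n k (px n P)) ≤ (4 * √θ) ^ S.card := by
  classical
  have hθ0 : 0 ≤ θ := by rw [hθ]; positivity
  have hs0 : 0 ≤ √θ := Real.sqrt_nonneg _
  have hs1 : √θ ≤ 1 := Real.sqrt_le_one.mpr hθ1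
  have h1 : pr n (fun P => ∀ z ∈ S, z ∈ XX n k (px n P)) ≤
      pr n (fun P => ∃ q ∈ (Finset.univ : Finset Bool) ×ˢ S.powerset, S.card ≤ 2 * q.2.card ∧
        ∀ a ∈ q.2, ∃ c ∈ CC n k, Ev n k q.1 (px n P) a c) := by
    apply pr_mono
    intro P hP
    set Sp := S.filter fun a => ∃ c ∈ CC n k, Ev n k true (px n P) a c
    set Sm := S.filter fun a => ∃ c ∈ CC n k, Ev n k false (px n P) a c
    have hun : S ⊆ Sp ∪ Sm := by
      intro a ha
      obtain ⟨σ, h⟩ := XX_Ev hk (hP a ha)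
      cases σ
      · exact Finset.mem_union_right _ (Finset.mem_filter.mpr ⟨ha, h⟩)
      · exact Finset.mem_union_left _ (Finset.mem_filter.mpr ⟨ha, h⟩)
    have hc := (Finset.card_le_card hun).trans (Finset.card_union_le _ _)
    rcases le_total Sm.card Sp.card with h | h
    · exact ⟨(true, Sp), by simp [Sp], by simp only; omega, fun a ha => (Finset.mem_filter.mp ha).2⟩
    · exact ⟨(false, Sm), by simp [Sm], by simp only; omega, fun a ha => (Finset.mem_filter.mp ha).2⟩
  refine h1.trans ((pr_exists_le _ _ (√θ ^ S.card) ?_).trans ?_)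
  · rintro ⟨σ, S'⟩ hq
    simp only [Finset.mem_product, Finset.mem_univ, Finset.mem_powerset, true_and] at hq
    by_cases hcard : S.card ≤ 2 * S'.card
    swap
    · rw [pr_zero (by tauto)]; positivity
    have hS' : Sep S' := fun x hx y hy => hS x (hq hx) y (hq hy)
    have h2 := pr_choice S' (CC n k) (fun a c P => Ev n k σ (px n P) a c) _
      (fun f => pr_fixed hk σ S' hS' f)
    refine (pr_mono fun P hP => hP.2).trans (h2.trans ?_)
    rw [← mul_pow, card_CC]
    push_cast
    rw [← hθ]
    calc θ ^ S'.card = √θ ^ (2 * S'.card) := by rw [pow_mul, Real.sq_sqrt hθ0]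
      _ ≤ √θ ^ S.card := pow_le_pow_of_le_one hs0 hs1 hcard
  · rw [Finset.card_product, Finset.card_powerset]
    push_cast
    rw [mul_pow, show (4 : ℝ) = 2 * 2 by norm_num, mul_pow]
    have h3 : (2 : ℝ) ≤ 2 ^ S.card := by
      calc (2 : ℝ) = 2 ^ 1 := by norm_num
        _ ≤ _ := pow_le_pow_right₀ (by norm_num) (Finset.card_pos.mpr hne)
    simp only [Finset.card_univ, Fintype.card_bool]
    push_cast
    gcongr

lemma XX_box {n k : ℕ} (hk : 1 ≤ k) (p) (a) (ha : a ∈ XX n k p) : a ∈ box n := by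
  have h := ha.1
  unfold InW at h
  simp only at h
  have h1 := cA_mul (n := n) (k := k) (by omega) h.1.2
  have h2 := cA_mul (n := n) (k := k) (by omega) h.2.2
  rw [mem_box]
  have hk' : (1 : ℤ) ≤ k := by omega
  refine ⟨⟨h.1.1, ?_⟩, h.2.1, ?_⟩
  · nlinarith
  · nlinarith

end RP

namespace RP

lemma ph_mono {n k a b : ℤ} (hk : 1 ≤ k) (h : a ≤ b) : ph n k a ≤ ph n k b := by
  have : k * a ≤ k * b := by nlinarith
  unfold ph; omega

lemma ph_succ {n k a : ℤ} (hk : 1 ≤ k) : ph n k (a + 1) ≤ ph n k a + k := by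
  have : k * (a + 1) = k * a + k := by ring
  unfold ph; omega

lemma ph_zero {n k : ℤ} (hkn : k ≤ n) : ph n k 0 = 0 := by
  unfold ph; simp; omega

lemma ph_top {n k : ℤ} (hk : 1 ≤ k) : ph n k (cA n k) = n - k := by
  have h1 := Int.emod_add_mul_ediv (n - 1) k
  have h2 := Int.emod_lt_of_pos (n - 1) (show 0 < k by omega)
  unfold ph cA
  omega

lemma ph_nonneg {n k a : ℤ} (hk : 1 ≤ k) (hkn : k ≤ n) (h : 0 ≤ a) : 0 ≤ ph n k a := by
  have := ph_mono (n := n) hk h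
  rw [ph_zero hkn] at this
  exact this

lemma ph_le {n k a : ℤ} : ph n k a ≤ n - k := by unfold ph; omega

/-- Position of the coarse window. -/
def Ph (n k : ℤ) (a : ℤ × ℤ) : ℤ × ℤ := (ph n k a.1, ph n k a.2)

section road
variable {n k : ℤ} {p p' : ℤ × ℤ → Bool} (hk : 2 ≤ k) (hkn : k ≤ n) (H : WR n k p' p)
include hk hkn

lemma notXX {a : ℤ × ℤ} (hG : InW (0, 0) (cA n k, cA n k) a) (ha : a ∉ XX n k p) :
    (∀ i, -k ≤ i → i ≤ k → 0 ≤ ph n k a.1 + i → ph n k a.1 + i ≤ n - k + 1 →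
      Uq n (k - 1) k p (ph n k a.1 + i, ph n k a.2)) ∧
    (∀ i, -k ≤ i → i ≤ k → 0 ≤ ph n k a.2 + i → ph n k a.2 + i ≤ n - k + 1 →
      Uq n k (k - 1) p (ph n k a.1, ph n k a.2 + i)) := by
  have h1 := ph_nonneg (n := n) (k := k) (a := a.1) (by omega) hkn hG.1.1
  have h2 := ph_nonneg (n := n) (k := k) (a := a.2) (by omega) hkn hG.2.1
  have h3 := ph_le (n := n) (k := k) (a := a.1)
  have h4 := ph_le (n := n) (k := k) (a := a.2)
  constructor
  · intro i hi hi' h5 h6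
    by_contra hcon
    refine ha ⟨hG, true, i, hi, hi', ?_, ?_⟩
    · simp only [zs, ws, hs, if_true, Vd]; omega
    · simpa [zs, ws, hs] using hcon
  · intro i hi hi' h5 h6
    by_contra hcon
    refine ha ⟨hG, false, i, hi, hi', ?_, ?_⟩
    · simp [zs, ws, hs, Vd]; omega
    · simpa [zs, ws, hs] using hcon

include H

lemma road1 {s a a' : ℤ × ℤ} (hG : InW (0, 0) (cA n k, cA n k) a)
    (hG' : InW (0, 0) (cA n k, cA n k) a') (ha : a ∉ XX n k p) (hadj : Adj a a')
    (hv : Vd n k k (Ph n k a - s)) (hv' : Vd n k k (Ph n k a' - s))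
    (he : Eqr k k p' p (Ph n k a - s) (Ph n k a)) : Eqr k k p' p (Ph n k a' - s) (Ph n k a') := by
  have h1 := ph_nonneg (n := n) (k := k) (a := a.1) (by omega) hkn hG.1.1
  have h2 := ph_nonneg (n := n) (k := k) (a := a.2) (by omega) hkn hG.2.1
  have h3 := ph_le (n := n) (k := k) (a := a.1)
  have h4 := ph_le (n := n) (k := k) (a := a.2)
  have h1' := ph_nonneg (n := n) (k := k) (a := a'.1) (by omega) hkn hG'.1.1
  have h2' := ph_nonneg (n := n) (k := k) (a := a'.2) (by omega) hkn hG'.2.1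
  have h3' := ph_le (n := n) (k := k) (a := a'.1)
  have h4' := ph_le (n := n) (k := k) (a := a'.2)
  have hy : Vd n k k (Ph n k a) := by unfold Vd Ph; simp only; omega
  obtain ⟨u1, u2⟩ := notXX hk hkn hG ha
  rcases hadj with ⟨e, e' | e'⟩ | ⟨e, e' | e'⟩
  · have hm := ph_mono (n := n) (k := k) (a := a'.2) (b := a.2) (by omega) (by omega)
    have hsu := ph_succ (n := n) (k := k) (a := a'.2) (by omega)
    rw [← e'] at hsu
    have ht : ((ph n k a.2 - ph n k a'.2).toNat : ℤ) = ph n k a.2 - ph n k a'.2 := by omega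
    have := (walkD H hv hy he (ph n k a.2 - ph n k a'.2).toNat
      (by rw [ht]; unfold Vd Ph at *; simp at *; rw [e]; omega)
      (by
        intro i hi hi'
        have := u2 (-i) (by omega) (by omega) (by omega) (by omega)
        simpa [Ph, sub_eq_add_neg] using this)).2
    rw [ht] at this
    convert this using 1
    · ext <;> simp [Ph, e]
    · ext <;> simp [Ph, e]
  · have hm := ph_mono (n := n) (k := k) (a := a.2) (b := a'.2) (by omega) (by omega)
    have hsu := ph_succ (n := n) (k := k) (a := a.2) (by omega)
    rw [← e'] at hsu
    have ht : ((ph n k a'.2 - ph n k a.2).toNat : ℤ) = ph n k a'.2 - ph n k a.2 := by omega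
    have := (walkU H hv hy he (ph n k a'.2 - ph n k a.2).toNat
      (by rw [ht]; unfold Vd Ph at *; simp at *; rw [e]; omega)
      (by
        intro i hi hi'
        exact u2 i (by omega) (by omega) (by omega) (by omega))).2
    rw [ht] at this
    convert this using 1
    · ext <;> simp [Ph, e]
    · ext <;> simp [Ph, e]
  · have hm := ph_mono (n := n) (k := k) (a := a'.1) (b := a.1) (by omega) (by omega)
    have hsu := ph_succ (n := n) (k := k) (a := a'.1) (by omega)
    rw [← e'] at hsu
    have ht : ((ph n k a.1 - ph n k a'.1).toNat : ℤ) = ph n k a.1 - ph n k a'.1 := by omega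
    have := (walkL H hv hy he (ph n k a.1 - ph n k a'.1).toNat
      (by rw [ht]; unfold Vd Ph at *; simp at *; rw [e]; omega)
      (by
        intro i hi hi'
        have := u1 (-i) (by omega) (by omega) (by omega) (by omega)
        simpa [Ph, sub_eq_add_neg] using this)).2
    rw [ht] at this
    convert this using 1
    · ext <;> simp [Ph, e]
    · ext <;> simp [Ph, e]
  · have hm := ph_mono (n := n) (k := k) (a := a.1) (b := a'.1) (by omega) (by omega)
    have hsu := ph_succ (n := n) (k := k) (a := a.1) (by omega)
    rw [← e'] at hsu
    have ht : ((ph n k a'.1 - ph n k a.1).toNat : ℤ) = ph n k a'.1 - ph n k a.1 := by omega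
    have := (walkR H hv hy he (ph n k a'.1 - ph n k a.1).toNat
      (by rw [ht]; unfold Vd Ph at *; simp at *; rw [e]; omega)
      (by
        intro i hi hi'
        exact u1 i (by omega) (by omega) (by omega) (by omega))).2
    rw [ht] at this
    convert this using 1
    · ext <;> simp [Ph, e]
    · ext <;> simp [Ph, e]

lemma road {s l u a b : ℤ × ℤ} (hW : ∀ a, InW l u a → InW (0, 0) (cA n k, cA n k) a ∧
    Vd n k k (Ph n k a - s)) (hab : Con l u (XX n k p) a b)
    (he : Eqr k k p' p (Ph n k a - s) (Ph n k a)) : Eqr k k p' p (Ph n k b - s) (Ph n k b) := by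
  unfold Con at hab
  induction hab with
  | refl => exact he
  | tail _ hst ih =>
    obtain ⟨⟨h1, h2⟩, ⟨h3, h4⟩, h5⟩ := hst
    exact road1 hk hkn H (hW _ h1).1 (hW _ h3).1 h2 h5 (hW _ h1).2 (hW _ h3).2 ih

lemma stage1 (H2 : WR n k p p') {I : ℕ} (hI : Bad (XX n k p) I = ∅) {h : ℤ}
    (hh : 4 * rr I + 4 ≤ h) (hA : 4 * rr I + 4 ≤ cA n k - h)
    (c0 : Core (XX n k p) I (h, h)) (c1 : Core (XX n k p) I (cA n k, h))
    (c2 : Core (XX n k p) I (0, h)) (c3 : Core (XX n k p) I (h, cA n k))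
    (c4 : Core (XX n k p) I (h, 0)) : Eqr k k p' p (Ph n k (h, h)) (Ph n k (h, h)) := by
  have hr := rr_pos I
  have hb1 := ph_nonneg (n := n) (k := k) (a := h) (by omega) hkn (by omega)
  have hb2 := ph_le (n := n) (k := k) (a := h)
  have hPv : Vd n k k (Ph n k (h, h)) := by unfold Vd Ph; simp only; omega
  obtain ⟨x, hx, hex⟩ := H2 _ hPv
  have he0 : Eqr k k p' p x (Ph n k (h, h)) := fun a b h1 h2 h3 h4 => (hex a b h1 h2 h3 h4).symm
  obtain ⟨s, hs⟩ : ∃ s, s = Ph n k (h, h) - x := ⟨_, rfl⟩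
  have hxs : Ph n k (h, h) - s = x := by rw [hs]; simp
  have hs1 : s.1 = ph n k h - x.1 := by rw [hs]; simp [Ph]
  have hs2 : s.2 = ph n k h - x.2 := by rw [hs]; simp [Ph]
  rw [← hxs] at he0
  set l : ℤ × ℤ := (if 0 ≤ s.1 then h else 0, if 0 ≤ s.2 then h else 0) with hl
  set u : ℤ × ℤ := (if 0 ≤ s.1 then cA n k else h, if 0 ≤ s.2 then cA n k else h) with hu
  have hl1 : l.1 = if 0 ≤ s.1 then h else 0 := rfl
  have hl2 : l.2 = if 0 ≤ s.2 then h else 0 := rfl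
  have hu1 : u.1 = if 0 ≤ s.1 then cA n k else h := rfl
  have hu2 : u.2 = if 0 ≤ s.2 then cA n k else h := rfl
  have hW : ∀ a, InW l u a → InW (0, 0) (cA n k, cA n k) a ∧ Vd n k k (Ph n k a - s) := by
    intro a ha
    unfold InW at ha
    have hG : InW (0, 0) (cA n k, cA n k) a := by
      unfold InW; simp only; omega
    refine ⟨hG, ?_⟩
    have h1 := ph_nonneg (n := n) (k := k) (a := a.1) (by omega) hkn hG.1.1
    have h2 := ph_nonneg (n := n) (k := k) (a := a.2) (by omega) hkn hG.2.1
    have h3 := ph_le (n := n) (k := k) (a := a.1)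
    have h4 := ph_le (n := n) (k := k) (a := a.2)
    have g1 : 0 ≤ ph n k a.1 - s.1 ∧ ph n k a.1 - s.1 + k ≤ n := by
      unfold Vd at hx
      by_cases h0 : 0 ≤ s.1
      · have := ph_mono (n := n) (k := k) (a := h) (b := a.1) (by omega) (by omega)
        omega
      · have := ph_mono (n := n) (k := k) (a := a.1) (b := h) (by omega) (by omega)
        omega
    have g2 : 0 ≤ ph n k a.2 - s.2 ∧ ph n k a.2 - s.2 + k ≤ n := by
      unfold Vd at hx
      by_cases h0 : 0 ≤ s.2
      · have := ph_mono (n := n) (k := k) (a := h) (b := a.2) (by omega) (by omega)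
        omega
      · have := ph_mono (n := n) (k := k) (a := a.2) (b := h) (by omega) (by omega)
        omega
    unfold Vd Ph
    simp only [Prod.fst_sub, Prod.snd_sub]
    omega
  have hd1 : 4 * rr I + 4 ≤ u.1 - l.1 := by omega
  have hd2 : 4 * rr I + 4 ≤ u.2 - l.2 := by omega
  have hW0 : InW l u (h, h) := by unfold InW; simp only; omega
  have reach : ∀ b, InW l u b → Core (XX n k p) I b → Eqr k k p' p (Ph n k b - s) (Ph n k b) := by
    intro b hb hbc
    exact road hk hkn H hW (con_core hI hd1 hd2 hW0 hb c0 hbc) he0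
  have hs0 : s = 0 := by
    have n1 : ¬ 0 < s.1 := by
      intro hpos
      have hbW : InW l u (cA n k, h) := by unfold InW; simp only; omega
      have he := reach _ hbW c1
      have hv := (hW _ hbW).2
      have hU := (notXX hk hkn (hW _ hbW).1 (core_notin hI c1)).1 1 (by omega) (by omega)
      simp only [ph_top (n := n) (show 1 ≤ k by omega)] at hU
      have := (stepR H he (by unfold Vd Ph at *; simp [ph_top (n := n) (show 1 ≤ k by omega)] at *; omega)
        (by
          simp only [Ph, ph_top (n := n) (show 1 ≤ k by omega)]
          exact hU (by omega) (by omega))).1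
      unfold Vd Ph at this
      simp [ph_top (n := n) (show 1 ≤ k by omega)] at this
      omega
    have n2 : ¬ s.1 < 0 := by
      intro hpos
      have hbW : InW l u (0, h) := by unfold InW; simp only; omega
      have he := reach _ hbW c2
      have hv := (hW _ hbW).2
      have hU := (notXX hk hkn (hW _ hbW).1 (core_notin hI c2)).1 0 (by omega) (by omega)
      simp only [ph_zero hkn, add_zero] at hU
      have := (stepL H he (by unfold Vd Ph at *; simp [ph_zero hkn] at *; omega)
        (by
          simp only [Ph, ph_zero hkn]
          exact hU (by omega) (by omega))).1
      unfold Vd Ph at this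
      simp [ph_zero hkn] at this
    have n3 : ¬ 0 < s.2 := by
      intro hpos
      have hbW : InW l u (h, cA n k) := by unfold InW; simp only; omega
      have he := reach _ hbW c3
      have hv := (hW _ hbW).2
      have hU := (notXX hk hkn (hW _ hbW).1 (core_notin hI c3)).2 1 (by omega) (by omega)
      simp only [ph_top (n := n) (show 1 ≤ k by omega)] at hU
      have := (stepU H he (by unfold Vd Ph at *; simp [ph_top (n := n) (show 1 ≤ k by omega)] at *; omega)
        (by
          simp only [Ph, ph_top (n := n) (show 1 ≤ k by omega)]
          exact hU (by omega) (by omega))).1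
      unfold Vd Ph at this
      simp [ph_top (n := n) (show 1 ≤ k by omega)] at this
      omega
    have n4 : ¬ s.2 < 0 := by
      intro hpos
      have hbW : InW l u (h, 0) := by unfold InW; simp only; omega
      have he := reach _ hbW c4
      have hv := (hW _ hbW).2
      have hU := (notXX hk hkn (hW _ hbW).1 (core_notin hI c4)).2 0 (by omega) (by omega)
      simp only [ph_zero hkn, add_zero] at hU
      have := (stepD H he (by unfold Vd Ph at *; simp [ph_zero hkn] at *; omega)
        (by
          simp only [Ph, ph_zero hkn]
          exact hU (by omega) (by omega))).1
      unfold Vd Ph at this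
      simp [ph_zero hkn] at this
    ext
    · simp; omega
    · simp; omega
  rw [hs0, sub_zero] at he0
  exact he0

lemma stage1b (H2 : WR n k p p') {I : ℕ} (hI : Bad (XX n k p) I = ∅) {h : ℤ}
    (hh : 4 * rr I + 4 ≤ h) (hA : 4 * rr I + 4 ≤ cA n k - h)
    (c0 : Core (XX n k p) I (h, h)) (c1 : Core (XX n k p) I (cA n k, h))
    (c2 : Core (XX n k p) I (0, h)) (c3 : Core (XX n k p) I (h, cA n k))
    (c4 : Core (XX n k p) I (h, 0)) (a : ℤ × ℤ) (ha : InW (0, 0) (cA n k, cA n k) a)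
    (hac : Core (XX n k p) I a) : Eqr k k p' p (Ph n k a) (Ph n k a) := by
  have he := stage1 hk hkn H H2 hI hh hA c0 c1 c2 c3 c4
  have hr := rr_pos I
  have := road (s := 0) (l := (0, 0)) (u := (cA n k, cA n k)) (b := a) hk hkn H (fun a ha => ⟨ha, by
    have h1 := ph_nonneg (n := n) (k := k) (a := a.1) (by omega) hkn ha.1.1
    have h2 := ph_nonneg (n := n) (k := k) (a := a.2) (by omega) hkn ha.2.1
    have h3 := ph_le (n := n) (k := k) (a := a.1)
    have h4 := ph_le (n := n) (k := k) (a := a.2)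
    unfold Vd Ph; simp; omega⟩)
    (con_core hI (by simp only; omega) (by simp only; omega) (a := (h, h))
      (by unfold InW; simp only; omega) ha c0 hac) (by simpa using he)
  simpa using this

end road
end RP

namespace RP

/-- The window at `y` is the window at `x` altered by the pattern `e`. -/
def Sh (k : ℤ) (p e : ℤ × ℤ → Bool) (x y : ℤ × ℤ) : Prop :=
  ∀ c ∈ rc k k x, p (c + (y - x)) = xor (p c) (e c)

lemma Sh_back {k : ℤ} {p e : ℤ × ℤ → Bool} {x y c : ℤ × ℤ} (h : Sh k p e x y) (hc : c ∈ rc k k y) :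
    p c = xor (p (c - (y - x))) (e (c - (y - x))) := by
  have := h (c - (y - x)) (by rw [mem_rc] at hc ⊢; simp; omega)
  simpa using this

lemma Sh_forw {k : ℤ} {p e : ℤ × ℤ → Bool} {x y c : ℤ × ℤ} (h : Sh k p e x y) (hc : c ∈ rc k k x) :
    p c = xor (p (c + (y - x))) (e c) := by
  rw [h c hc]; simp

lemma card_rck (k : ℕ) (z : ℤ × ℤ) : (rc k k z).card = k ^ 2 := by
  rw [card_rc]; simp [sq]

lemma Vd_ell {n k : ℕ} (hk : 1 ≤ k) {x y : ℤ × ℤ} (hx : Vd n k k x) (hy : Vd n k k y) (h : x ≠ y) :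
    ell n x ≠ ell n y := by
  unfold Vd at hx hy
  exact ell_ne (by rw [mem_box]; omega) (by rw [mem_box]; omega) h

/-- One altered window. -/
lemma sh_pr1 {n k : ℕ} (hk : 1 ≤ k) (e : ℤ × ℤ → Bool) {x y : ℤ × ℤ} (hx : Vd n k k x) (hy : Vd n k k y)
    (hne : x ≠ y) : pr n (fun P => Sh k (px n P) e x y) ≤ (1 / 2) ^ (k ^ 2) := by
  have hl := Vd_ell hk hx hy hne
  rcases lt_or_gt_of_ne hl with hlt | hlt
  · have := glb (n := n) (rc k k y) (fun c => c - (y - x)) (fun c => e (c - (y - x))) (ell n)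
      (fun c hc => rc_box hy hc)
      (fun c hc => rc_box hx (by
        rw [mem_rc] at hc ⊢; simp; omega))
      (fun c hc => by rw [ell_sub, ell_sub]; omega)
    rw [card_rck] at this
    exact le_trans (pr_mono fun P hP c hc => Sh_back hP hc) this
  · have := glb (n := n) (rc k k x) (fun c => c + (y - x)) e (ell n)
      (fun c hc => rc_box hx hc)
      (fun c hc => rc_box hy (by
        rw [mem_rc] at hc ⊢; simp; omega))
      (fun c hc => by rw [ell_add, ell_sub]; omega)
    rw [card_rck] at this
    exact le_trans (pr_mono fun P hP c hc => Sh_forw hP hc) this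

lemma card_two {k : ℕ} {z z' : ℤ × ℤ} (h : ¬ nr (k - 1) z z') : (rc k k z ∪ rc k k z').card = 2 * k ^ 2 := by
  rw [Finset.card_union_of_disjoint, card_rck, card_rck]
  · ring
  rw [Finset.disjoint_left]
  intro c hc hc'
  rw [mem_rc] at hc hc'
  apply h
  unfold nr
  omega

lemma rc_far {k : ℕ} {z z' c : ℤ × ℤ} (h : ¬ nr (k - 1) z z') (hc : c ∈ rc k k z) : c ∉ rc k k z' := by
  intro hc'
  rw [mem_rc] at hc hc'
  apply h
  unfold nr
  omega

lemma rc_sh {k : ℤ} {x y c : ℤ × ℤ} (hc : c ∈ rc k k x) : c + (y - x) ∈ rc k k y := by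
  rw [mem_rc] at hc ⊢; simp; omega

lemma rc_shb {k : ℤ} {x y c : ℤ × ℤ} (hc : c ∈ rc k k y) : c - (y - x) ∈ rc k k x := by
  rw [mem_rc] at hc ⊢; simp; omega

open scoped Classical in
/-- One far shift and one near shift. -/
lemma sh_pr2 {n k : ℕ} (hk : 1 ≤ k) (e : ℤ × ℤ → Bool) {x y x' y' : ℤ × ℤ} (hx : Vd n k k x)
    (hy : Vd n k k y) (hx' : Vd n k k x') (hy' : Vd n k k y')
    (hxx : nr k x x') (hxy : ¬ nr (8 * k) x y) (hxy' : nr (4 * k) x' y') (hne : x' ≠ y') :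
    pr n (fun P => Sh k (px n P) e x y ∧ Sh k (px n P) e x' y') ≤ (1 / 2) ^ (2 * k ^ 2) := by
  have hl := Vd_ell hk hx' hy' hne
  have f1 : ¬ nr (k - 1) x y := by unfold nr at *; omega
  have f2 : ¬ nr (k - 1) x' y := by unfold nr at *; omega
  have f3 : ¬ nr (k - 1) y' y := by unfold nr at *; omega
  have f2' : ¬ nr (k - 1) y x' := by unfold nr at *; omega
  have f3' : ¬ nr (k - 1) y y' := by unfold nr at *; omega
  obtain ⟨M, hM⟩ : ∃ M : ℤ, ∀ c ∈ box n, ell n c < M := by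
    refine ⟨2 * n * n + n + 1, fun c hc => ?_⟩
    rw [mem_box] at hc
    unfold ell
    nlinarith
  rcases lt_or_gt_of_ne hl with hlt | hlt
  · have := glb (n := n) (rc k k y ∪ rc k k y')
      (fun c => if c ∈ rc k k y then c - (y - x) else c - (y' - x'))
      (fun c => if c ∈ rc k k y then e (c - (y - x)) else e (c - (y' - x')))
      (fun c => if c ∈ rc k k y then M else ell n c)
      (fun c hc => by
        rcases Finset.mem_union.1 hc with h | h
        · exact rc_box hy h
        · exact rc_box hy' h)
      (fun c hc => by
        by_cases h : c ∈ rc k k y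
        · rw [if_pos h]; exact rc_box hx (rc_shb h)
        · rw [if_neg h]
          exact rc_box hx' (rc_shb ((Finset.mem_union.1 hc).resolve_left h)))
      (fun c hc => by
        by_cases h : c ∈ rc k k y
        · simp only [if_pos h]
          rw [if_neg (rc_far f1 (rc_shb h))]
          exact hM _ (rc_box hx (rc_shb h))
        · simp only [if_neg h]
          have h' := (Finset.mem_union.1 hc).resolve_left h
          rw [if_neg (rc_far f2 (rc_shb h')), ell_sub, ell_sub]
          omega)
    rw [card_two f3'] at this
    refine le_trans (pr_mono fun P hP c hc => ?_) this
    by_cases h : c ∈ rc k k y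
    · simp only [if_pos h]; exact Sh_back hP.1 h
    · simp only [if_neg h]; exact Sh_back hP.2 ((Finset.mem_union.1 hc).resolve_left h)
  · have := glb (n := n) (rc k k y ∪ rc k k x')
      (fun c => if c ∈ rc k k y then c - (y - x) else c + (y' - x'))
      (fun c => if c ∈ rc k k y then e (c - (y - x)) else e c)
      (fun c => if c ∈ rc k k y then M else ell n c)
      (fun c hc => by
        rcases Finset.mem_union.1 hc with h | h
        · exact rc_box hy h
        · exact rc_box hx' h)
      (fun c hc => by
        by_cases h : c ∈ rc k k y
        · rw [if_pos h]; exact rc_box hx (rc_shb h)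
        · rw [if_neg h]
          exact rc_box hy' (rc_sh ((Finset.mem_union.1 hc).resolve_left h)))
      (fun c hc => by
        by_cases h : c ∈ rc k k y
        · simp only [if_pos h]
          rw [if_neg (rc_far f1 (rc_shb h))]
          exact hM _ (rc_box hx (rc_shb h))
        · simp only [if_neg h]
          have h' := (Finset.mem_union.1 hc).resolve_left h
          rw [if_neg (rc_far f3 (rc_sh h')), ell_add, ell_sub]
          omega)
    rw [card_two f2'] at this
    refine le_trans (pr_mono fun P hP c hc => ?_) this
    by_cases h : c ∈ rc k k y
    · simp only [if_pos h]; exact Sh_back hP.1 h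
    · simp only [if_neg h]; exact Sh_forw hP.2 ((Finset.mem_union.1 hc).resolve_left h)

open scoped Classical in
/-- Two different far shifts. -/
lemma sh_pr3 {n k : ℕ} (hk : 1 ≤ k) (e : ℤ × ℤ → Bool) {x y x' y' : ℤ × ℤ} (hx : Vd n k k x)
    (hy : Vd n k k y) (hx' : Vd n k k x') (hy' : Vd n k k y')
    (hxx : nr k x x') (hxy : ¬ nr (4 * k) x y) (hxy' : ¬ nr (4 * k) x' y') (hne : y - x ≠ y' - x') :
    pr n (fun P => Sh k (px n P) e x y ∧ Sh k (px n P) e x' y') ≤ (1 / 2) ^ (2 * k ^ 2) := by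
  have hl : ell n (y - x - (y' - x')) ≠ 0 := by
    unfold Vd at *
    exact ell_ne_zero (by simp; omega) (by simp; omega) (sub_ne_zero.mpr hne)
  have f1 : ¬ nr (k - 1) y x := by unfold nr at *; omega
  have f2 : ¬ nr (k - 1) y x' := by unfold nr at *; omega
  have f3 : ¬ nr (k - 1) y' x := by unfold nr at *; omega
  have f4 : ¬ nr (k - 1) y' x' := by unfold nr at *; omega
  obtain ⟨τ, hτ⟩ : ∃ τ : ℤ, 1 ≤ τ * ell n (y - x - (y' - x')) := by
    rcases lt_or_gt_of_ne hl with h | h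
    · exact ⟨-1, by omega⟩
    · exact ⟨1, by omega⟩
  rw [ell_sub, ell_sub, ell_sub] at hτ
  have := glb (n := n) (rc k k y ∪ rc k k x')
      (fun c => if c ∈ rc k k y then c - (y - x) else c + (y' - x'))
      (fun c => if c ∈ rc k k y then e (c - (y - x)) else e c)
      (fun c => if c ∈ rc k k x ∨ c ∈ rc k k x' then 2 * (τ * ell n c) - 1
        else 2 * (τ * ell n (c - (y - x))))
      (fun c hc => by
        rcases Finset.mem_union.1 hc with h | h
        · exact rc_box hy h
        · exact rc_box hx' h)
      (fun c hc => by
        by_cases h : c ∈ rc k k y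
        · rw [if_pos h]; exact rc_box hx (rc_shb h)
        · rw [if_neg h]
          exact rc_box hy' (rc_sh ((Finset.mem_union.1 hc).resolve_left h)))
      (fun c hc => by
        by_cases h : c ∈ rc k k y
        · simp only [if_pos h]
          rw [if_pos (Or.inl (rc_shb h)), if_neg (by
            rintro (h1 | h1)
            · exact rc_far f1 h h1
            · exact rc_far f2 h h1)]
          omega
        · simp only [if_neg h]
          have h' := (Finset.mem_union.1 hc).resolve_left h
          rw [if_pos (Or.inr h'), if_neg (by
            rintro (h1 | h1)
            · exact rc_far f3 (rc_sh h') h1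
            · exact rc_far f4 (rc_sh h') h1)]
          rw [ell_sub, ell_add, ell_sub, ell_sub]
          nlinarith)
  rw [card_two f2] at this
  refine le_trans (pr_mono fun P hP c hc => ?_) this
  by_cases h : c ∈ rc k k y
  · simp only [if_pos h]; exact Sh_back hP.1 h
  · simp only [if_neg h]; exact Sh_forw hP.2 ((Finset.mem_union.1 hc).resolve_left h)

end RP

namespace RP

/-- Compatibility of two target windows: equal shifts or disjoint. -/
def cp (k : ℤ) (i j : ℕ) (a b : ℤ × ℤ) : Prop := b = (a.1 + (j - i), a.2) ∨ ¬ nr (k - 1) a b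

open scoped Classical in
/-- Union of the target windows. -/
noncomputable def Un (k : ℕ) (j : ℕ) (y : ℕ → ℤ × ℤ) : Finset (ℤ × ℤ) :=
  (Finset.range j).biUnion fun i => rc k k (y i)

lemma mem_Un {k j : ℕ} {y : ℕ → ℤ × ℤ} {c : ℤ × ℤ} : c ∈ Un k j y ↔ ∃ i < j, c ∈ rc k k (y i) := by
  classical
  unfold Un
  simp

lemma half_le {U s : Finset (ℤ × ℤ)} {m : ℕ} (h : m ≤ s.card) (hs : ∀ c ∈ s, c ∈ U) :
    ((1 : ℝ) / 2) ^ U.card ≤ (1 / 2) ^ m :=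
  pow_le_pow_of_le_one (by norm_num) (by norm_num) (h.trans (Finset.card_le_card hs))

open scoped Classical in
lemma new_cells {k j : ℕ} (hk : 2 ≤ k) (hj : 1 ≤ j) (y : ℕ → ℤ × ℤ) (s : ℤ × ℤ)
    (hc : ∀ i < j, cp k i j (y i) s) :
    ((1 : ℝ) / 2) ^ (rc k k s \ Un k j y).card ≤
      (if s = ((y (j - 1)).1 + 1, (y (j - 1)).2) then (1 / 2) ^ k else 0) +
      (∑ i ∈ Finset.range j, if s = ((y i).1 + (j - i), (y i).2) then (1 / 2) ^ (2 * k) else 0) +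
      (1 / 2) ^ (k ^ 2) := by
  have n1 : (0 : ℝ) ≤ (if s = ((y (j - 1)).1 + 1, (y (j - 1)).2) then (1 / 2) ^ k else 0) := by
    split_ifs <;> positivity
  have n2' : ∀ i ∈ Finset.range j, (0 : ℝ) ≤
      if s = ((y i).1 + (j - i), (y i).2) then (1 / 2) ^ (2 * k) else 0 := by
    intro i _; split_ifs <;> positivity
  have n2 := Finset.sum_nonneg n2'
  have n3 : (0 : ℝ) ≤ (1 / 2) ^ (k ^ 2) := by positivity
  by_cases h1 : s = ((y (j - 1)).1 + 1, (y (j - 1)).2)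
  · rw [if_pos h1]
    have : ((1 : ℝ) / 2) ^ (rc k k s \ Un k j y).card ≤ (1 / 2) ^ k := by
      apply half_le (s := rc 1 k (s.1 + k - 1, s.2))
      · rw [card_rc]; simp
      intro c hcc
      rw [mem_rc] at hcc
      rw [Finset.mem_sdiff, mem_Un, mem_rc]
      simp only at hcc
      refine ⟨by omega, ?_⟩
      rintro ⟨i, hi, hci⟩
      rw [mem_rc] at hci
      rcases hc i hi with h | h
      · rw [Prod.ext_iff] at h
        simp only at h
        omega
      · apply h; unfold nr; omega
    linarith
  by_cases h2 : ∃ i < j, s = ((y i).1 + (j - i), (y i).2)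
  · have : ((1 : ℝ) / 2) ^ (rc k k s \ Un k j y).card ≤ (1 / 2) ^ (2 * k) := by
      apply half_le (s := rc 2 k (s.1 + k - 2, s.2))
      · rw [card_rc]; simp
      intro c hcc
      rw [mem_rc] at hcc
      rw [Finset.mem_sdiff, mem_Un, mem_rc]
      simp only at hcc
      refine ⟨by omega, ?_⟩
      rintro ⟨i, hi, hci⟩
      rw [mem_rc] at hci
      rcases hc i hi with h | h
      · have : i ≠ j - 1 := by
          rintro rfl
          apply h1
          rw [h]
          ext
          · simp; omega
          · simp
        rw [Prod.ext_iff] at h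
        simp only at h
        omega
      · apply h; unfold nr; omega
    obtain ⟨i, hi, hi'⟩ := h2
    have h3 := Finset.single_le_sum n2' (Finset.mem_range.2 hi)
    rw [if_pos hi'] at h3
    linarith
  · have : ((1 : ℝ) / 2) ^ (rc k k s \ Un k j y).card ≤ (1 / 2) ^ (k ^ 2) := by
      apply half_le (s := rc k k s)
      · rw [card_rck]
      intro c hcc
      rw [Finset.mem_sdiff, mem_Un]
      refine ⟨hcc, ?_⟩
      rintro ⟨i, hi, hci⟩
      rcases hc i hi with h | h
      · exact h2 ⟨i, hi, h⟩
      · exact rc_far h hci hcc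
    linarith

/-- The growth factor. -/
noncomputable def qq (n k : ℕ) : ℝ := (1 / 2) ^ k + k * (1 / 2) ^ (2 * k) + n ^ 2 * (1 / 2) ^ (k ^ 2)

open scoped Classical in
lemma new_sum {n k j : ℕ} (hk : 2 ≤ k) (hj : 1 ≤ j) (hjk : j ≤ k) (y : ℕ → ℤ × ℤ) :
    ∑ s ∈ (box n).filter (fun s => ∀ i < j, cp k i j (y i) s),
      ((1 : ℝ) / 2) ^ (rc k k s \ Un k j y).card ≤ qq n k := by
  have key : ∀ (a : ℤ × ℤ) (m : ℕ) (T : Finset (ℤ × ℤ)),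
      ∑ s ∈ T, (if s = a then ((1 : ℝ) / 2) ^ m else 0) ≤ (1 / 2) ^ m := by
    intro a m T
    rw [Finset.sum_ite_eq']
    split_ifs
    · exact le_rfl
    · positivity
  refine (Finset.sum_le_sum fun s hs => new_cells hk hj y s (Finset.mem_filter.1 hs).2).trans ?_
  rw [Finset.sum_add_distrib, Finset.sum_add_distrib]
  unfold qq
  refine add_le_add (add_le_add (key _ _ _) ?_) ?_
  · rw [Finset.sum_comm]
    refine (Finset.sum_le_sum fun i _ => key _ _ _).trans ?_
    simp only [Finset.sum_const, Finset.card_range, nsmul_eq_mul]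
    gcongr
  · rw [Finset.sum_const, nsmul_eq_mul]
    gcongr
    have := Finset.card_filter_le (box n) (fun s => ∀ i < j, cp k i j (y i) s)
    rw [card_box] at this
    exact_mod_cast this

/-- Start positions of the source windows. -/
def xj (x : ℤ × ℤ) (j : ℕ) : ℤ × ℤ := (x.1 + j, x.2)

/-- Good configurations of target windows. -/
def Gd (n k : ℕ) (x : ℤ × ℤ) (y : ℕ → ℤ × ℤ) : Prop :=
  ∀ j < k, Vd n k k (y j) ∧ ¬ nr (3 * k) x (y j) ∧ ∀ i < j, cp k i j (y i) (y j)

open scoped Classical in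
lemma main_base {n k : ℕ} (e : ℤ × ℤ → Bool) {x : ℤ × ℤ} (hx : ∀ j < k, Vd n k k (xj x j))
    {y : ℕ → ℤ × ℤ} (hy : Gd n k x y) :
    pr n (fun P => ∀ j < k, Sh k (px n P) e (xj x j) (y j)) ≤ (1 / 2) ^ (Un k k y).card := by
  have hch : ∀ c : ℤ × ℤ, ∃ j : ℕ, c ∈ Un k k y → j < k ∧ c ∈ rc k k (y j) := by
    intro c
    by_cases h : c ∈ Un k k y
    · obtain ⟨j, h1, h2⟩ := mem_Un.1 h
      exact ⟨j, fun _ => ⟨h1, h2⟩⟩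
    · exact ⟨0, fun h' => absurd h' h⟩
  choose J hJ using hch
  have := glb (n := n) (Un k k y) (fun c => c - (y (J c) - xj x (J c)))
    (fun c => e (c - (y (J c) - xj x (J c))))
    (fun c => if c ∈ Un k k y then 1 else 0)
    (fun c hc => rc_box (hy _ (hJ c hc).1).1 (hJ c hc).2)
    (fun c hc => rc_box (hx _ (hJ c hc).1) (rc_shb (hJ c hc).2))
    (fun c hc => by
      rw [if_pos hc, if_neg]
      · norm_num
      intro h
      obtain ⟨i, hi, hci⟩ := mem_Un.1 h
      have h1 := rc_shb (x := xj x (J c)) (hJ c hc).2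
      have h2 := (hy i hi).2.1
      have h3 := (hJ c hc).1
      rw [mem_rc] at h1 hci
      unfold xj at *
      apply h2
      unfold nr
      simp only [Prod.fst_sub, Prod.snd_sub] at *
      omega)
  refine le_trans (pr_mono fun P hP c hc => ?_) this
  exact Sh_back (hP _ (hJ c hc).1) (hJ c hc).2

open scoped Classical in
lemma main_ind {n k : ℕ} (hk : 2 ≤ k) (e : ℤ × ℤ → Bool) {x : ℤ × ℤ}
    (hx : ∀ j < k, Vd n k k (xj x j)) (m : ℕ) : ∀ j, 1 ≤ j → j + m = k → ∀ y : ℕ → ℤ × ℤ,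
    pr n (fun P => ∃ y', (∀ i < j, y' i = y i) ∧ Gd n k x y' ∧
      ∀ j < k, Sh k (px n P) e (xj x j) (y' j)) ≤ (1 / 2) ^ (Un k j y).card * qq n k ^ m := by
  have hq : 0 ≤ qq n k := by unfold qq; positivity
  induction m with
  | zero =>
    intro j hj hjm y
    obtain rfl : j = k := by omega
    rw [pow_zero, mul_one]
    by_cases hy : Gd n j x y
    · refine le_trans (pr_mono ?_) (main_base e hx hy)
      rintro P ⟨y', h1, -, h2⟩ i hi
      rw [← h1 i hi]; exact h2 i hi
    · rw [pr_zero]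
      · positivity
      rintro P ⟨y', h1, h2, -⟩
      apply hy
      intro i hi
      have := h2 i hi
      rw [h1 i hi] at this
      refine ⟨this.1, this.2.1, fun l hl => ?_⟩
      rw [← h1 l (by omega)]
      exact this.2.2 l hl
  | succ m ih =>
    intro j hj hjm y
    have hstep := pr_exists (n := n) ((box n).filter (fun s => ∀ i < j, cp k i j (y i) s))
      (fun s P => ∃ y', (∀ i < j + 1, y' i = Function.update y j s i) ∧ Gd n k x y' ∧
      ∀ j < k, Sh k (px n P) e (xj x j) (y' j))
    refine le_trans (pr_mono ?_) (hstep.trans ?_)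
    · rintro P ⟨y', h1, h2, h3⟩
      refine ⟨y' j, ?_, y', ?_, h2, h3⟩
      · rw [Finset.mem_filter]
        have h4 := h2 j (by omega)
        refine ⟨?_, fun i hi => ?_⟩
        · have := h4.1; unfold Vd at this; rw [mem_box]; omega
        · rw [← h1 i hi]; exact h4.2.2 i hi
      · intro i hi
        by_cases hij : i = j
        · subst hij; simp
        · rw [Function.update_of_ne hij]; exact h1 i (by omega)
    · calc _ ≤ ∑ s ∈ (box n).filter (fun s => ∀ i < j, cp k i j (y i) s),
            (((1 : ℝ) / 2) ^ (Un k j y).card * qq n k ^ m) * (1 / 2) ^ (rc k k s \ Un k j y).card := by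
            refine Finset.sum_le_sum fun s hs => (ih (j + 1) (by omega) (by omega) _).trans ?_
            have : (Un k (j + 1) (Function.update y j s)).card =
                (Un k j y).card + (rc k k s \ Un k j y).card := by
              rw [← Finset.card_union_of_disjoint Finset.disjoint_sdiff]
              congr 1
              ext c
              rw [mem_Un, Finset.mem_union, Finset.mem_sdiff, mem_Un]
              constructor
              · rintro ⟨i, hi, hci⟩
                by_cases hij : i = j
                · subst hij
                  rw [Function.update_self] at hci
                  tauto
                · rw [Function.update_of_ne hij] at hci
                  exact Or.inl ⟨i, by omega, hci⟩
              · rintro (⟨i, hi, hci⟩ | ⟨h1, -⟩)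
                · exact ⟨i, by omega, by rwa [Function.update_of_ne (by omega)]⟩
                · exact ⟨j, by omega, by rwa [Function.update_self]⟩
            rw [this, pow_add]
            apply le_of_eq; ring
        _ ≤ (((1 : ℝ) / 2) ^ (Un k j y).card * qq n k ^ m) * qq n k := by
            rw [← Finset.mul_sum]
            exact mul_le_mul_of_nonneg_left (new_sum hk hj (by omega) y) (by positivity)
        _ = _ := by ring

lemma main_pr {n k : ℕ} (hk : 2 ≤ k) (e : ℤ × ℤ → Bool) {x : ℤ × ℤ}
    (hx : ∀ j < k, Vd n k k (xj x j)) :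
    pr n (fun P => ∃ y', Gd n k x y' ∧ ∀ j < k, Sh k (px n P) e (xj x j) (y' j)) ≤
      n ^ 2 * ((1 / 2) ^ (k ^ 2) * qq n k ^ (k - 1)) := by
  have h := pr_exists_le (n := n) (box n) (fun s P => ∃ y', (∀ i < 1, y' i = (fun _ => s) i) ∧
    Gd n k x y' ∧ ∀ j < k, Sh k (px n P) e (xj x j) (y' j))
    ((1 / 2) ^ (k ^ 2) * qq n k ^ (k - 1)) (fun s _ => by
      have := main_ind hk e hx (k - 1) 1 le_rfl (by omega) (fun _ => s)
      have h2 : Un k 1 (fun _ => s) = rc k k s := by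
        ext c; rw [mem_Un]; simp
      rw [h2, card_rck] at this
      exact this)
  rw [card_box] at h
  push_cast at h
  refine le_trans (pr_mono ?_) h
  rintro P ⟨y', h1, h2⟩
  refine ⟨y' 0, ?_, y', ?_, h1, h2⟩
  · have := (h1 0 (by omega)).1; unfold Vd at this; rw [mem_box]; omega
  · intro i hi
    have : i = 0 := by omega
    simp [this]

end RP

namespace RP

/-- Error pattern. -/
def ep (k : ℤ) (x : ℤ × ℤ) (A : Finset ℤ) (c : ℤ × ℤ) : Bool :=
  decide (c.2 = x.2 + (k - 1) ∧ (c.1 = x.1 + (k - 1) ∨ c.1 - (x.1 + (k - 1)) ∈ A))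

/-- Extremal event. -/
def EE (n k : ℕ) (p : ℤ × ℤ → Bool) : Prop :=
  ∃ x : ℤ × ℤ, ∃ A ∈ (Finset.Ioo (0 : ℤ) k).powerset, (∀ j < k, Vd n k k (xj x j)) ∧
    ∃ y : ℕ → ℤ × ℤ, ∀ j < k, Vd n k k (y j) ∧ xj x j ≠ y j ∧ Sh k p (ep k x A) (xj x j) (y j)

/-- Centered square. -/
noncomputable def sq0 (r : ℤ) : Finset (ℤ × ℤ) := Finset.Icc (-r) r ×ˢ Finset.Icc (-r) r

lemma mem_sq0 {r : ℤ} {t : ℤ × ℤ} : t ∈ sq0 r ↔ nr r t 0 := by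
  unfold sq0 nr
  rw [Finset.mem_product, Finset.mem_Icc, Finset.mem_Icc]
  simp only [Prod.fst_zero, Prod.snd_zero]
  omega

lemma card_sq0 (r : ℕ) : (sq0 r).card = (2 * r + 1) ^ 2 := by
  unfold sq0
  rw [Finset.card_product, Int.card_Icc, sq]
  congr 1 <;> omega

lemma xj_zero (x : ℤ × ℤ) : xj x 0 = x := by unfold xj; simp

lemma EA1 {n k : ℕ} (hk : 2 ≤ k) : pr n (fun P => ∃ x : ℤ × ℤ, ∃ A ∈ (Finset.Ioo (0 : ℤ) k).powerset,
    Vd n k k x ∧ ∃ y, Vd n k k y ∧ x ≠ y ∧ nr (8 * k) x y ∧ Sh k (px n P) (ep k x A) x y) ≤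
    n ^ 2 * (16 * k + 1) ^ 2 * (1 / 2) ^ (k ^ 2) := by
  have h := pr_exists_le (n := n) (box n ×ˢ sq0 ((8 * k : ℕ) : ℤ))
    (fun i P => Vd n k k i.1 ∧ Vd n k k (i.1 + i.2) ∧ i.1 ≠ i.1 + i.2 ∧
      Sh k (px n P) (ep k i.1 ∅) i.1 (i.1 + i.2)) ((1 / 2) ^ (k ^ 2)) (fun i _ => by
      by_cases h : Vd n k k i.1 ∧ Vd n k k (i.1 + i.2) ∧ i.1 ≠ i.1 + i.2
      · refine le_trans (pr_mono ?_) (sh_pr1 (by omega) (ep k i.1 ∅) h.1 h.2.1 h.2.2)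
        rintro P hP; exact hP.2.2.2
      · rw [pr_zero (by tauto)]; positivity)
  rw [Finset.card_product, card_box, card_sq0] at h
  refine le_trans (pr_mono ?_) (h.trans (le_of_eq ?_))
  · rintro P ⟨x, A, hA, hx, y, hy, hne, hn, hs⟩
    refine ⟨(x, y - x), ?_, hx, ?_, ?_, ?_⟩
    · rw [Finset.mem_product, mem_box, mem_sq0]
      unfold nr Vd at *
      simp only [Prod.fst_sub, Prod.snd_sub, Prod.fst_zero, Prod.snd_zero]
      push_cast
      omega
    · simpa using hy
    · simpa using hne
    · simp only [add_sub_cancel]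
      intro c hc
      rw [hs c hc]
      congr 1
      rw [mem_rc] at hc
      rw [Finset.mem_powerset] at hA
      unfold ep
      have : c.1 - (x.1 + (k - 1)) ∉ A := by
        intro h
        have := hA h
        rw [Finset.mem_Ioo] at this
        omega
      simp [this]
  · push_cast; ring

lemma EA2 {n k : ℕ} (hk : 2 ≤ k) (e : ℤ × ℤ → Bool) (x : ℤ × ℤ) (hx : ∀ j < k, Vd n k k (xj x j)) :
    pr n (fun P => ∃ y : ℕ → ℤ × ℤ, (∀ j < k, Vd n k k (y j) ∧ xj x j ≠ y j ∧
      Sh k (px n P) e (xj x j) (y j)) ∧ ¬ nr (8 * k) x (y 0) ∧ ∃ j < k, nr (4 * k) (xj x j) (y j)) ≤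
    k * n ^ 2 * (8 * k + 1) ^ 2 * (1 / 2) ^ (2 * k ^ 2) := by
  have h := pr_exists_le (n := n) (Finset.range k ×ˢ box n ×ˢ sq0 ((4 * k : ℕ) : ℤ))
    (fun i P => i.1 < k ∧ Vd n k k i.2.1 ∧ Vd n k k (xj x i.1 + i.2.2) ∧ ¬ nr (8 * k) x i.2.1 ∧
      nr (4 * k) (xj x i.1) (xj x i.1 + i.2.2) ∧ xj x i.1 ≠ xj x i.1 + i.2.2 ∧
      Sh k (px n P) e x i.2.1 ∧ Sh k (px n P) e (xj x i.1) (xj x i.1 + i.2.2))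
      ((1 / 2) ^ (2 * k ^ 2)) (fun i _ => by
      by_cases h : i.1 < k ∧ Vd n k k i.2.1 ∧ Vd n k k (xj x i.1 + i.2.2) ∧ ¬ nr (8 * k) x i.2.1 ∧
        nr (4 * k) (xj x i.1) (xj x i.1 + i.2.2) ∧ xj x i.1 ≠ xj x i.1 + i.2.2
      · obtain ⟨h1, h2, h3, h4, h5, h6⟩ := h
        refine le_trans (pr_mono ?_) (sh_pr2 (by omega) e (by
          have := hx 0 (by omega); rwa [xj_zero] at this) h2 (hx _ h1) h3 (by
          unfold nr xj; simp; omega) h4 h5 h6)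
        rintro P hP; exact hP.2.2.2.2.2.2
      · rw [pr_zero (by tauto)]; positivity)
  rw [Finset.card_product, Finset.card_product, card_box, card_sq0, Finset.card_range] at h
  refine le_trans (pr_mono ?_) (h.trans (le_of_eq ?_))
  · rintro P ⟨y, hy, h8, j, hj, hjn⟩
    have h0 := hy 0 (by omega)
    have h1 := hy j hj
    rw [xj_zero] at h0
    refine ⟨(j, y 0, y j - xj x j), ?_, hj, h0.1, ?_, h8, ?_, ?_, h0.2.2, ?_⟩
    · rw [Finset.mem_product, Finset.mem_product, mem_box, mem_sq0, Finset.mem_range]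
      have h0 := h0.1
      unfold nr Vd at *
      simp only [Prod.fst_sub, Prod.snd_sub, Prod.fst_zero, Prod.snd_zero]
      push_cast
      omega
    · simpa using h1.1
    · simpa using hjn
    · simpa using h1.2.1
    · simpa using h1.2.2
  · push_cast; ring

lemma EA3 {n k : ℕ} (hk : 2 ≤ k) (e : ℤ × ℤ → Bool) (x : ℤ × ℤ) (hx : ∀ j < k, Vd n k k (xj x j)) :
    pr n (fun P => ∃ y : ℕ → ℤ × ℤ, (∀ j < k, Vd n k k (y j) ∧
      Sh k (px n P) e (xj x j) (y j)) ∧ (∀ j < k, ¬ nr (4 * k) (xj x j) (y j)) ∧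
      ∃ i < k, ∃ j < k, y i - xj x i ≠ y j - xj x j ∧ nr (2 * k) (y i - xj x i) (y j - xj x j)) ≤
    k ^ 2 * n ^ 2 * (4 * k + 1) ^ 2 * (1 / 2) ^ (2 * k ^ 2) := by
  have h := pr_exists_le (n := n) (Finset.range k ×ˢ Finset.range k ×ˢ box n ×ˢ sq0 ((2 * k : ℕ) : ℤ))
    (fun i P => ∃ z, z = i.2.2.2 + (i.2.2.1 - xj x i.1) + xj x i.2.1 ∧
      (i.1 < k ∧ i.2.1 < k ∧ Vd n k k i.2.2.1 ∧ Vd n k k z ∧ ¬ nr (4 * k) (xj x i.1) i.2.2.1 ∧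
      ¬ nr (4 * k) (xj x i.2.1) z ∧ i.2.2.1 - xj x i.1 ≠ z - xj x i.2.1) ∧
      Sh k (px n P) e (xj x i.1) i.2.2.1 ∧ Sh k (px n P) e (xj x i.2.1) z)
      ((1 / 2) ^ (2 * k ^ 2)) (fun i _ => by
      obtain ⟨z, hz⟩ : ∃ z, z = i.2.2.2 + (i.2.2.1 - xj x i.1) + xj x i.2.1 := ⟨_, rfl⟩
      by_cases h : (i.1 < k ∧ i.2.1 < k ∧ Vd n k k i.2.2.1 ∧ Vd n k k z ∧
        ¬ nr (4 * k) (xj x i.1) i.2.2.1 ∧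
        ¬ nr (4 * k) (xj x i.2.1) z ∧ i.2.2.1 - xj x i.1 ≠ z - xj x i.2.1)
      · obtain ⟨h1, h2, h3, h4, h5, h6, h7⟩ := h
        refine le_trans (pr_mono ?_) (sh_pr3 (by omega) e (hx _ h1) h3 (hx _ h2) h4 (by
          unfold nr xj; simp; omega) h5 h6 h7)
        rintro P ⟨z', hz', hP⟩
        rw [hz', ← hz] at hP
        exact hP.2
      · rw [pr_zero]
        · positivity
        rintro P ⟨z', hz', hP⟩
        rw [hz', ← hz] at hP
        exact h hP.1)
  rw [Finset.card_product, Finset.card_product, Finset.card_product, card_box, card_sq0,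
    Finset.card_range] at h
  refine le_trans (pr_mono ?_) (h.trans (le_of_eq ?_))
  · rintro P ⟨y, hy, h4, i, hi, j, hj, hne, hjn⟩
    refine ⟨(i, j, y i, y j - xj x j - (y i - xj x i)), ?_, y j, ?_, ⟨hi, hj, (hy i hi).1, (hy j hj).1,
      h4 i hi, h4 j hj, hne⟩, (hy i hi).2, (hy j hj).2⟩
    · rw [Finset.mem_product, Finset.mem_product, Finset.mem_product, mem_box, mem_sq0,
        Finset.mem_range, Finset.mem_range]
      have h0 := (hy i hi).1
      unfold nr Vd at *
      simp only [Prod.fst_sub, Prod.snd_sub, Prod.fst_zero, Prod.snd_zero] at *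
      push_cast
      omega
    · simp
  · push_cast; ring

lemma EE_pr {n k : ℕ} (hk : 2 ≤ k) : pr n (fun P => EE n k (px n P)) ≤
    n ^ 2 * (16 * k + 1) ^ 2 * (1 / 2) ^ (k ^ 2) +
    n ^ 2 * 2 ^ (k - 1) * (k * n ^ 2 * (8 * k + 1) ^ 2 * (1 / 2) ^ (2 * k ^ 2) +
    k ^ 2 * n ^ 2 * (4 * k + 1) ^ 2 * (1 / 2) ^ (2 * k ^ 2) +
    n ^ 2 * ((1 / 2) ^ (k ^ 2) * qq n k ^ (k - 1))) := by
  have h := pr_exists_le (n := n) (box n ×ˢ (Finset.Ioo (0 : ℤ) k).powerset)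
    (fun i P => (∀ j < k, Vd n k k (xj i.1 j)) ∧
    ∃ y : ℕ → ℤ × ℤ, (∀ j < k, Vd n k k (y j) ∧ xj i.1 j ≠ y j ∧
      Sh k (px n P) (ep k i.1 i.2) (xj i.1 j) (y j)) ∧ ¬ nr (8 * k) i.1 (y 0)) 
    (k * n ^ 2 * (8 * k + 1) ^ 2 * (1 / 2) ^ (2 * k ^ 2) +
    k ^ 2 * n ^ 2 * (4 * k + 1) ^ 2 * (1 / 2) ^ (2 * k ^ 2) +
    n ^ 2 * ((1 / 2) ^ (k ^ 2) * qq n k ^ (k - 1))) (by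
      have hq : 0 ≤ qq n k := by unfold qq; positivity
      rintro ⟨x, A⟩ -
      simp only
      by_cases hx : ∀ j < k, Vd n k k (xj x j)
      swap
      · rw [pr_zero (by tauto)]; positivity
      refine le_trans (pr_mono ?_) ((pr_or _ _).trans (add_le_add ((pr_or _ _).trans
        (add_le_add (EA2 hk (ep k x A) x hx) (EA3 hk (ep k x A) x hx))) (main_pr hk (ep k x A) hx)))
      rintro P ⟨-, y, hy, h8⟩
      by_cases h2 : ∃ j < k, nr (4 * k) (xj x j) (y j)
      · exact Or.inl (Or.inl ⟨y, hy, h8, h2⟩)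
      push Not at h2
      by_cases h3 : ∃ i < k, ∃ j < k, y i - xj x i ≠ y j - xj x j ∧
        nr (2 * k) (y i - xj x i) (y j - xj x j)
      · exact Or.inl (Or.inr ⟨y, fun j hj => ⟨(hy j hj).1, (hy j hj).2.2⟩, h2, h3⟩)
      push Not at h3
      refine Or.inr ⟨y, ?_, fun j hj => (hy j hj).2.2⟩
      intro j hj
      refine ⟨(hy j hj).1, ?_, ?_⟩
      · have := h2 j hj
        unfold nr xj at *
        simp only at *
        omega
      · intro i hi
        have h4 := h3 i (by omega) j hj
        by_cases he : y i - xj x i = y j - xj x j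
        · left
          unfold xj at he
          rw [Prod.ext_iff] at he ⊢
          simp only [Prod.fst_sub, Prod.snd_sub] at *
          omega
        · right
          have h4 := h4 he
          unfold nr xj at *
          simp only [Prod.fst_sub, Prod.snd_sub] at *
          omega)
  rw [Finset.card_product, card_box, Finset.card_powerset, Int.card_Ioo,
    show ((k : ℤ) - 0 - 1).toNat = k - 1 by omega] at h
  push_cast at h
  refine le_trans (pr_mono ?_) ((pr_or _ _).trans (add_le_add (EA1 hk) h))
  rintro P ⟨x, A, hA, hx, y, hy⟩
  have h0 := hy 0 (by omega)
  have hx0 := hx 0 (by omega)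
  rw [xj_zero] at h0 hx0
  by_cases h8 : nr (8 * k) x (y 0)
  · exact Or.inl ⟨x, A, hA, hx0, y 0, h0.1, h0.2.1, h8, h0.2.2⟩
  · refine Or.inr ⟨(x, A), ?_, hx, y, hy, h8⟩
    rw [Finset.mem_product, mem_box]
    unfold Vd at hx0
    simp only
    exact ⟨by omega, hA⟩

/-- Corner event. -/
def FF (n k ρ : ℕ) (p : ℤ × ℤ → Bool) : Prop :=
  ∃ x ∈ box ρ, Vd n k k x ∧ ∃ y, Vd n k k y ∧ x ≠ y ∧ Sh k p (fun c => decide (c = x)) x y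

lemma FF_pr {n k ρ : ℕ} (hk : 1 ≤ k) :
    pr n (fun P => FF n k ρ (px n P)) ≤ ρ ^ 2 * n ^ 2 * (1 / 2) ^ (k ^ 2) := by
  have h := pr_exists_le (n := n) (box ρ ×ˢ box n)
    (fun i P => (Vd n k k i.1 ∧ Vd n k k i.2 ∧ i.1 ≠ i.2) ∧
      Sh k (px n P) (fun c => decide (c = i.1)) i.1 i.2) ((1 / 2) ^ (k ^ 2)) (fun i _ => by
      by_cases h : Vd n k k i.1 ∧ Vd n k k i.2 ∧ i.1 ≠ i.2
      · refine le_trans (pr_mono ?_) (sh_pr1 hk (fun c => decide (c = i.1)) h.1 h.2.1 h.2.2)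
        rintro P hP; exact hP.2
      · rw [pr_zero (by tauto)]; positivity)
  rw [Finset.card_product, card_box, card_box] at h
  push_cast at h
  refine le_trans (pr_mono ?_) h
  rintro P ⟨x, hx, hv, y, hy, hne, hs⟩
  refine ⟨(x, y), ?_, ⟨hv, hy, hne⟩, hs⟩
  rw [Finset.mem_product]
  refine ⟨hx, ?_⟩
  rw [mem_box]
  unfold Vd at hy
  simp only
  omega

end RP

namespace RP

/-- An isolated cluster of errors. -/
structure Cl (n k D : ℕ) (p' p : ℤ × ℤ → Bool) (E : Set (ℤ × ℤ)) : Prop where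
  wr : WR n k p' p
  ne : E.Nonempty
  sub : ∀ c ∈ E, c ∈ box n
  err : ∀ c ∈ E, p' c ≠ p c
  iso : ∀ c ∈ E, ∀ c' ∈ box n, nr (k - 1) c c' → p' c' ≠ p c' → c' ∈ E
  diam : ∀ c ∈ E, ∀ c' ∈ E, nr D c c'

lemma Cl.finite {n k D : ℕ} {p' p : ℤ × ℤ → Bool} {E : Set (ℤ × ℤ)} (h : Cl n k D p' p E) :
    E.Finite := (box n).finite_toSet.subset (fun c hc => h.sub c hc)

lemma xor_of {a b e : Bool} (h : e = true ↔ a ≠ b) : a = xor b e := by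
  revert h; cases a <;> cases b <;> cases e <;> simp

lemma ext_a1 {n k D : ℕ} {p' p : ℤ × ℤ → Bool} {E : Set (ℤ × ℤ)} (h : Cl n k D p' p E)
    (hc : ∀ c ∈ E, (k : ℤ) - 1 ≤ c.1 ∧ c.1 ≤ n - k ∧ (k : ℤ) - 1 ≤ c.2) : EE n k p := by
  classical
  obtain ⟨v, hv, hmin⟩ := Set.exists_min_image E (fun c => c.2 * (n : ℤ) + c.1) h.finite h.ne
  have hvb := mem_box.1 (h.sub v hv)
  have hlow : ∀ c ∈ E, v.2 ≤ c.2 ∧ (c.2 = v.2 → v.1 ≤ c.1) := by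
    intro c hcE
    have h1 := hmin c hcE
    have hcb := mem_box.1 (h.sub c hcE)
    have h2 : v.2 ≤ c.2 := by
      by_contra hlt
      have : c.2 + 1 ≤ v.2 := by omega
      nlinarith
    refine ⟨h2, fun h3 => ?_⟩
    rw [h3] at h1
    omega
  have hvc := hc v hv
  obtain ⟨x, hx⟩ : ∃ x : ℤ × ℤ, x = (v.1 - (k - 1), v.2 - (k - 1)) := ⟨_, rfl⟩
  have hx1 : x.1 = v.1 - (k - 1) := by rw [hx]
  have hx2 : x.2 = v.2 - (k - 1) := by rw [hx]
  have hV : ∀ j < k, Vd n k k (xj x j) := by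
    intro j hj
    unfold Vd xj
    simp only
    omega
  refine ⟨x, (Finset.Ioo (0 : ℤ) k).filter (fun a => (v.1 + a, v.2) ∈ E), by simp, hV, ?_⟩
  have hch : ∀ j : ℕ, ∃ y, j < k → Vd n k k y ∧ Eqr k k p' p (xj x j) y := by
    intro j
    by_cases hj : j < k
    · obtain ⟨y, hy⟩ := h.wr _ (hV j hj)
      exact ⟨y, fun _ => hy⟩
    · exact ⟨0, fun h => absurd h hj⟩
  choose y hy using hch
  refine ⟨y, fun j hj => ⟨(hy j hj).1, ?_, ?_⟩⟩
  · intro heq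
    have := Eqr_at (hy j hj).2 (c := v) (by rw [mem_rc]; unfold xj; simp only; omega)
    rw [← heq, sub_self, add_zero] at this
    exact h.err v hv this
  · intro c hcr
    have hcb := rc_box (hV j hj) hcr
    have h1 := Eqr_at (hy j hj).2 hcr
    rw [← h1]
    apply xor_of
    rw [mem_rc] at hcr
    unfold xj at hcr
    simp only at hcr
    have hE : p' c ≠ p c ↔ c ∈ E := by
      constructor
      · intro h2
        exact h.iso v hv c hcb (by unfold nr; omega) h2
      · exact h.err c
    rw [hE]
    unfold ep
    rw [decide_eq_true_iff, Finset.mem_filter, Finset.mem_Ioo,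
      show x.1 + (k - 1) = v.1 by omega, show x.2 + (k - 1) = v.2 by omega]
    constructor
    · rintro ⟨h2, h3 | h3⟩
      · have : c = v := Prod.ext h3 h2
        rwa [this]
      · have : c = (v.1 + (c.1 - v.1), v.2) := by ext <;> simp [h2]
        rw [this]; exact h3.2
    · intro h2
      obtain ⟨h3, h4⟩ := hlow c h2
      have h5 : c.2 = v.2 := by omega
      have h6 := h4 h5
      refine ⟨h5, ?_⟩
      by_cases h7 : c.1 = v.1
      · exact Or.inl h7
      · right
        refine ⟨by omega, ?_⟩
        have : c = (v.1 + (c.1 - v.1), v.2) := by ext <;> simp [h5]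
        rw [← this]; exact h2

lemma ext_c1 {n k D ρ : ℕ} (hk : 1 ≤ k) {p' p : ℤ × ℤ → Bool} {E : Set (ℤ × ℤ)} (h : Cl n k D p' p E)
    (hc : ∀ c ∈ E, (c.1 ≤ n - k ∧ c.1 < ρ) ∧ c.2 ≤ n - k ∧ c.2 < ρ) : FF n k ρ p := by
  obtain ⟨v, hv, hmax⟩ := Set.exists_max_image E (fun c => c.1 * (n : ℤ) + c.2) h.finite h.ne
  have hvb := mem_box.1 (h.sub v hv)
  have hvc := hc v hv
  have hV : Vd n k k v := by unfold Vd; omega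
  obtain ⟨y, hy, hxy⟩ := h.wr v hV
  refine ⟨v, by rw [mem_box]; omega, hV, y, hy, ?_, ?_⟩
  · intro heq
    have := Eqr_at hxy (c := v) (by rw [mem_rc]; omega)
    rw [← heq, sub_self, add_zero] at this
    exact h.err v hv this
  · intro c hcr
    have hcb := rc_box hV hcr
    rw [← Eqr_at hxy hcr]
    apply xor_of
    rw [mem_rc] at hcr
    rw [decide_eq_true_iff]
    constructor
    · rintro rfl; exact h.err _ hv
    · intro h2
      have hE := h.iso v hv c hcb (by unfold nr; omega) h2
      have h3 := hmax c hE
      have h4 : c.1 = v.1 := by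
        by_contra hne
        have : v.1 + 1 ≤ c.1 := by omega
        nlinarith
      rw [h4] at h3
      exact Prod.ext h4 (by omega)

/-- Horizontal flip. -/
def fl1 (n : ℤ) (c : ℤ × ℤ) : ℤ × ℤ := (n - 1 - c.1, c.2)
/-- Vertical flip. -/
def fl2 (n : ℤ) (c : ℤ × ℤ) : ℤ × ℤ := (c.1, n - 1 - c.2)
/-- Transposition. -/
def tr (c : ℤ × ℤ) : ℤ × ℤ := (c.2, c.1)

lemma fl1_fl1 (n : ℤ) (c) : fl1 n (fl1 n c) = c := by unfold fl1; ext <;> simp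
lemma fl2_fl2 (n : ℤ) (c) : fl2 n (fl2 n c) = c := by unfold fl2; ext <;> simp
lemma tr_tr (c) : tr (tr c) = c := rfl

lemma Cl_map {n k D : ℕ} {p' p : ℤ × ℤ → Bool} {E : Set (ℤ × ℤ)} (h : Cl n k D p' p E)
    (f : ℤ × ℤ → ℤ × ℤ) (hf : ∀ c, f (f c) = c) (hb : ∀ c, f c ∈ box n ↔ c ∈ box n)
    (hn : ∀ r a b, nr r (f a) (f b) ↔ nr r a b) (hw : WR n k (p' ∘ f) (p ∘ f)) :
    Cl n k D (p' ∘ f) (p ∘ f) (f ⁻¹' E) where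
  wr := hw
  ne := by
    obtain ⟨c, hc⟩ := h.ne
    exact ⟨f c, by rw [Set.mem_preimage, hf]; exact hc⟩
  sub := fun c hc => (hb c).1 (h.sub _ hc)
  err := fun c hc => h.err _ hc
  iso := fun c hc c' hc' hnr he => h.iso _ hc _ ((hb c').2 hc') ((hn _ _ _).2 hnr) he
  diam := fun c hc c' hc' => (hn _ _ _).1 (h.diam _ hc _ hc')

lemma Cl_fl1 {n k D : ℕ} {p' p : ℤ × ℤ → Bool} {E : Set (ℤ × ℤ)} (h : Cl n k D p' p E) :
    Cl n k D (p' ∘ fl1 n) (p ∘ fl1 n) (fl1 n ⁻¹' E) := by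
  refine Cl_map h _ (fl1_fl1 n) ?_ ?_ ?_
  · intro c; rw [mem_box, mem_box]; unfold fl1; simp only; omega
  · intro r a b; unfold nr fl1; simp only; omega
  · intro x hx
    obtain ⟨y, hy, hxy⟩ := h.wr (n - k - x.1, x.2) (by unfold Vd at *; simp only; omega)
    refine ⟨(n - k - y.1, y.2), by unfold Vd at *; simp only; omega, ?_⟩
    intro a b ha ha' hb hb'
    have := hxy (k - 1 - a) b (by omega) (by omega) hb hb'
    unfold fl1
    simp only [Function.comp] at this ⊢
    convert this using 3 <;> ring

lemma Cl_fl2 {n k D : ℕ} {p' p : ℤ × ℤ → Bool} {E : Set (ℤ × ℤ)} (h : Cl n k D p' p E) :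
    Cl n k D (p' ∘ fl2 n) (p ∘ fl2 n) (fl2 n ⁻¹' E) := by
  refine Cl_map h _ (fl2_fl2 n) ?_ ?_ ?_
  · intro c; rw [mem_box, mem_box]; unfold fl2; simp only; omega
  · intro r a b; unfold nr fl2; simp only; omega
  · intro x hx
    obtain ⟨y, hy, hxy⟩ := h.wr (x.1, n - k - x.2) (by unfold Vd at *; simp only; omega)
    refine ⟨(y.1, n - k - y.2), by unfold Vd at *; simp only; omega, ?_⟩
    intro a b ha ha' hb hb'
    have := hxy a (k - 1 - b) ha ha' (by omega) (by omega)
    unfold fl2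
    simp only [Function.comp] at this ⊢
    convert this using 3 <;> ring

lemma Cl_tr {n k D : ℕ} {p' p : ℤ × ℤ → Bool} {E : Set (ℤ × ℤ)} (h : Cl n k D p' p E) :
    Cl n k D (p' ∘ tr) (p ∘ tr) (tr ⁻¹' E) := by
  refine Cl_map h _ tr_tr ?_ ?_ ?_
  · intro c; rw [mem_box, mem_box]; unfold tr; simp only; omega
  · intro r a b; unfold nr tr; simp only; omega
  · intro x hx
    obtain ⟨y, hy, hxy⟩ := h.wr (x.2, x.1) (by unfold Vd at *; simp only; omega)
    refine ⟨(y.2, y.1), by unfold Vd at *; simp only; omega, ?_⟩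
    intro a b ha ha' hb hb'
    exact hxy b a hb hb' ha ha'

lemma ext_a2 {n k D : ℕ} {p' p : ℤ × ℤ → Bool} {E : Set (ℤ × ℤ)} (hD : k + D + k ≤ n)
    (h : Cl n k D p' p E) (hc : ∀ c ∈ E, (k : ℤ) - 1 ≤ c.1 ∧ c.1 ≤ n - k) :
    EE n k p ∨ EE n k (p ∘ fl2 n) := by
  by_cases h1 : ∀ c ∈ E, (k : ℤ) - 1 ≤ c.2
  · exact Or.inl (ext_a1 h fun c hcE => ⟨(hc c hcE).1, (hc c hcE).2, h1 c hcE⟩)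
  · push Not at h1
    obtain ⟨c0, hc0, hlt⟩ := h1
    refine Or.inr (ext_a1 (Cl_fl2 h) fun c hcE => ?_)
    have h2 := hc _ hcE
    have h3 := h.diam _ hc0 _ hcE
    unfold nr at h3
    unfold fl2 at h2 h3
    simp only at h2 h3
    omega

/-- All the bad events. -/
def Bd (n k ρ : ℕ) (p : ℤ × ℤ → Bool) : Prop :=
  ((EE n k p ∨ EE n k (p ∘ fl2 n)) ∨ (EE n k (p ∘ tr) ∨ EE n k ((p ∘ tr) ∘ fl2 n))) ∨
  ((FF n k ρ p ∨ FF n k ρ (p ∘ fl2 n)) ∨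
    (FF n k ρ (p ∘ fl1 n) ∨ FF n k ρ ((p ∘ fl1 n) ∘ fl2 n)))

lemma ext_bd {n k D : ℕ} (hk : 1 ≤ k) {p' p : ℤ × ℤ → Bool} {E : Set (ℤ × ℤ)} (hD : k + D + k ≤ n)
    (h : Cl n k D p' p E) : Bd n k (k + D) p := by
  by_cases ha : ∀ c ∈ E, (k : ℤ) - 1 ≤ c.1 ∧ c.1 ≤ n - k
  · exact Or.inl (Or.inl (ext_a2 hD h ha))
  by_cases hb : ∀ c ∈ E, (k : ℤ) - 1 ≤ c.2 ∧ c.2 ≤ n - k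
  · exact Or.inl (Or.inr (ext_a2 hD (Cl_tr h) fun c hc => hb _ hc))
  right
  push Not at ha hb
  obtain ⟨a, haE, ha⟩ := ha
  obtain ⟨b, hbE, hb⟩ := hb
  have key : ∀ c ∈ E, nr D a c ∧ nr D b c ∧ c ∈ box n := fun c hc =>
    ⟨h.diam _ haE _ hc, h.diam _ hbE _ hc, h.sub c hc⟩
  simp only [mem_box] at key
  unfold nr at key
  by_cases ha1 : (k : ℤ) - 1 ≤ a.1
  · have ha2 := ha ha1
    by_cases hb1 : (k : ℤ) - 1 ≤ b.2
    · have hb2 := hb hb1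
      refine Or.inr (Or.inr (ext_c1 hk (Cl_fl2 (Cl_fl1 h)) fun c hc => ?_))
      have := key _ hc
      unfold fl1 fl2 at this
      simp only at this
      push_cast
      omega
    · refine Or.inr (Or.inl (ext_c1 hk (Cl_fl1 h) fun c hc => ?_))
      have := key _ hc
      unfold fl1 at this
      simp only at this
      push_cast
      omega
  · by_cases hb1 : (k : ℤ) - 1 ≤ b.2
    · have hb2 := hb hb1
      refine Or.inl (Or.inr (ext_c1 hk (Cl_fl2 h) fun c hc => ?_))
      have := key _ hc
      unfold fl2 at this
      simp only at this
      push_cast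
      omega
    · refine Or.inl (Or.inl (ext_c1 hk h fun c hc => ?_))
      have := key _ hc
      push_cast
      omega

lemma pr_flip {n : ℕ} (E : (ℤ × ℤ → Bool) → Prop) (f : ℤ × ℤ → ℤ × ℤ)
    (σ : Equiv.Perm (Fin n × Fin n)) (hσ : ∀ v, f (em n v) = em n (σ v))
    (hb : ∀ c, f c ∈ box n ↔ c ∈ box n) :
    pr n (fun P => E (px n P ∘ f)) = pr n (fun P => E (px n P)) := by
  rw [← pr_comp (fun P => E (px n P)) σ]
  congr 1
  funext P
  congr 1
  funext c
  by_cases hc : c ∈ box n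
  · obtain ⟨v, rfl⟩ := exists_em hc
    rw [Function.comp, hσ, px_em, px_em]
  · have hc' := (hb c).not.2 hc
    rw [mem_box] at hc hc'
    unfold px
    simp only [Function.comp]
    rw [dif_neg hc, dif_neg hc']

lemma pr_fl1 {n : ℕ} (E : (ℤ × ℤ → Bool) → Prop) :
    pr n (fun P => E (px n P ∘ fl1 n)) = pr n (fun P => E (px n P)) := by
  refine pr_flip E _ (Fin.revPerm.prodCongr (Equiv.refl _)) ?_ ?_
  · intro v
    have := v.1.2
    unfold fl1 em
    ext
    · simp [Fin.val_rev]; omega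
    · simp
  · intro c; rw [mem_box, mem_box]; unfold fl1; simp only; omega

lemma pr_fl2 {n : ℕ} (E : (ℤ × ℤ → Bool) → Prop) :
    pr n (fun P => E (px n P ∘ fl2 n)) = pr n (fun P => E (px n P)) := by
  refine pr_flip E _ ((Equiv.refl _).prodCongr Fin.revPerm) ?_ ?_
  · intro v
    have := v.2.2
    unfold fl2 em
    ext
    · simp
    · simp [Fin.val_rev]; omega
  · intro c; rw [mem_box, mem_box]; unfold fl2; simp only; omega

lemma pr_tr {n : ℕ} (E : (ℤ × ℤ → Bool) → Prop) :
    pr n (fun P => E (px n P ∘ tr)) = pr n (fun P => E (px n P)) := by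
  refine pr_flip E _ (Equiv.prodComm _ _) ?_ ?_
  · intro v
    unfold tr em
    ext <;> simp
  · intro c; rw [mem_box, mem_box]; unfold tr; simp only; omega

lemma Bd_pr {n k ρ : ℕ} : pr n (fun P => Bd n k ρ (px n P)) ≤
    4 * pr n (fun P => EE n k (px n P)) + 4 * pr n (fun P => FF n k ρ (px n P)) := by
  have e2 := pr_fl2 (n := n) (EE n k)
  have e3 := pr_tr (n := n) (EE n k)
  have e4 := pr_tr (n := n) (fun p => EE n k (p ∘ fl2 n))
  have f2 := pr_fl2 (n := n) (FF n k ρ)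
  have f3 := pr_fl1 (n := n) (FF n k ρ)
  have f4 := pr_fl1 (n := n) (fun p => FF n k ρ (p ∘ fl2 n))
  unfold Bd
  refine (pr_or _ _).trans ?_
  have a1 := (pr_or (n := n) (fun P => EE n k (px n P) ∨ EE n k (px n P ∘ fl2 n))
    (fun P => EE n k (px n P ∘ tr) ∨ EE n k ((px n P ∘ tr) ∘ fl2 n))).trans
    (add_le_add (pr_or _ _) (pr_or _ _))
  have a2 := (pr_or (n := n) (fun P => FF n k ρ (px n P) ∨ FF n k ρ (px n P ∘ fl2 n))
    (fun P => FF n k ρ (px n P ∘ fl1 n) ∨ FF n k ρ ((px n P ∘ fl1 n) ∘ fl2 n))).trans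
    (add_le_add (pr_or _ _) (pr_or _ _))
  linarith

end RP

namespace RP

lemma tile_close {k c c' : ℤ} (hk : 1 ≤ k) (h : c - c' ≤ k - 1) : c / k ≤ c' / k + 1 := by
  have h1 : c / k ≤ (c' + 1 * k) / k := Int.ediv_le_ediv (by omega) (by omega)
  rwa [Int.add_mul_ediv_right _ _ (by omega)] at h1

lemma tile_far {k c c' m : ℤ} (hk : 1 ≤ k) (h : c / k - c' / k ≤ m) : c - c' ≤ (m + 1) * k := by
  have h1 := Int.emod_add_mul_ediv c k
  have h2 := Int.emod_lt_of_pos c (show 0 < k by omega)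
  have h3 := Int.emod_add_mul_ediv c' k
  have h4 := Int.emod_nonneg c' (show k ≠ 0 by omega)
  nlinarith

/-- Diameter bound. -/
def DD (I k : ℕ) : ℕ := (120 * 32 ^ I + 1) * k

lemma DD_cast (I k : ℕ) : ((DD I k : ℕ) : ℤ) = (6 * rr I + 1) * k := by
  unfold DD rr; push_cast; ring

lemma det {n k I : ℕ} (hk : 2 ≤ k) (hkn : k ≤ n) {p p' : ℤ × ℤ → Bool} (H : WR n k p' p) (H2 : WR n k p p')
    (hI : Bad (XX n k p) I = ∅) {h : ℤ}
    (hh : 4 * rr I + 4 ≤ h) (hA : 4 * rr I + 4 ≤ cA n k - h)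
    (c0 : Core (XX n k p) I (h, h)) (c1 : Core (XX n k p) I (cA n k, h))
    (c2 : Core (XX n k p) I (0, h)) (c3 : Core (XX n k p) I (h, cA n k))
    (c4 : Core (XX n k p) I (h, 0)) (hD : k + DD I k + k ≤ n) (hB : ¬ Bd n k (k + DD I k) p) :
    ∀ c ∈ box n, p' c = p c := by
  have hE : {a : ℤ × ℤ | ∃ c ∈ box n, (c.1 / k, c.2 / k) = a ∧ p' c ≠ p c} = ∅ := by
    refine clean_all (X := XX n k p) (I := I) ?_ ?_
    · rintro a hac ⟨c, hc, rfl, hne⟩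
      apply hne
      rw [mem_box] at hc
      have hin : InW (0, 0) (cA n k, cA n k) (c.1 / k, c.2 / k) := by
        unfold InW cA
        simp only
        exact ⟨⟨Int.ediv_nonneg (by omega) (by omega), Int.ediv_le_ediv (by omega) (by omega)⟩,
          ⟨Int.ediv_nonneg (by omega) (by omega), Int.ediv_le_ediv (by omega) (by omega)⟩⟩
      have he := stage1b (n := n) (k := k) (by omega) (by omega) H H2 hI hh hA c0 c1 c2 c3 c4 _ hin hac
      have := Eqr_at he (c := c) (by
        have h1 := Int.emod_add_mul_ediv c.1 k
        have h2 := Int.emod_lt_of_pos c.1 (show (0 : ℤ) < k by omega)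
        have h3 := Int.emod_nonneg c.1 (show (k : ℤ) ≠ 0 by omega)
        have h1' := Int.emod_add_mul_ediv c.2 k
        have h2' := Int.emod_lt_of_pos c.2 (show (0 : ℤ) < k by omega)
        have h3' := Int.emod_nonneg c.2 (show (k : ℤ) ≠ 0 by omega)
        rw [mem_rc]
        unfold Ph ph
        simp only
        omega)
      simpa using this
    · rintro i hi q a ⟨c, hc, hca, hne⟩ hnr
      by_contra hno
      push Not at hno
      apply hB
      have hri : rr i ≤ rr I := rr_mono (by omega)
      refine ext_bd (p' := p') (by omega) hD
        (E := {c | c ∈ box n ∧ p' c ≠ p c ∧ nr (3 * rr i) (c.1 / k, c.2 / k) q}) ?_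
      refine ⟨H, ⟨c, hc, hne, by rw [hca]; exact hnr⟩, fun c hc => hc.1, fun c hc => hc.2.1, ?_, ?_⟩
      · rintro c hc c' hc' hnr' hne'
        refine ⟨hc', hne', ?_⟩
        apply hno _ ⟨c', hc', rfl, hne'⟩
        have h1 := hc.2.2
        unfold nr at hnr' h1 ⊢
        simp only at h1 ⊢
        have t1 := tile_close (k := k) (c := c.1) (c' := c'.1) (by omega) (by omega)
        have t2 := tile_close (k := k) (c := c'.1) (c' := c.1) (by omega) (by omega)
        have t3 := tile_close (k := k) (c := c.2) (c' := c'.2) (by omega) (by omega)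
        have t4 := tile_close (k := k) (c := c'.2) (c' := c.2) (by omega) (by omega)
        omega
      · rintro c hc c' hc'
        have h1 := hc.2.2
        have h2 := hc'.2.2
        rw [DD_cast]
        unfold nr at h1 h2 ⊢
        simp only at h1 h2
        exact ⟨⟨tile_far (by omega) (by omega), tile_far (by omega) (by omega)⟩,
          ⟨tile_far (by omega) (by omega), tile_far (by omega) (by omega)⟩⟩
  intro c hc
  by_contra hne
  have : ((c.1 / k, c.2 / k) : ℤ × ℤ) ∈ {a : ℤ × ℤ | ∃ c ∈ box n, (c.1 / k, c.2 / k) = a ∧ p' c ≠ p c} :=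
    ⟨c, hc, rfl, hne⟩
  rw [hE] at this
  exact this

/-- The main probability bound. -/
lemma case2 {n k I : ℕ} (hk : 2 ≤ k) (hkn : k ≤ n) (θ : ℝ)
    (hθ : θ = 2 * ((2 * k + 1) * n ^ 2) * (1 / 2) ^ (k ^ 2 - k)) (hθ1 : θ ≤ 1)
    (hη : 2 ^ 28 * (4 * √θ) ≤ 1 / 4) (hsize : k * (8 * (20 * 32 ^ I) + 12) + k + DD I k + k ≤ n) :
    pr n (fun P => ¬ Reconstructible n k P) ≤ n ^ 2 * (1 / 4) ^ (2 ^ I) + 5 * (2 ^ 28 * (4 * √θ)) +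
      (4 * pr n (fun P => EE n k (px n P)) + 4 * pr n (fun P => FF n k (k + DD I k) (px n P))) := by
  have hη0 : 0 ≤ 4 * √θ := by positivity
  have hbad := pr_badI (n := n) (fun P => XX n k (px n P)) (4 * √θ) hη0
    (fun S h1 h2 => pr_XX hk θ hθ hθ1 S h1 h2) (box n)
    (fun P a ha => XX_box (by omega) _ a ha) I hη
  have hcore := pr_core (n := n) (fun P => XX n k (px n P)) (4 * √θ) hη0
    (fun S h1 h2 => pr_XX hk θ hθ hθ1 S h1 h2) I hη
  rw [card_box] at hbad
  push_cast at hbad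
  have hrI : rr I = 20 * 32 ^ I := rfl
  obtain ⟨h, hh⟩ : ∃ h : ℤ, h = 4 * rr I + 4 := ⟨_, rfl⟩
  have hA : 4 * rr I + 4 ≤ cA n k - h := by
    have : (8 * rr I + 12 : ℤ) ≤ cA n k := by
      unfold cA
      rw [Int.le_ediv_iff_mul_le (by omega), hrI]
      have : ((k * (8 * (20 * 32 ^ I) + 12) + k : ℕ) : ℤ) ≤ n := by exact_mod_cast (by omega)
      push_cast at this
      linarith
    omega
  have hbd := Bd_pr (n := n) (k := k) (ρ := k + DD I k)
  have s1 := (pr_or (n := n) (fun P => ¬ Core (XX n k (px n P)) I (h, h))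
    (fun P => ¬ Core (XX n k (px n P)) I (cA n k, h))).trans (add_le_add (hcore _) (hcore _))
  have s2 := (pr_or (n := n) _ (fun P => ¬ Core (XX n k (px n P)) I (0, h))).trans
    (add_le_add s1 (hcore _))
  have s3 := (pr_or (n := n) _ (fun P => ¬ Core (XX n k (px n P)) I (h, cA n k))).trans
    (add_le_add s2 (hcore _))
  have s4 := (pr_or (n := n) _ (fun P => ¬ Core (XX n k (px n P)) I (h, 0))).trans
    (add_le_add s3 (hcore _))
  have s5 := (pr_or (n := n) (fun P => Bad (XX n k (px n P)) I ≠ ∅) _).trans (add_le_add hbad s4)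
  have s6 := (pr_or (n := n) _ (fun P => Bd n k (k + DD I k) (px n P))).trans (add_le_add s5 hbd)
  refine le_trans (pr_mono ?_) (s6.trans (le_of_eq (by ring)))
  intro P hP
  by_contra hno
  apply hP
  intro P' hdeck
  push Not at hno
  obtain ⟨⟨hb, ⟨⟨⟨c0, c1⟩, c2⟩, c3⟩, c4⟩, hB⟩ := hno
  apply px_ext
  exact det hk hkn (deck_WR hkn hdeck) (deck_WR hkn hdeck.symm) hb hh.ge hA c0 c1 c2 c3 c4
    (by omega) hB

end RP

namespace RP

lemma half_facts {k : ℕ} (hk : 2 ≤ k) :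
    ((1 : ℝ) / 2) ^ (k ^ 2) = (1 / 2) ^ (k ^ 2 - k) * (1 / 2) ^ k ∧
    ((1 : ℝ) / 2) ^ (2 * k ^ 2) = ((1 / 2) ^ (k ^ 2 - k) * (1 / 2) ^ k) ^ 2 ∧
    (((1 : ℝ) / 2) ^ k) ^ (k - 1) = (1 / 2) ^ (k ^ 2 - k) ∧
    (2 : ℝ) ^ (k - 1) * (1 / 2) ^ k = 1 / 2 := by
  have h1 : k ^ 2 - k + k = k ^ 2 := Nat.sub_add_cancel (by nlinarith)
  have h2 : ((1 : ℝ) / 2) ^ (k ^ 2) = (1 / 2) ^ (k ^ 2 - k) * (1 / 2) ^ k := by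
    rw [← pow_add, h1]
  refine ⟨h2, ?_, ?_, ?_⟩
  · rw [← h2, ← pow_mul, mul_comm]
  · rw [← pow_mul]; congr 1; rw [Nat.mul_sub, sq, mul_one]
  · obtain ⟨m, rfl⟩ : ∃ m, k = m + 1 := ⟨k - 1, by omega⟩
    rw [Nat.add_sub_cancel, pow_succ, ← mul_assoc, ← mul_pow]
    norm_num

lemma EE_bd {n k : ℕ} (hk : 2 ≤ k) {L h : ℝ} (hL : L = n ^ 2 * (1 / 2) ^ (k ^ 2 - k))
    (hh : h = (1 / 2) ^ k) : pr n (fun P => EE n k (px n P)) ≤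
    289 * k ^ 2 * L * h + L ^ 2 * h / 2 * (81 * k ^ 3 + 25 * k ^ 4) +
      L ^ 2 / 2 * (1 + k * h + L) ^ (k - 1) := by
  obtain ⟨f1, f2, f3, f4⟩ := half_facts hk
  have hq : qq n k = h * (1 + k * h + L) := by
    unfold qq
    rw [f1, hL, hh, mul_comm 2 k, pow_mul]
    ring
  refine (EE_pr hk).trans ?_
  rw [hq, mul_pow, f1, f2, ← hh] 
  rw [← hh] at f3 f4
  rw [f3]
  set M : ℝ := (1 / 2) ^ (k ^ 2 - k) with hM
  have hh0 : 0 ≤ h := by rw [hh]; positivity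
  have hM0 : 0 ≤ M := by rw [hM]; positivity
  have hk1 : (1 : ℝ) ≤ k := by exact_mod_cast (by omega : 1 ≤ k)
  have b1 : (16 * (k : ℝ) + 1) ^ 2 ≤ 289 * k ^ 2 := by nlinarith
  have b2 : (8 * (k : ℝ) + 1) ^ 2 ≤ 81 * k ^ 2 := by nlinarith
  have b3 : (4 * (k : ℝ) + 1) ^ 2 ≤ 25 * k ^ 2 := by nlinarith
  calc _ = (16 * (k : ℝ) + 1) ^ 2 * L * h + (2 ^ (k - 1) * h) * (L ^ 2 * h * (k * (8 * k + 1) ^ 2 +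
        k ^ 2 * (4 * k + 1) ^ 2)) + (2 ^ (k - 1) * h) * (L ^ 2 * (1 + k * h + L) ^ (k - 1)) := by
        rw [hL]; ring
    _ ≤ (289 * k ^ 2) * L * h + (2 ^ (k - 1) * h) * (L ^ 2 * h * (k * (81 * k ^ 2) +
        k ^ 2 * (25 * k ^ 2))) + (2 ^ (k - 1) * h) * (L ^ 2 * (1 + k * h + L) ^ (k - 1)) := by
        have hL0 : 0 ≤ L := by rw [hL]; positivity
        gcongr
    _ = _ := by rw [f4]; ring

lemma size_bd {n k I : ℕ} (hk : 60 ≤ k) (hI : 2 ^ I ≤ 2 * k ^ 2) (hn : 2 ^ (k ^ 2 - k) < n ^ 5) :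
    k * (8 * (20 * 32 ^ I) + 12) + k + DD I k + k ≤ 9000 * k ^ 11 ∧ 9000 * k ^ 11 ≤ n := by
  have h32 : 32 ^ I ≤ 32 * k ^ 10 := by
    calc 32 ^ I = (2 ^ I) ^ 5 := by rw [← pow_mul, mul_comm, pow_mul]; norm_num
      _ ≤ (2 * k ^ 2) ^ 5 := Nat.pow_le_pow_left hI 5
      _ = _ := by ring
  constructor
  · unfold DD
    have h2 : k ≤ k ^ 11 := Nat.le_self_pow (by norm_num) k
    have h3 : k * 32 ^ I ≤ 32 * k ^ 11 := by
      calc _ ≤ k * (32 * k ^ 10) := Nat.mul_le_mul_left _ h32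
        _ = _ := by ring
    nlinarith
  · by_contra hlt
    push Not at hlt
    have h1 : 9000 * k ^ 11 ≤ 2 ^ (14 + 11 * k) := by
      rw [pow_add, mul_comm 11 k, pow_mul]
      exact Nat.mul_le_mul (by norm_num) (Nat.pow_le_pow_left Nat.lt_two_pow_self.le _)
    have h2 : n ^ 5 ≤ 2 ^ ((14 + 11 * k) * 5) := by
      rw [pow_mul]
      exact Nat.pow_le_pow_left (by omega) 5
    have h3 : (14 + 11 * k) * 5 ≤ k ^ 2 - k := by
      have : k * 60 ≤ k ^ 2 := by rw [sq]; exact Nat.mul_le_mul_left _ hk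
      omega
    have h4 : 2 ^ ((14 + 11 * k) * 5) ≤ 2 ^ (k ^ 2 - k) := Nat.pow_le_pow_right (by norm_num) h3
    omega

set_option maxHeartbeats 1600000 in
lemma fin_bd {n k : ℕ} (hk : 60 ≤ k) (hkn : k ≤ n) {ε δ : ℝ}
    (hε : ε = k * n ^ 2 / 2 ^ (k ^ 2 - k)) (hδ : δ = k ^ 22 * (1 / 2) ^ k)
    (hη : 2 ^ 28 * (4 * √(6 * ε)) ≤ 1 / 4) (hδ1 : δ ≤ 1) :
    pr n (fun P => ¬ Reconstructible n k P) ≤ 2 / n + (ε + 5 * (2 ^ 28 * (4 * √(6 * ε))) +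
      (4 * (500 * δ + 4 * ε) + 4 * (9000 ^ 2 * δ))) := by
  have hk1 : (1 : ℝ) ≤ k := by exact_mod_cast (by omega : 1 ≤ k)
  have hε0 : 0 ≤ ε := by rw [hε]; positivity
  have hδ0 : 0 ≤ δ := by rw [hδ]; positivity
  by_cases hcase : n ^ 5 ≤ 2 ^ (k ^ 2 - k)
  · refine (case1 (by omega) hkn hcase).trans ?_
    have : 0 ≤ (ε + 5 * (2 ^ 28 * (4 * √(6 * ε))) + (4 * (500 * δ + 4 * ε) + 4 * (9000 ^ 2 * δ))) := by
      positivity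
    linarith
  push Not at hcase
  obtain ⟨L, hL⟩ : ∃ L : ℝ, L = n ^ 2 * (1 / 2) ^ (k ^ 2 - k) := ⟨_, rfl⟩
  obtain ⟨h, hh⟩ : ∃ h : ℝ, h = (1 / 2) ^ k := ⟨_, rfl⟩
  have hL0 : 0 ≤ L := by rw [hL]; positivity
  have hh0 : 0 ≤ h := by rw [hh]; positivity
  have hεL : ε = k * L := by rw [hε, hL, one_div, inv_pow]; ring
  have hLε : L ≤ ε := by rw [hεL]; nlinarith
  have hε1 : 6 * ε ≤ 1 := by
    by_contra hlt
    push Not at hlt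
    have : 1 ≤ √(6 * ε) := Real.one_le_sqrt.mpr hlt.le
    linarith
  obtain ⟨I, hI1, hI2⟩ : ∃ I : ℕ, k ^ 2 ≤ 2 ^ I ∧ 2 ^ I ≤ 2 * k ^ 2 := by
    refine ⟨Nat.clog 2 (k ^ 2), Nat.le_pow_clog (by norm_num) _, ?_⟩
    have h1 : 1 < k ^ 2 := by nlinarith
    have h2 := Nat.pow_pred_clog_lt_self (b := 2) (by norm_num) h1
    have h3 : 0 < Nat.clog 2 (k ^ 2) := Nat.clog_pos (by norm_num) h1
    obtain ⟨m, hm⟩ : ∃ m, Nat.clog 2 (k ^ 2) = m + 1 := ⟨Nat.clog 2 (k ^ 2) - 1, by omega⟩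
    rw [hm] at h2 ⊢
    simp only [Nat.pred_succ] at h2
    rw [pow_succ]
    omega
  obtain ⟨hs1, hs2⟩ := size_bd hk hI2 hcase
  obtain ⟨θ, hθ⟩ : ∃ θ : ℝ, θ = 2 * ((2 * k + 1) * n ^ 2) * (1 / 2) ^ (k ^ 2 - k) := ⟨_, rfl⟩
  have hθε : θ ≤ 6 * ε := by
    have : θ = 2 * (2 * k + 1) * L := by rw [hθ, hL]; ring
    rw [this, hεL]; nlinarith
  have hsq : √θ ≤ √(6 * ε) := Real.sqrt_le_sqrt hθε
  have hmain := case2 (I := I) (by omega) hkn θ hθ (by linarith) (by linarith) (hs1.trans hs2)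
  have hδh : δ = k ^ 22 * h := by rw [hδ, hh]
  have hpow : ∀ m ≤ 22, (k : ℝ) ^ m * h ≤ δ := by
    intro m hm
    rw [hδh]
    gcongr
  obtain ⟨f1, f2, f3, f4⟩ := half_facts (k := k) (by omega)
  have t1 : (n : ℝ) ^ 2 * (1 / 4) ^ (2 ^ I) ≤ ε := by
    refine le_trans ?_ hLε
    rw [hL]
    gcongr ?_ * ?_
    calc ((1 : ℝ) / 4) ^ (2 ^ I) ≤ (1 / 4) ^ (k ^ 2 - k) :=
          pow_le_pow_of_le_one (by norm_num) (by norm_num) (by omega)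
      _ ≤ _ := by gcongr; norm_num
  have t3 : pr n (fun P => FF n k (k + DD I k) (px n P)) ≤ 9000 ^ 2 * δ := by
    refine (FF_pr (by omega)).trans ?_
    have hρ : ((k + DD I k : ℕ) : ℝ) ≤ 9000 * k ^ 11 := by
      have : k + DD I k ≤ 9000 * k ^ 11 := by omega
      exact_mod_cast this
    calc _ = ((k + DD I k : ℕ) : ℝ) ^ 2 * (L * h) := by rw [f1, hL, hh]; ring
      _ ≤ (9000 * k ^ 11) ^ 2 * (1 * h) := by gcongr; linarith
      _ = _ := by rw [hδh]; ring
  have t4 : pr n (fun P => EE n k (px n P)) ≤ 500 * δ + 4 * ε := by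
    refine (EE_bd (by omega) hL hh).trans ?_
    have e1 : (1 + k * h + L) ^ (k - 1) ≤ 8 := by
      have g1 : (1 + k * h + L) ^ (k - 1) ≤ Real.exp (k * h + L) ^ (k - 1) := by
        have := Real.add_one_le_exp (k * h + L)
        gcongr
        linarith
      have g2 : Real.exp (k * h + L) ^ (k - 1) ≤ Real.exp (k * h + L) ^ k :=
        pow_le_pow_right₀ (Real.one_le_exp (by positivity)) (by omega)
      have g3 : Real.exp (k * h + L) ^ k ≤ Real.exp 1 ^ 2 := by
        rw [← Real.exp_nat_mul, ← Real.exp_nat_mul]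
        apply Real.exp_le_exp.mpr
        have := hpow 2 (by norm_num)
        push_cast
        calc (k : ℝ) * (k * h + L) = k ^ 2 * h + ε := by rw [hεL]; ring
          _ ≤ 2 * 1 := by linarith
      have g4 := Real.exp_one_lt_d9
      have g5 := Real.exp_pos 1
      have g6 : Real.exp 1 ^ 2 ≤ 2.8 ^ 2 := by
        gcongr
        linarith
      have g7 : (2.8 : ℝ) ^ 2 ≤ 8 := by norm_num
      linarith
    have p2 := hpow 2 (by norm_num)
    have p3 := hpow 3 (by norm_num)
    have p4 := hpow 4 (by norm_num)
    have hL1 : L ≤ 1 := by linarith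
    have hL2 : L ^ 2 ≤ 1 := by nlinarith
    have a1 : 289 * (k : ℝ) ^ 2 * L * h ≤ 289 * δ := by
      calc _ = 289 * ((k : ℝ) ^ 2 * h) * L := by ring
        _ ≤ 289 * δ * 1 := by gcongr
        _ = _ := by ring
    have a2 : L ^ 2 * h / 2 * (81 * k ^ 3 + 25 * k ^ 4) ≤ 53 * δ := by
      calc _ = L ^ 2 * ((81 / 2) * ((k : ℝ) ^ 3 * h) + (25 / 2) * ((k : ℝ) ^ 4 * h)) := by ring
        _ ≤ 1 * ((81 / 2) * δ + (25 / 2) * δ) := by gcongr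
        _ = _ := by ring
    have a3 : L ^ 2 / 2 * (1 + k * h + L) ^ (k - 1) ≤ 4 * ε := by
      calc _ ≤ L ^ 2 / 2 * 8 := by gcongr
        _ = 4 * (L * L) := by ring
        _ ≤ 4 * (1 * ε) := by gcongr
        _ = _ := by ring
    linarith
  have hn0 : (0 : ℝ) ≤ 2 / n := by positivity
  linarith

lemma final (k : ℕ → ℕ)
    (hk : ∀ᶠ n : ℕ in atTop, k n ≤ n)
    (hinf : Tendsto k atTop atTop)
    (hlim : Tendsto (fun n : ℕ => (k n : ℝ) * (n : ℝ) ^ 2 / 2 ^ (k n ^ 2 - k n))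
      atTop (nhds 0)) :
    Tendsto (fun n : ℕ => reconProb n (k n)) atTop (nhds 1) := by
  have hδ0 : Tendsto (fun m : ℕ => (m : ℝ) ^ 22 * (1 / 2) ^ m) atTop (nhds 0) :=
    tendsto_pow_const_mul_const_pow_of_abs_lt_one 22 (by rw [abs_of_pos] <;> norm_num)
  have hδ := hδ0.comp hinf
  have hsq : Tendsto (fun n : ℕ => √(6 * ((k n : ℝ) * (n : ℝ) ^ 2 / 2 ^ (k n ^ 2 - k n))))
      atTop (nhds 0) := by
    have := (Real.continuous_sqrt.tendsto (6 * 0)).comp (hlim.const_mul 6)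
    rw [mul_zero, Real.sqrt_zero] at this
    exact this
  have hη : Tendsto (fun n : ℕ => 2 ^ 28 * (4 * √(6 * ((k n : ℝ) * (n : ℝ) ^ 2 / 2 ^ (k n ^ 2 - k n)))))
      atTop (nhds 0) := by
    simpa using (hsq.const_mul 4).const_mul (2 ^ 28)
  have hb : Tendsto (fun n : ℕ => 2 / (n : ℝ) + ((k n : ℝ) * (n : ℝ) ^ 2 / 2 ^ (k n ^ 2 - k n) +
      5 * (2 ^ 28 * (4 * √(6 * ((k n : ℝ) * (n : ℝ) ^ 2 / 2 ^ (k n ^ 2 - k n))))) +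
      (4 * (500 * ((k n : ℝ) ^ 22 * (1 / 2) ^ (k n)) +
        4 * ((k n : ℝ) * (n : ℝ) ^ 2 / 2 ^ (k n ^ 2 - k n))) +
      4 * (9000 ^ 2 * ((k n : ℝ) ^ 22 * (1 / 2) ^ (k n)))))) atTop (nhds 0) := by
    have h2 : Tendsto (fun n : ℕ => 2 / (n : ℝ)) atTop (nhds 0) :=
      tendsto_const_div_atTop_nhds_zero_nat 2
    have := h2.add ((hlim.add (hη.const_mul 5)).add
      ((((hδ.const_mul 500).add (hlim.const_mul 4)).const_mul 4).add
        ((hδ.const_mul (9000 ^ 2)).const_mul 4)))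
    simpa using this
  have hz : Tendsto (fun n : ℕ => pr n (fun P => ¬ Reconstructible n (k n) P)) atTop (nhds 0) := by
    refine tendsto_of_tendsto_of_tendsto_of_le_of_le' tendsto_const_nhds hb
      (Eventually.of_forall fun n => pr_nonneg _ _) ?_
    have e1 := hη.eventually (Iic_mem_nhds (show (0 : ℝ) < 1 / 4 by norm_num))
    have e2 := hδ.eventually (Iic_mem_nhds (show (0 : ℝ) < 1 by norm_num))
    filter_upwards [hk, hinf.eventually_ge_atTop 60, e1, e2] with n h1 h2 h3 h4
    exact fin_bd h2 h1 rfl rfl h3 h4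
  have heq : ∀ n, reconProb n (k n) = 1 - pr n (fun P => ¬ Reconstructible n (k n) P) := by
    intro n
    rw [← pr_not n (fun P => Reconstructible n (k n) P)]
    rfl
  simp only [heq]
  simpa using hz.const_sub 1

end RP

/-- If `k : ℕ → ℕ` satisfies `k n ≤ n` for all sufficiently large
`n`, `k n → ∞`, and `k n · n² / 2 ^ (k n² − k n) → 0`, then the probability that
a uniformly random picture of size `n` is reconstructible from its `k n`-deck
tends to `1`. -/
theorem one_statement (k : ℕ → ℕ)
    (hk : ∀ᶠ n : ℕ in atTop, k n ≤ n)
    (hinf : Tendsto k atTop atTop)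
    (hlim : Tendsto (fun n : ℕ => (k n : ℝ) * (n : ℝ) ^ 2 / 2 ^ (k n ^ 2 - k n))
      atTop (nhds 0)) :
    Tendsto (fun n : ℕ => reconProb n (k n)) atTop (nhds 1) := by
  exact RP.final k hk hinf hlim
end

section
/- For all integers n and k with 1 ≤ k ≤ n, the number of pictures of size n that are reconstructible from their k-deck is at most the binomial coefficient C((n−k+1)² + 2^(k²) − 1, 2^(k²) − 1). -/
open Filter

open scoped Classical in
/-- For `1 ≤ k ≤ n`, the number of pictures of size `n` that are
reconstructible from their `k`-deck is at most
`C((n−k+1)² + 2^(k²) − 1, 2^(k²) − 1)`. -/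
theorem card_reconstructible_le (n k : ℕ) (hk1 : 1 ≤ k) (hkn : k ≤ n) :
    ((Finset.univ : Finset (Fin n × Fin n → Bool)).filter fun P =>
        Reconstructible n k P).card ≤
      Nat.choose ((n - k + 1) ^ 2 + 2 ^ (k ^ 2) - 1) (2 ^ (k ^ 2) - 1) := by
  have hcard : ∀ P, (deck n k P).card = (n - k + 1) ^ 2 := by
    intro P
    simp [deck, sq]
  let f : (Fin n × Fin n → Bool) → Sym (Fin k × Fin k → Bool) ((n - k + 1) ^ 2) :=
    fun P => ⟨deck n k P, hcard P⟩
  have h1 := Finset.card_le_card_of_injOn (t := Finset.univ)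
    (s := (Finset.univ : Finset (Fin n × Fin n → Bool)).filter fun P =>
        Reconstructible n k P) f (fun _ _ => Finset.mem_coe.2 (Finset.mem_univ _)) (by
      intro P _ Q hQ h
      have hQ' : Reconstructible n k Q := by simpa using hQ
      exact hQ' P (congrArg Subtype.val h))
  refine h1.trans (le_of_eq ?_)
  rw [Finset.card_univ, Sym.card_sym_eq_choose]
  have hc : Fintype.card (Fin k × Fin k → Bool) = 2 ^ (k ^ 2) := by
    simp [sq]
  rw [hc]
  have hp : 1 ≤ 2 ^ (k ^ 2) := Nat.one_le_two_pow
  rw [Nat.add_comm (2 ^ (k ^ 2))]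
  apply Nat.choose_symm_of_eq_add
  omega
end

section
/- For all integers n and k with 2 ≤ k ≤ n and 2^(k²) ≤ n², the binomial coefficient C((n−k+1)² + 2^(k²) − 1, 2^(k²) − 1) is at most (10 n² / 2^(k²))^(2^(k²)). -/
open Filter

/-- For `2 ≤ k ≤ n` with `2^(k²) ≤ n²`, we have
`C((n−k+1)² + 2^(k²) − 1, 2^(k²) − 1) ≤ (10 n² / 2^(k²))^(2^(k²))`. -/
theorem choose_le_bound (n k : ℕ) (hk2 : 2 ≤ k) (hkn : k ≤ n)
    (h : 2 ^ (k ^ 2) ≤ n ^ 2) :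
    (Nat.choose ((n - k + 1) ^ 2 + 2 ^ (k ^ 2) - 1) (2 ^ (k ^ 2) - 1) : ℝ) ≤
      (10 * (n : ℝ) ^ 2 / 2 ^ (k ^ 2)) ^ (2 ^ (k ^ 2)) := by
  have hm0 : 0 < 2 ^ (k ^ 2) := by positivity
  have hcast : (2 : ℝ) ^ (k ^ 2) = ((2 ^ (k ^ 2) : ℕ) : ℝ) := by push_cast; rfl
  rw [hcast]
  generalize 2 ^ (k ^ 2) = m at *
  have h1 : (n - k + 1) ^ 2 ≤ n ^ 2 := Nat.pow_le_pow_left (by omega) 2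
  have h2 : Nat.choose ((n - k + 1) ^ 2 + m - 1) (m - 1) ≤ Nat.choose (2 * n ^ 2) m := by
    obtain ⟨r, rfl⟩ : ∃ r, m = r + 1 := ⟨m - 1, by omega⟩
    calc _ ≤ Nat.choose ((n - k + 1) ^ 2 + r + 1) (r + 1) := by
          rw [Nat.choose_succ_succ]
          exact Nat.le_add_right _ _
      _ ≤ _ := Nat.choose_le_choose _ (by omega)
  have hmR : (0 : ℝ) < m := by exact_mod_cast hm0
  have hf : (0 : ℝ) < (m.factorial : ℝ) := by exact_mod_cast m.factorial_pos
  have h3 : (m : ℝ) ^ m / m.factorial ≤ 5 ^ m := by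
    calc _ ≤ Real.exp m := Real.pow_div_factorial_le_exp _ hmR.le m
      _ = Real.exp 1 ^ m := by rw [← Real.exp_nat_mul, mul_one]
      _ ≤ 5 ^ m := pow_le_pow_left₀ (Real.exp_pos _).le
          (by linarith [Real.exp_one_lt_d9]) m
  have h4 := Nat.choose_le_pow_div (α := ℝ) m (2 * n ^ 2)
  calc (Nat.choose ((n - k + 1) ^ 2 + m - 1) (m - 1) : ℝ)
      ≤ (Nat.choose (2 * n ^ 2) m : ℝ) := by exact_mod_cast h2
    _ ≤ _ := h4
    _ = (2 * (n : ℝ) ^ 2 / m) ^ m * ((m : ℝ) ^ m / m.factorial) := by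
        push_cast
        rw [div_pow]
        field_simp
    _ ≤ (2 * (n : ℝ) ^ 2 / m) ^ m * 5 ^ m := by gcongr
    _ = _ := by
        rw [← mul_pow]
        congr 1
        ring
end

section
/- For all integers n and k with 2 ≤ k ≤ n and 2^(k²) ≤ n², the probability that a uniformly random picture of size n is reconstructible from its k-deck is at most (10 n² / 2^(k²))^(2^(k²)) · 2^(−n²). -/
open Filter

lemma card_recon_le (n k : ℕ) (s : Finset (Fin n × Fin n → Bool))
    (hs : ∀ P ∈ s, Reconstructible n k P) :
    s.card ≤ (2 ^ (k ^ 2)).multichoose ((n - k + 1) ^ 2) := by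
  classical
  have hc : Fintype.card (Sym (Fin k × Fin k → Bool) ((n - k + 1) ^ 2)) =
      (2 ^ (k ^ 2)).multichoose ((n - k + 1) ^ 2) := by
    rw [Sym.card_sym_eq_multichoose]
    simp [sq]
  rw [← hc, ← Finset.card_univ]
  refine Finset.card_le_card_of_injOn
    (fun P => (⟨deck n k P, by simp [deck, sq]⟩ :
      Sym (Fin k × Fin k → Bool) ((n - k + 1) ^ 2))) (fun _ _ => Finset.mem_coe.mpr (Finset.mem_univ _)) ?_
  intro P _ Q hQ hPQ
  exact hs Q hQ P (congrArg Subtype.val hPQ)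

lemma multichoose_bound (N m M : ℕ) (hN : 0 < N) (hm : m ≤ M) (hNM : N ≤ M) :
    ((N.multichoose m : ℕ) : ℝ) ≤ (10 * (M : ℝ) / N) ^ N := by
  have h1 : N.multichoose m ≤ (2 * M).choose N := by
    rw [Nat.multichoose_eq]
    calc (N + m - 1).choose m ≤ (N + m).choose m := Nat.choose_le_choose _ (by omega)
      _ = (N + m).choose N := by rw [← Nat.choose_symm_add]
      _ ≤ (2 * M).choose N := Nat.choose_le_choose _ (by omega)
  have hN' : (0 : ℝ) < N := by exact_mod_cast hN
  have h2 : ((2 * M).choose N : ℝ) ≤ ((2 * M : ℕ) : ℝ) ^ N / (N.factorial : ℝ) :=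
    Nat.choose_le_pow_div N (2 * M)
  have h3 : (N : ℝ) ^ N / (N.factorial : ℝ) ≤ 5 ^ N := by
    calc (N : ℝ) ^ N / (N.factorial : ℝ) ≤ Real.exp N :=
          Real.pow_div_factorial_le_exp _ hN'.le N
      _ = Real.exp 1 ^ N := by rw [← Real.exp_nat_mul, mul_one]
      _ ≤ 5 ^ N := by
          have := Real.exp_one_lt_d9
          gcongr
          linarith
  calc ((N.multichoose m : ℕ) : ℝ) ≤ ((2 * M).choose N : ℝ) := by exact_mod_cast h1
    _ ≤ ((2 * M : ℕ) : ℝ) ^ N / (N.factorial : ℝ) := h2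
    _ = (2 * (M : ℝ) / N) ^ N * ((N : ℝ) ^ N / (N.factorial : ℝ)) := by
        rw [div_pow]
        push_cast
        field_simp
    _ ≤ (2 * (M : ℝ) / N) ^ N * 5 ^ N := by gcongr
    _ = (10 * (M : ℝ) / N) ^ N := by
        rw [← mul_pow]
        congr 1
        ring

/-- For `2 ≤ k ≤ n` with `2^(k²) ≤ n²`, the probability that a
uniformly random picture of size `n` is reconstructible from its `k`-deck is at
most `(10 n² / 2^(k²))^(2^(k²)) · 2^(−n²)`. -/
theorem reconProb_le_bound (n k : ℕ) (hk2 : 2 ≤ k) (hkn : k ≤ n)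
    (h : 2 ^ (k ^ 2) ≤ n ^ 2) :
    reconProb n k ≤
      (10 * (n : ℝ) ^ 2 / 2 ^ (k ^ 2)) ^ (2 ^ (k ^ 2)) * ((2 : ℝ) ^ (n ^ 2))⁻¹ := by
  classical
  unfold reconProb
  rw [div_eq_mul_inv]
  refine mul_le_mul_of_nonneg_right ?_ (by positivity)
  have hb := multichoose_bound (2 ^ (k ^ 2)) ((n - k + 1) ^ 2) (n ^ 2) (by positivity)
    (Nat.pow_le_pow_left (by omega) 2) h
  push_cast at hb
  refine le_trans ?_ hb
  exact_mod_cast card_recon_le n k _ (fun P hP => (Finset.mem_filter.mp hP).2)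
end

section
/- Let k_c(n) be the unique integer m such that m − 3/4 ≤ (2 log₂ n)^(1/2) < m + 1/4, and let k : ℕ → ℕ satisfy k(n) > k_c(n) for all sufficiently large n. Then k(n) · n² / 2^(k(n)² − k(n)) → 0 as n → ∞. -/
open Filter

/-- If `kc` is the threshold function (defined for `n ≥ 2` by
`kc n − 3/4 ≤ √(2 log₂ n) < kc n + 1/4`) and `k n > kc n` for all sufficiently
large `n`, then `k n · n² / 2^(k n² − k n) → 0`. -/
theorem above_threshold_entropy (kc k : ℕ → ℕ)
    (hkc : ∀ n : ℕ, 2 ≤ n →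
      (kc n : ℝ) - 3 / 4 ≤ Real.sqrt (2 * Real.logb 2 n) ∧
        Real.sqrt (2 * Real.logb 2 n) < (kc n : ℝ) + 1 / 4)
    (hk : ∀ᶠ n : ℕ in atTop, kc n < k n) :
    Tendsto (fun n : ℕ => (k n : ℝ) * (n : ℝ) ^ 2 / 2 ^ (k n ^ 2 - k n)) atTop
      (nhds 0) := by
  have hlog : Tendsto (fun n : ℕ => Real.sqrt (2 * Real.logb 2 n)) atTop atTop := by
    refine Real.tendsto_sqrt_atTop.comp ?_
    refine Tendsto.const_mul_atTop (by norm_num) ?_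
    exact (Real.tendsto_logb_atTop (by norm_num)).comp tendsto_natCast_atTop_atTop
  have hlt : ∀ᶠ n : ℕ in atTop, Real.sqrt (2 * Real.logb 2 n) < (k n : ℝ) - 3 / 4 := by
    filter_upwards [hk, eventually_ge_atTop 2] with n hn h2
    have h := (hkc n h2).2
    have h' : (kc n : ℝ) + 1 ≤ k n := by exact_mod_cast hn
    linarith
  have hkt : Tendsto k atTop atTop := by
    rw [← tendsto_natCast_atTop_iff (R := ℝ)]
    refine tendsto_atTop_mono' _ ?_ hlog
    filter_upwards [hlt] with n hn
    linarith
  set r : ℝ := (2 : ℝ) ^ (-(1 / 2) : ℝ) with hr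
  have hr0 : 0 ≤ r := by positivity
  have hr1 : r < 1 := Real.rpow_lt_one_of_one_lt_of_neg (by norm_num) (by norm_num)
  have hlim : Tendsto (fun n : ℕ => 2 * ((k n : ℝ) * r ^ (k n))) atTop (nhds 0) := by
    have := ((tendsto_self_mul_const_pow_of_lt_one hr0 hr1).comp hkt).const_mul 2
    simpa using this
  refine squeeze_zero' (Eventually.of_forall fun n => by positivity) ?_ hlim
  filter_upwards [hlt, eventually_ge_atTop 2] with n hn h2
  have hn0 : (0 : ℝ) < n := by positivity
  have hl0 : 0 ≤ Real.logb 2 n :=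
    Real.logb_nonneg (by norm_num) (by exact_mod_cast (by omega : 1 ≤ n))
  have hs0 := Real.sqrt_nonneg (2 * Real.logb 2 n)
  have hsq := Real.sq_sqrt (by positivity : 0 ≤ 2 * Real.logb 2 n)
  have hb : 2 * Real.logb 2 n ≤ ((k n : ℝ) ^ 2 - k n) + 1 + (-(1 / 2)) * k n := by
    nlinarith
  have hn2 : (n : ℝ) ^ 2 = (2 : ℝ) ^ (2 * Real.logb 2 n) := by
    rw [mul_comm, Real.rpow_mul (by norm_num), Real.rpow_logb (by norm_num) (by norm_num) hn0]
    norm_cast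
  have hle : k n ≤ k n ^ 2 := Nat.le_self_pow (by norm_num) _
  have hpow : (2 : ℝ) ^ ((k n : ℝ) ^ 2 - k n) = 2 ^ (k n ^ 2 - k n) := by
    rw [← Real.rpow_natCast 2 (k n ^ 2 - k n), Nat.cast_sub hle, Nat.cast_pow]
  have hmain : (n : ℝ) ^ 2 ≤ 2 ^ (k n ^ 2 - k n) * 2 * r ^ (k n) := by
    calc (n : ℝ) ^ 2 = (2 : ℝ) ^ (2 * Real.logb 2 n) := hn2
      _ ≤ (2 : ℝ) ^ (((k n : ℝ) ^ 2 - k n) + 1 + (-(1 / 2)) * k n) :=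
          Real.rpow_le_rpow_of_exponent_le (by norm_num) hb
      _ = _ := by
          rw [Real.rpow_add (by norm_num), Real.rpow_add (by norm_num), hpow, Real.rpow_one,
            Real.rpow_mul (by norm_num), Real.rpow_natCast]
  rw [div_le_iff₀ (by positivity)]
  calc (k n : ℝ) * (n : ℝ) ^ 2 ≤ k n * (2 ^ (k n ^ 2 - k n) * 2 * r ^ (k n)) := by gcongr
    _ = _ := by ring
end
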